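/- Let h be any nonzero integer. For X > 0, let N_h(3,X) denote the number of GL₂(ℤ)-equivalence classes of integral binary cubic forms F with 0 < |disc(F)| < X such that F is maximal, F locally represents h everywhere, and F(x,y) = h has no solution (x,y) ∈ ℤ²; let N(3,X) denote the total number of GL₂(ℤ)-equivalence classes of integral binary cubic forms F with 0 < |disc(F)| < X. Then liminf_{X→∞} N_h(3,X)/N(3,X) > 0. -/

import Mathlib

open Finset

/-- Evaluation of the binary form of degree `n` with coefficient vector `c` at `(x, y)`:
`c 0 * x^n + c 1 * x^(n-1) * y + ⋯ + c n * y^n`. -/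
def binEval {n : ℕ} {R : Type*} [CommRing R] (c : Fin (n + 1) → R) (x y : R) : R :=
  ∑ i : Fin (n + 1), c i * x ^ (n - (i : ℕ)) * y ^ (i : ℕ)

/-- The binary form with coefficient vector `c` as an element of `MvPolynomial (Fin 2) R`. -/
noncomputable def formPolyR {n : ℕ} {R : Type*} [CommRing R] (c : Fin (n + 1) → R) :
    MvPolynomial (Fin 2) R :=
  ∑ i : Fin (n + 1), MvPolynomial.C (c i) * MvPolynomial.X 0 ^ (n - (i : ℕ)) *
    MvPolynomial.X 1 ^ (i : ℕ)

/-- The binary form with integer coefficient vector `c`, base-changed to `R`. -/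
noncomputable def formPoly {n : ℕ} (R : Type*) [CommRing R] (c : Fin (n + 1) → ℤ) :
    MvPolynomial (Fin 2) R :=
  formPolyR (fun i => ((c i : R)))

/-- `F(X, 1)` over `R`, for the binary form with integer coefficient vector `c`. -/
noncomputable def formPolyX {n : ℕ} (R : Type*) [CommRing R] (c : Fin (n + 1) → ℤ) :
    Polynomial R :=
  ∑ i : Fin (n + 1), Polynomial.C ((c i : R)) * Polynomial.X ^ (n - (i : ℕ))

/-- `IsDisc c D`: the binary form with coefficient vector `c` factors over `ℂ` as
`∏ (αᵢ x - βᵢ y)` and `D = ∏_{i<j} (αᵢ βⱼ - αⱼ βᵢ)²` is its discriminant. -/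
def IsDisc {n : ℕ} (c : Fin (n + 1) → ℤ) (D : ℤ) : Prop :=
  ∃ α β : Fin n → ℂ,
    (∀ x y : ℂ, binEval (fun i => ((c i : ℂ))) x y = ∏ i : Fin n, (α i * x - β i * y)) ∧
    (D : ℂ) = ∏ i : Fin n, ∏ j ∈ Finset.univ.filter (fun j => i < j),
      (α i * β j - α j * β i) ^ 2

/-- `G` is a maximal form: it is not a proper subform of any integral binary form. -/
def IsMaximalForm {n : ℕ} (G : Fin (n + 1) → ℤ) : Prop :=
  ¬ ∃ (F : Fin (n + 1) → ℤ) (a b c d : ℤ), 1 < |a * d - b * c| ∧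
      ∀ x y : ℤ, binEval G x y = binEval F (a * x + b * y) (c * x + d * y)

/-- `GL₂(ℤ)`-equivalence of integral binary forms. -/
def FormEquiv {n : ℕ} (F G : Fin (n + 1) → ℤ) : Prop :=
  ∃ a b c d : ℤ, |a * d - b * c| = 1 ∧
    ∀ x y : ℤ, binEval G x y = binEval F (a * x + b * y) (c * x + d * y)

/-- The form locally represents `h` everywhere: over `ℝ` and over `ℤ_p` for all primes `p`. -/
def LocallyRep {n : ℕ} (c : Fin (n + 1) → ℤ) (h : ℤ) : Prop :=
  (∃ x y : ℝ, binEval (fun i => ((c i : ℝ))) x y = (h : ℝ)) ∧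
  ∀ (p : ℕ) (hp : p.Prime),
    haveI : Fact p.Prime := ⟨hp⟩
    ∃ x y : ℤ_[p], binEval (fun i => ((c i : ℤ_[p]))) x y = (h : ℤ_[p])

/-- The integral binary form is primitive: the gcd of its coefficients is 1. -/
def IsPrimitiveForm {n : ℕ} (c : Fin (n + 1) → ℤ) : Prop :=
  ∀ d : ℤ, (∀ i, d ∣ c i) → IsUnit d

/-- The form splits completely modulo `p`: modulo `p` it is a product of pairwise
non-proportional linear forms over `ℤ/pℤ`. -/
def SplitsCompletelyMod (p : ℕ) {n : ℕ} (c : Fin (n + 1) → ℤ) : Prop :=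
  ∃ L : Fin n → ZMod p × ZMod p,
    (∀ i j, i ≠ j → (L i).1 * (L j).2 ≠ (L j).1 * (L i).2) ∧
    formPoly (ZMod p) c =
      ∏ i : Fin n, (MvPolynomial.C (L i).1 * MvPolynomial.X 0 +
        MvPolynomial.C (L i).2 * MvPolynomial.X 1)

section BasicAlgebra

variable {R : Type*} [CommRing R]

lemma binEval_cubic (c : Fin 4 → R) (x y : R) :
    binEval (n := 3) c x y = c 0 * x ^ 3 + c 1 * x ^ 2 * y + c 2 * x * y ^ 2 + c 3 * y ^ 3 := by
  simp [binEval, Fin.sum_univ_four]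

/-- The discriminant of a binary cubic form, as a polynomial in its coefficients. -/
def cubicDisc (c : Fin 4 → R) : R :=
  c 1 ^ 2 * c 2 ^ 2 - 4 * c 0 * c 2 ^ 3 - 4 * c 1 ^ 3 * c 3 - 27 * c 0 ^ 2 * c 3 ^ 2 +
    18 * c 0 * c 1 * c 2 * c 3

/-- Leading coefficient of the Hessian covariant. -/
def hessA (c : Fin 4 → R) : R := c 1 ^ 2 - 3 * c 0 * c 2

/-- Middle coefficient of the Hessian covariant. -/
def hessB (c : Fin 4 → R) : R := c 1 * c 2 - 9 * c 0 * c 3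

/-- Last coefficient of the Hessian covariant. -/
def hessC (c : Fin 4 → R) : R := c 2 ^ 2 - 3 * c 1 * c 3

/-- The Hessian covariant. -/
def hessVal (c : Fin 4 → R) (x y : R) : R := hessA c * x ^ 2 + hessB c * x * y + hessC c * y ^ 2

/-- Leading coefficient of the cubic covariant. -/
def covU (c : Fin 4 → R) : R := 2 * c 1 ^ 3 + 27 * c 0 ^ 2 * c 3 - 9 * c 0 * c 1 * c 2

/-- The form `F(px + qy, rx + sy)`. -/
def substForm (c : Fin 4 → R) (p q r s : R) : Fin 4 → R :=
  ![c 0 * p ^ 3 + c 1 * p ^ 2 * r + c 2 * p * r ^ 2 + c 3 * r ^ 3,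
    3 * c 0 * p ^ 2 * q + c 1 * (p ^ 2 * s + 2 * p * q * r) + c 2 * (q * r ^ 2 + 2 * p * r * s) +
      3 * c 3 * r ^ 2 * s,
    3 * c 0 * p * q ^ 2 + c 1 * (q ^ 2 * r + 2 * p * q * s) + c 2 * (p * s ^ 2 + 2 * q * r * s) +
      3 * c 3 * r * s ^ 2,
    c 0 * q ^ 3 + c 1 * q ^ 2 * s + c 2 * q * s ^ 2 + c 3 * s ^ 3]

lemma binEval_substForm (c : Fin 4 → R) (p q r s x y : R) :
    binEval (n := 3) (substForm c p q r s) x y =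
      binEval (n := 3) c (p * x + q * y) (r * x + s * y) := by
  simp only [binEval_cubic, substForm, Matrix.cons_val]
  ring

lemma cubicDisc_substForm (c : Fin 4 → R) (p q r s : R) :
    cubicDisc (substForm c p q r s) = (p * s - q * r) ^ 6 * cubicDisc c := by
  simp only [cubicDisc, substForm, Matrix.cons_val]
  ring

lemma hessA_substForm (c : Fin 4 → R) (p q r s : R) :
    hessA (substForm c p q r s) = (p * s - q * r) ^ 2 * hessVal c p r := by
  simp only [hessA, hessB, hessC, hessVal, substForm, Matrix.cons_val]
  ring

lemma hessB_substForm (c : Fin 4 → R) (p q r s : R) :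
    hessB (substForm c p q r s) = (p * s - q * r) ^ 2 *
      (2 * hessA c * p * q + hessB c * (p * s + q * r) + 2 * hessC c * r * s) := by
  simp only [hessA, hessB, hessC, substForm, Matrix.cons_val]
  ring

lemma hessC_substForm (c : Fin 4 → R) (p q r s : R) :
    hessC (substForm c p q r s) = (p * s - q * r) ^ 2 * hessVal c q s := by
  simp only [hessA, hessB, hessC, hessVal, substForm, Matrix.cons_val]
  ring

lemma hessVal_substForm (c : Fin 4 → R) (p q r s x y : R) :
    hessVal (substForm c p q r s) x y =
      (p * s - q * r) ^ 2 * hessVal c (p * x + q * y) (r * x + s * y) := by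
  rw [hessVal, hessA_substForm, hessB_substForm, hessC_substForm]
  simp only [hessVal]
  ring

lemma hess_disc (c : Fin 4 → R) :
    4 * hessA c * hessC c - hessB c ^ 2 = 3 * cubicDisc c := by
  simp only [hessA, hessB, hessC, cubicDisc]
  ring

lemma cubic_syzygy (c : Fin 4 → R) :
    covU c ^ 2 + 27 * c 0 ^ 2 * cubicDisc c = 4 * hessA c ^ 3 := by
  simp only [hessA, covU, cubicDisc]
  ring

lemma substForm_substForm (c : Fin 4 → R) (p q r s p' q' r' s' : R) :
    substForm (substForm c p q r s) p' q' r' s' =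
      substForm c (p * p' + q * r') (p * q' + q * s') (r * p' + s * r') (r * q' + s * s') := by
  funext i
  fin_cases i <;> simp [substForm] <;> ring

lemma substForm_one (c : Fin 4 → R) : substForm c 1 0 0 1 = c := by
  funext i
  fin_cases i <;> simp [substForm]

end BasicAlgebra

lemma cubic_ext_int {F G : Fin 4 → ℤ}
    (h : ∀ x y : ℤ, binEval (n := 3) F x y = binEval (n := 3) G x y) : F = G := by
  have h1 := h 1 0
  have h2 := h 0 1
  have h3 := h 1 1
  have h4 := h 1 (-1)
  simp only [binEval_cubic] at h1 h2 h3 h4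
  funext i
  fin_cases i <;> simp <;> linarith

lemma formEquiv_iff {F G : Fin 4 → ℤ} :
    FormEquiv (n := 3) F G ↔ ∃ p q r s : ℤ, |p * s - q * r| = 1 ∧ G = substForm F p q r s := by
  constructor
  · rintro ⟨p, q, r, s, hd, h⟩
    exact ⟨p, q, r, s, hd, cubic_ext_int fun x y => by rw [h, binEval_substForm]⟩
  · rintro ⟨p, q, r, s, hd, rfl⟩
    exact ⟨p, q, r, s, hd, fun x y => binEval_substForm ..⟩

lemma formEquiv_equivalence : Equivalence (FormEquiv (n := 3)) where
  refl F := formEquiv_iff.2 ⟨1, 0, 0, 1, by simp, (substForm_one F).symm⟩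
  symm := by
    intro F G h
    obtain ⟨p, q, r, s, hd, rfl⟩ := formEquiv_iff.1 h
    have h2 : (p * s - q * r) * (p * s - q * r) = 1 := by
      rw [← abs_mul_abs_self, hd, one_mul]
    set e := p * s - q * r with he
    refine formEquiv_iff.2 ⟨e * s, -(e * q), -(e * r), e * p, ?_, ?_⟩
    · have : e * s * (e * p) - -(e * q) * -(e * r) = e := by linear_combination e * h2 - e * e * he
      rw [this, hd]
    · rw [substForm_substForm]
      have e1 : p * (e * s) + q * -(e * r) = 1 := by linear_combination h2 - e * he
      have e2 : p * -(e * q) + q * (e * p) = 0 := by ring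
      have e3 : r * (e * s) + s * -(e * r) = 0 := by ring
      have e4 : r * -(e * q) + s * (e * p) = 1 := by linear_combination h2 - e * he
      rw [e1, e2, e3, e4, substForm_one]
  trans := by
    intro F G H h1 h2
    obtain ⟨p, q, r, s, hd, rfl⟩ := formEquiv_iff.1 h1
    obtain ⟨p', q', r', s', hd', rfl⟩ := formEquiv_iff.1 h2
    refine formEquiv_iff.2 ⟨_, _, _, _, ?_, substForm_substForm ..⟩
    have : (p * p' + q * r') * (r * q' + s * s') - (p * q' + q * s') * (r * p' + s * r') =
        (p * s - q * r) * (p' * s' - q' * r') := by ring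
    rw [this, abs_mul, hd, hd', one_mul]

lemma quot_mk_eq_iff {F G : Fin 4 → ℤ} :
    Quot.mk (FormEquiv (n := 3)) F = Quot.mk (FormEquiv (n := 3)) G ↔ FormEquiv (n := 3) F G :=
  ⟨fun h => (formEquiv_equivalence.eqvGen_iff).1 (Quot.eqvGen_exact h), Quot.sound⟩

lemma eq_cubicDisc_of_isDisc {c : Fin 4 → ℤ} {D : ℤ} (h : IsDisc (n := 3) c D) :
    D = cubicDisc c := by
  obtain ⟨α, β, h, hD⟩ := h
  have h1 := h 1 0
  have h2 := h 0 1
  have h3 := h 1 1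
  have h4 := h 1 (-1)
  simp only [binEval_cubic, Fin.prod_univ_three] at h1 h2 h3 h4
  have e0 : (c 0 : ℂ) = α 0 * α 1 * α 2 := by linear_combination h1
  have e3 : (c 3 : ℂ) = -(β 0 * β 1 * β 2) := by linear_combination h2
  have e1 : (c 1 : ℂ) = -(α 0 * α 1 * β 2 + α 0 * β 1 * α 2 + β 0 * α 1 * α 2) := by
    linear_combination (h3 - h4) / 2 - h2
  have e2 : (c 2 : ℂ) = α 0 * β 1 * β 2 + β 0 * α 1 * β 2 + β 0 * β 1 * α 2 := by
    linear_combination (h3 + h4) / 2 - h1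
  have hf0 : (univ.filter fun j : Fin 3 => 0 < j) = {1, 2} := by decide
  have hf1 : (univ.filter fun j : Fin 3 => 1 < j) = {2} := by decide
  have hf2 : (univ.filter fun j : Fin 3 => 2 < j) = ∅ := by decide
  rw [Fin.prod_univ_three, hf0, hf1, hf2, prod_pair (by decide), prod_singleton, prod_empty] at hD
  have : (D : ℂ) = (cubicDisc c : ℤ) := by
    rw [hD]
    simp only [cubicDisc]
    push_cast
    rw [e0, e1, e2, e3]
    ring
  exact_mod_cast this

lemma isDisc_cubicDisc {c : Fin 4 → ℤ} (h0 : c 0 ≠ 0) : IsDisc (n := 3) c (cubicDisc c) := by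
  have h0' : (c 0 : ℂ) ≠ 0 := by exact_mod_cast h0
  obtain ⟨u, hu⟩ := IsAlgClosed.exists_root
    (Polynomial.C (c 0 : ℂ) * Polynomial.X ^ 3 + Polynomial.C (c 1 : ℂ) * Polynomial.X ^ 2 +
      Polynomial.C (c 2 : ℂ) * Polynomial.X + Polynomial.C (c 3 : ℂ))
    (by rw [Polynomial.degree_cubic h0']; decide)
  obtain ⟨v, hv⟩ := IsAlgClosed.exists_root
    (Polynomial.C (c 0 : ℂ) * Polynomial.X ^ 2 + Polynomial.C (c 1 + c 0 * u : ℂ) * Polynomial.X +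
      Polynomial.C (c 2 + c 1 * u + c 0 * u ^ 2 : ℂ))
    (by rw [Polynomial.degree_quadratic h0']; decide)
  simp only [Polynomial.IsRoot.def, Polynomial.eval_add, Polynomial.eval_mul, Polynomial.eval_C,
    Polynomial.eval_pow, Polynomial.eval_X] at hu hv
  obtain ⟨w, hw⟩ : ∃ w : ℂ, c 1 = -(c 0 * (u + v + w)) :=
    ⟨-(c 1 / c 0) - u - v, by field_simp; ring⟩
  have e2 : (c 2 : ℂ) = c 0 * (u * v + u * w + v * w) := by
    linear_combination hv - (u + v) * hw
  have e3 : (c 3 : ℂ) = -(c 0 * (u * v * w)) := by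
    linear_combination hu - u * e2 - u ^ 2 * hw
  refine ⟨![c 0, 1, 1], ![c 0 * u, v, w], fun x y => ?_, ?_⟩
  · simp only [binEval_cubic, Fin.prod_univ_three, Matrix.cons_val]
    rw [e2, e3, hw]
    ring
  · have hf0 : (univ.filter fun j : Fin 3 => 0 < j) = {1, 2} := by decide
    have hf1 : (univ.filter fun j : Fin 3 => 1 < j) = {2} := by decide
    have hf2 : (univ.filter fun j : Fin 3 => 2 < j) = ∅ := by decide
    rw [Fin.prod_univ_three, hf0, hf1, hf2, prod_pair (by decide), prod_singleton, prod_empty]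
    simp only [cubicDisc, Matrix.cons_val]
    push_cast
    rw [e2, e3, hw]
    ring

section PadeCoefficients

/-- The integer `3 ^ m * r (r + 3) ⋯ (r + 3 (m - 1)) / m!`. -/
def triBinom (r m : ℕ) : ℕ := 3 ^ m * (∏ i ∈ range m, (r + 3 * i)) / m.factorial

lemma factorial_dvd_three_pow_mul_prod (r m : ℕ) :
    m.factorial ∣ 3 ^ m * ∏ i ∈ range m, (r + 3 * i) := by
  obtain ⟨v, m', h3, hm⟩ := Nat.exists_eq_pow_mul_and_not_dvd (Nat.factorial_ne_zero m) 3 (by norm_num)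
  have hv : v ≤ m := by
    have h1 : padicValNat 3 m.factorial = v := by
      have : Fact (Nat.Prime 3) := ⟨Nat.prime_three⟩
      rw [hm, padicValNat.mul (by positivity) (by rintro rfl; simp at h3), padicValNat.prime_pow,
        padicValNat.eq_zero_of_not_dvd h3, add_zero]
    have : Fact (Nat.Prime 3) := ⟨Nat.prime_three⟩
    have h2 := sub_one_mul_padicValNat_factorial (p := 3) m
    rw [h1] at h2
    omega
  have hm0 : m' ≠ 0 := by rintro rfl; simp at h3
  have hco : Nat.Coprime 3 m' := (Nat.Prime.coprime_iff_not_dvd Nat.prime_three).2 h3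
  have hm' : m' ∣ ∏ i ∈ range m, (r + 3 * i) := by
    obtain ⟨t, ht⟩ : ∃ t : ℕ, 3 * t ≡ r [MOD m'] := by
      obtain ⟨u, hu, hur⟩ := Nat.chineseRemainder hco 0 r
      obtain ⟨t, rfl⟩ := (Nat.modEq_zero_iff_dvd.1 hu)
      exact ⟨t, hur⟩
    have h1 : ∏ i ∈ range m, (r + 3 * i) ≡ ∏ i ∈ range m, 3 * (t + i) [MOD m'] := by
      refine Nat.ModEq.prod fun i _ => ?_
      rw [mul_add]
      exact ht.symm.add_right _
    rw [prod_mul_distrib] at h1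
    refine (h1.dvd_iff dvd_rfl).2 (Dvd.dvd.mul_left ?_ _)
    rw [← Nat.ascFactorial_eq_prod_range]
    exact (Dvd.intro_left _ hm.symm).trans (Nat.factorial_dvd_ascFactorial _ _)
  rw [hm]
  exact mul_dvd_mul (pow_dvd_pow 3 hv) hm'

lemma triBinom_mul_factorial (r m : ℕ) :
    triBinom r m * m.factorial = 3 ^ m * ∏ i ∈ range m, (r + 3 * i) :=
  Nat.div_mul_cancel (factorial_dvd_three_pow_mul_prod r m)

lemma triBinom_le (r m : ℕ) : triBinom (3 * r + 2) m ≤ 9 ^ m * (r + m).choose m := by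
  rw [triBinom]
  refine Nat.div_le_of_le_mul ?_
  have h1 : ∏ i ∈ range m, (3 * r + 2 + 3 * i) ≤ ∏ i ∈ range m, 3 * (r + 1 + i) :=
    prod_le_prod' fun i _ => by omega
  rw [prod_mul_distrib, ← Nat.ascFactorial_eq_prod_range, Nat.ascFactorial_eq_factorial_mul_choose,
    prod_const, card_range] at h1
  calc _ ≤ 3 ^ m * (3 ^ m * (m.factorial * (r + m).choose m)) := by gcongr
    _ = _ := by rw [show (9 : ℕ) = 3 * 3 by norm_num, mul_pow]; ring

/-- Coefficients of the Padé approximants to the cube root. -/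
def padeCoeff (n k : ℕ) : ℕ := triBinom (3 * k + 2) (n - k) * triBinom (3 * (n - k) + 4) k

lemma sum_padeCoeff_le (n : ℕ) : ∑ k ∈ range (n + 1), padeCoeff n k ≤ 2 * 36 ^ n := by
  have h1 : ∀ k ∈ range (n + 1), padeCoeff n k ≤ n.choose k * (9 ^ n * 2 ^ (n + 1)) := by
    intro k hk
    have hk : k ≤ n := by simpa [Nat.lt_succ_iff] using hk
    have h2 := triBinom_le k (n - k)
    have h3 : triBinom (3 * (n - k) + 4) k ≤ 9 ^ k * (n - k + 1 + k).choose k :=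
      le_trans (by
        rw [triBinom, triBinom]
        gcongr ?_ / _
        refine Nat.mul_le_mul_left _ (prod_le_prod' fun i _ => ?_)
        omega) (triBinom_le (n - k + 1) k)
    rw [show k + (n - k) = n by omega, Nat.choose_symm hk] at h2
    rw [show n - k + 1 + k = n + 1 by omega] at h3
    calc padeCoeff n k ≤ (9 ^ (n - k) * n.choose k) * (9 ^ k * (n + 1).choose k) := by
          rw [padeCoeff]; gcongr
      _ = n.choose k * (9 ^ (n - k + k) * (n + 1).choose k) := by rw [pow_add]; ring
      _ ≤ n.choose k * (9 ^ n * 2 ^ (n + 1)) := by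
          rw [show n - k + k = n by omega]
          gcongr
          exact Nat.choose_le_two_pow _ _
  refine (sum_le_sum h1).trans ?_
  rw [← sum_mul, Nat.sum_range_choose, show (36 : ℕ) = 2 * 9 * 2 by norm_num, mul_pow, mul_pow]
  exact le_of_eq (by ring)

/-- `2 · 5 · 8 ⋯ (3 m - 1)`. -/
def prodTwo (m : ℕ) : ℕ := ∏ i ∈ range m, (3 * i + 2)

/-- `1 · 4 · 7 ⋯ (3 m - 2)`. -/
def prodOne (m : ℕ) : ℕ := ∏ i ∈ range m, (3 * i + 1)

lemma prodTwo_pos (m : ℕ) : 0 < prodTwo m := prod_pos fun _ _ => by omega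

lemma prodOne_pos (m : ℕ) : 0 < prodOne m := prod_pos fun _ _ => by omega

lemma padeCoeff_mul (k m : ℕ) :
    padeCoeff (k + m) k * (k.factorial * m.factorial * prodTwo k * prodOne (m + 1)) =
      3 ^ (k + m) * prodTwo (k + m) * prodOne (k + m + 1) := by
  have h1 : triBinom (3 * k + 2) m * m.factorial = 3 ^ m * ∏ i ∈ range m, (3 * k + 2 + 3 * i) :=
    triBinom_mul_factorial _ _
  have h2 : triBinom (3 * m + 4) k * k.factorial = 3 ^ k * ∏ i ∈ range k, (3 * m + 4 + 3 * i) :=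
    triBinom_mul_factorial _ _
  have h3 : prodTwo (k + m) = prodTwo k * ∏ i ∈ range m, (3 * k + 2 + 3 * i) := by
    rw [prodTwo, prod_range_add, prodTwo]
    congr 1
    exact prod_congr rfl fun i _ => by ring
  have h4 : prodOne (k + m + 1) = prodOne (m + 1) * ∏ i ∈ range k, (3 * m + 4 + 3 * i) := by
    rw [show k + m + 1 = (m + 1) + k by ring, prodOne, prod_range_add, prodOne]
    congr 1
    exact prod_congr rfl fun i _ => by ring
  rw [padeCoeff, Nat.add_sub_cancel_left, h3, h4]
  calc _ = (triBinom (3 * k + 2) m * m.factorial) * (triBinom (3 * m + 4) k * k.factorial) *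
        (prodTwo k * prodOne (m + 1)) := by ring
    _ = _ := by rw [h1, h2, pow_add]; ring

lemma padeCoeff_eq {n k : ℕ} (hk : k ≤ n) :
    (padeCoeff n k : ℚ) = 3 ^ n * prodTwo n * prodOne (n + 1) /
      (k.factorial * (n - k).factorial * prodTwo k * prodOne (n - k + 1)) := by
  obtain ⟨m, rfl⟩ := Nat.exists_eq_add_of_le hk
  have h := padeCoeff_mul k m
  have := prodTwo_pos k
  have := prodOne_pos (m + 1)
  rw [Nat.add_sub_cancel_left, eq_div_iff (by positivity)]
  exact_mod_cast h

lemma prod_range_erase {M : Type*} [CommMonoid M] (f : ℕ → M) (k m : ℕ) :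
    ∏ j ∈ (range (k + m + 1)).erase k, f j =
      (∏ j ∈ range k, f (k - 1 - j)) * ∏ j ∈ range m, f (k + 1 + j) := by
  have h : ∏ j ∈ (range (k + m + 1)).erase k, f j =
      ∏ j ∈ range (k + (m + 1)), if j = k then 1 else f j := by
    rw [← mul_prod_erase (range (k + (m + 1))) _ (a := k) (by simp), if_pos rfl, one_mul]
    exact prod_congr rfl fun j hj => by rw [if_neg (ne_of_mem_erase hj)]
  rw [h, prod_range_add, prod_range_succ', add_zero, if_pos rfl, mul_one]
  congr 1
  · rw [prod_range_reflect f k]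
    exact prod_congr rfl fun j hj => by rw [if_neg (by simp at hj; omega)]
  · exact prod_congr rfl fun j hj => by rw [if_neg (by omega)]; congr 1; ring

lemma node_weight_same (k m : ℕ) :
    ∏ j ∈ (range (k + m + 1)).erase k, ((3 * k : ℚ) - 3 * j) =
      (-1) ^ m * 3 ^ (k + m) * (k.factorial * m.factorial) := by
  rw [prod_range_erase]
  have h1 : ∏ j ∈ range k, ((3 * k : ℚ) - 3 * ((k - 1 - j : ℕ) : ℚ)) = 3 ^ k * k.factorial := by
    rw [← prod_range_add_one_eq_factorial]
    push_cast
    rw [← card_range k, ← prod_const, card_range, ← prod_mul_distrib]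
    refine prod_congr rfl fun j hj => ?_
    have : k = (k - 1 - j) + (j + 1) := by simp at hj; omega
    have : (k : ℚ) = ((k - 1 - j : ℕ) : ℚ) + (j + 1) := by exact_mod_cast this
    linear_combination 3 * this
  have h2 : ∏ j ∈ range m, ((3 * k : ℚ) - 3 * ((k + 1 + j : ℕ) : ℚ)) =
      (-1) ^ m * 3 ^ m * m.factorial := by
    rw [← prod_range_add_one_eq_factorial, ← mul_pow]
    push_cast
    rw [← card_range m, ← prod_const, card_range, ← prod_mul_distrib]
    exact prod_congr rfl fun j hj => by ring
  rw [h1, h2, pow_add]; ring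

lemma node_weight_left (k m : ℕ) :
    ∏ j ∈ range (k + m + 1), ((3 * k : ℚ) - (3 * j + 1)) =
      (-1) ^ (m + 1) * (prodTwo k * prodOne (m + 1)) := by
  rw [show k + m + 1 = k + (m + 1) by ring, prod_range_add, prodTwo, prodOne]
  have h1 : ∏ j ∈ range k, ((3 * k : ℚ) - (3 * j + 1)) = ∏ i ∈ range k, (3 * (i : ℚ) + 2) := by
    rw [← prod_range_reflect]
    refine prod_congr rfl fun j hj => ?_
    have : k = (k - 1 - j) + (j + 1) := by simp at hj; omega
    have : (k : ℚ) = ((k - 1 - j : ℕ) : ℚ) + (j + 1) := by exact_mod_cast this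
    linear_combination 3 * this
  have h2 : ∏ j ∈ range (m + 1), ((3 * k : ℚ) - (3 * ((k + j : ℕ) : ℚ) + 1)) =
      (-1) ^ (m + 1) * ∏ i ∈ range (m + 1), (3 * (i : ℚ) + 1) := by
    rw [← card_range (m + 1), ← prod_const, card_range, ← prod_mul_distrib]
    exact prod_congr rfl fun j hj => by push_cast; ring
  rw [h1, h2]
  push_cast
  ring

lemma node_weight_right (k m : ℕ) :
    ∏ j ∈ range (k + m + 1), ((3 * k + 1 : ℚ) - 3 * j) =
      (-1) ^ m * (prodOne (k + 1) * prodTwo m) := by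
  rw [show k + m + 1 = (k + 1) + m by ring, prod_range_add, prodTwo, prodOne]
  have h1 : ∏ j ∈ range (k + 1), ((3 * k + 1 : ℚ) - 3 * j) =
      ∏ i ∈ range (k + 1), (3 * (i : ℚ) + 1) := by
    rw [← prod_range_reflect]
    refine prod_congr rfl fun j hj => ?_
    have : k = (k + 1 - 1 - j) + j := by simp at hj; omega
    have : (k : ℚ) = ((k + 1 - 1 - j : ℕ) : ℚ) + j := by exact_mod_cast this
    linear_combination 3 * this
  have h2 : ∏ j ∈ range m, ((3 * k + 1 : ℚ) - 3 * ((k + 1 + j : ℕ) : ℚ)) =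
      (-1) ^ m * ∏ i ∈ range m, (3 * (i : ℚ) + 2) := by
    rw [← card_range m, ← prod_const, card_range, ← prod_mul_distrib]
    exact prod_congr rfl fun j hj => by push_cast; ring
  rw [h1, h2]
  push_cast
  ring

/-- The moment identities defining the Padé approximants. -/
lemma padeCoeff_moment (n : ℕ) (p : Polynomial ℚ) (hp : p.natDegree ≤ 2 * n) :
    ∑ k ∈ range (n + 1), (padeCoeff n (n - k) : ℚ) * p.eval (3 * k + 1 : ℚ) =
      ∑ k ∈ range (n + 1), (padeCoeff n k : ℚ) * p.eval (3 * k : ℚ) := by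
  set s : Finset (ℕ ⊕ ℕ) := (range (n + 1)).disjSum (range (n + 1)) with hs
  set v : ℕ ⊕ ℕ → ℚ := Sum.elim (fun k => 3 * (k : ℚ)) (fun k => 3 * (k : ℚ) + 1) with hv
  have hcard : #s = 2 * n + 2 := by rw [hs, card_disjSum, card_range]; ring
  have hinj : Set.InjOn v s := by
    rintro (a | a) - (b | b) - hab <;> simp only [hv, Sum.elim_inl, Sum.elim_inr] at hab
    · congr 1; exact_mod_cast (by linarith : (a : ℚ) = b)
    · exfalso
      have : 3 * a = 3 * b + 1 := by exact_mod_cast hab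
      omega
    · exfalso
      have : 3 * a + 1 = 3 * b := by exact_mod_cast hab
      omega
    · congr 1; exact_mod_cast (by linarith : (a : ℚ) = b)
  have h := Lagrange.coeff_eq_sum hinj (P := p) (by
    rw [hcard]
    exact lt_of_le_of_lt p.degree_le_natDegree (by exact_mod_cast (by omega)))
  rw [Polynomial.coeff_eq_zero_of_natDegree_lt (by omega), hs, sum_disjSum] at h
  have hE1 : ∀ k, ((range (n + 1)).disjSum (range (n + 1))).erase (Sum.inl k) =
      ((range (n + 1)).erase k).disjSum (range (n + 1)) := by
    intro k; ext (a | a) <;> simp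
  have hE2 : ∀ k, ((range (n + 1)).disjSum (range (n + 1))).erase (Sum.inr k) =
      (range (n + 1)).disjSum ((range (n + 1)).erase k) := by
    intro k; ext (a | a) <;> simp
  set κ : ℚ := 3 ^ (2 * n) * prodTwo n * prodOne (n + 1) with hκ
  have hl : ∑ k ∈ range (n + 1), p.eval (v (Sum.inl k)) /
      ∏ j ∈ ((range (n + 1)).disjSum (range (n + 1))).erase (Sum.inl k), (v (Sum.inl k) - v j) =
      - (∑ k ∈ range (n + 1), (padeCoeff n k : ℚ) * p.eval (3 * k : ℚ)) / κ := by
    rw [neg_div, sum_div, ← sum_neg_distrib]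
    refine sum_congr rfl fun k hk => ?_
    obtain ⟨m, rfl⟩ := Nat.exists_eq_add_of_le (Nat.lt_succ_iff.1 (mem_range.1 hk))
    rw [hE1, prod_disjSum, padeCoeff_eq (by omega)]
    simp only [hv, Sum.elim_inl, Sum.elim_inr]
    rw [node_weight_same, node_weight_left, Nat.add_sub_cancel_left, hκ]
    have := prodTwo_pos k
    have := prodOne_pos (m + 1)
    have := prodTwo_pos (k + m)
    have := prodOne_pos (k + m + 1)
    have h1 : ((-1 : ℚ) ^ m) * (-1) ^ m = 1 := by rw [← mul_pow]; simp
    have h0 : ((-1 : ℚ) ^ m) ≠ 0 := by positivity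
    field_simp
    linear_combination (-(p.eval (3 * (k : ℚ)) * 3 ^ (2 * (k + m)))) * h1
  have hr : ∑ k ∈ range (n + 1), p.eval (v (Sum.inr k)) /
      ∏ j ∈ ((range (n + 1)).disjSum (range (n + 1))).erase (Sum.inr k), (v (Sum.inr k) - v j) =
      (∑ k ∈ range (n + 1), (padeCoeff n (n - k) : ℚ) * p.eval (3 * k + 1 : ℚ)) / κ := by
    rw [sum_div]
    refine sum_congr rfl fun k hk => ?_
    obtain ⟨m, rfl⟩ := Nat.exists_eq_add_of_le (Nat.lt_succ_iff.1 (mem_range.1 hk))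
    rw [hE2, prod_disjSum, padeCoeff_eq (by omega)]
    simp only [hv, Sum.elim_inl, Sum.elim_inr, add_sub_add_right_eq_sub]
    rw [node_weight_same, node_weight_right, Nat.add_sub_cancel_left, hκ, Nat.add_sub_cancel]
    have := prodTwo_pos m
    have := prodOne_pos (k + 1)
    have := prodTwo_pos (k + m)
    have := prodOne_pos (k + m + 1)
    have h1 : ((-1 : ℚ) ^ m) * (-1) ^ m = 1 := by rw [← mul_pow]; simp
    field_simp
    linear_combination (-(p.eval (3 * (k : ℚ) + 1) * 3 ^ (2 * (k + m)))) * h1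
  have hκ0 : κ ≠ 0 := by
    have := prodTwo_pos n
    have := prodOne_pos (n + 1)
    positivity
  rw [hl, hr] at h
  field_simp at h
  linarith

end PadeCoefficients

section PadeApproximation

lemma padeCoeff_moment_pow (n m : ℕ) (hm : m ≤ 2 * n) :
    ∑ k ∈ range (n + 1), (padeCoeff n (n - k) : ℂ) * (3 * k + 1 : ℂ) ^ m =
      ∑ k ∈ range (n + 1), (padeCoeff n k : ℂ) * (3 * k : ℂ) ^ m := by
  have h := padeCoeff_moment n (Polynomial.X ^ m) (by simpa using hm)
  simp only [Polynomial.eval_pow, Polynomial.eval_X] at h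
  have h2 := congrArg (fun q : ℚ => (q : ℂ)) h
  push_cast at h2
  exact h2

lemma padeCoeff_moment_choose (n j : ℕ) (hj : j ≤ 2 * n) :
    ∑ k ∈ range (n + 1), (padeCoeff n (n - k) : ℂ) * ((3 * k + 1).choose j : ℂ) =
      ∑ k ∈ range (n + 1), (padeCoeff n k : ℂ) * ((3 * k).choose j : ℂ) := by
  have h := padeCoeff_moment n (descPochhammer ℚ j) (by simpa using hj)
  have h1 : ∀ e : ℕ, (descPochhammer ℚ j).eval (e : ℚ) = j.factorial * e.choose j := by
    intro e
    rw [descPochhammer_eval_eq_descFactorial, Nat.descFactorial_eq_factorial_mul_choose]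
    push_cast
    rfl
  have h2 : ∑ k ∈ range (n + 1), (padeCoeff n (n - k) : ℚ) * ((3 * k + 1).choose j : ℚ) =
      ∑ k ∈ range (n + 1), (padeCoeff n k : ℚ) * ((3 * k).choose j : ℚ) := by
    have h3 : (j.factorial : ℚ) ≠ 0 := by positivity
    apply mul_left_cancel₀ h3
    rw [mul_sum, mul_sum]
    convert h using 2 with k _ k _
    · have := h1 (3 * k + 1)
      push_cast at this
      rw [this]; ring
    · have := h1 (3 * k)
      push_cast at this
      rw [this]; ring
  exact_mod_cast congrArg (fun q : ℚ => (q : ℂ)) h2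

/-- Denominator-type Padé polynomial. -/
noncomputable def padeP (n : ℕ) : Polynomial ℂ :=
  ∑ k ∈ range (n + 1), Polynomial.monomial k (padeCoeff n k : ℂ)

/-- Numerator-type Padé polynomial. -/
noncomputable def padeQ (n : ℕ) : Polynomial ℂ :=
  ∑ k ∈ range (n + 1), Polynomial.monomial k (padeCoeff n (n - k) : ℂ)

/-- The remainder `w Q(w³) - P(w³)`. -/
noncomputable def padeR (n : ℕ) : Polynomial ℂ :=
  Polynomial.X * Polynomial.expand ℂ 3 (padeQ n) - Polynomial.expand ℂ 3 (padeP n)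

lemma padeR_eq (n : ℕ) : padeR n =
    ∑ k ∈ range (n + 1), Polynomial.monomial (3 * k + 1) (padeCoeff n (n - k) : ℂ) -
      ∑ k ∈ range (n + 1), Polynomial.monomial (3 * k) (padeCoeff n k : ℂ) := by
  rw [padeR, padeQ, padeP, map_sum, map_sum, mul_sum]
  congr 1
  · refine sum_congr rfl fun k _ => ?_
    rw [Polynomial.expand_monomial, Polynomial.X_mul_monomial, mul_comm]
  · refine sum_congr rfl fun k _ => ?_
    rw [Polynomial.expand_monomial, mul_comm]

lemma pow_dvd_padeR (n : ℕ) :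
    (Polynomial.X - Polynomial.C (1 : ℂ)) ^ (2 * n + 1) ∣ padeR n := by
  have h : (Polynomial.X : Polynomial ℂ) ^ (2 * n + 1) ∣ Polynomial.taylor 1 (padeR n) := by
    rw [Polynomial.X_pow_dvd_iff]
    intro j hj
    have h2 : ∀ (e : ℕ) (c : ℂ), (Polynomial.taylor 1 (Polynomial.monomial e c)).coeff j =
        c * e.choose j := by
      intro e c
      rw [Polynomial.taylor_monomial, Polynomial.coeff_C_mul, map_one, 
        Polynomial.coeff_X_add_one_pow]
    rw [padeR_eq, map_sub, map_sum, map_sum, Polynomial.coeff_sub, Polynomial.finsetSum_coeff,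
      Polynomial.finsetSum_coeff, sub_eq_zero]
    simp only [h2]
    exact padeCoeff_moment_choose n j (by omega)
  obtain ⟨S, hS⟩ := h
  refine ⟨Polynomial.taylor (-1) S, ?_⟩
  have h3 := congrArg (Polynomial.taylor (-1 : ℂ)) hS
  rw [Polynomial.taylor_taylor, Polynomial.taylor_mul, Polynomial.taylor_pow,
    Polynomial.taylor_X] at h3
  simpa [sub_eq_add_neg] using h3

lemma padeP_coeff (n k : ℕ) : (padeP n).coeff k = if k ≤ n then (padeCoeff n k : ℂ) else 0 := by
  rw [padeP, Polynomial.finsetSum_coeff]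
  simp [Polynomial.coeff_monomial]

lemma padeQ_coeff (n k : ℕ) :
    (padeQ n).coeff k = if k ≤ n then (padeCoeff n (n - k) : ℂ) else 0 := by
  rw [padeQ, Polynomial.finsetSum_coeff]
  simp [Polynomial.coeff_monomial]

lemma padeP_natDegree (n : ℕ) : (padeP n).natDegree ≤ n :=
  Polynomial.natDegree_le_iff_coeff_eq_zero.2 fun k hk => by rw [padeP_coeff, if_neg (by omega)]

lemma padeQ_natDegree (n : ℕ) : (padeQ n).natDegree ≤ n :=
  Polynomial.natDegree_le_iff_coeff_eq_zero.2 fun k hk => by rw [padeQ_coeff, if_neg (by omega)]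

/-- The determinant of consecutive Padé approximants. -/
noncomputable def padeDet (n : ℕ) : Polynomial ℂ :=
  padeP n * padeQ (n + 1) - padeP (n + 1) * padeQ n

lemma triBinom_pos {r : ℕ} (hr : 0 < r) (m : ℕ) : 0 < triBinom r m := by
  have h := triBinom_mul_factorial r m
  have h1 : 0 < 3 ^ m * ∏ i ∈ range m, (r + 3 * i) :=
    Nat.mul_pos (by positivity) (prod_pos fun i _ => by omega)
  rw [← h] at h1
  exact Nat.pos_of_mul_pos_right h1

lemma triBinom_succ (r m : ℕ) :
    triBinom r (m + 1) * (m + 1) = 3 * (r + 3 * m) * triBinom r m := by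
  have h := triBinom_mul_factorial r m
  have h1 := triBinom_mul_factorial r (m + 1)
  rw [prod_range_succ, Nat.factorial_succ, pow_succ] at h1
  apply Nat.eq_of_mul_eq_mul_right (Nat.factorial_pos m)
  calc _ = triBinom r (m + 1) * ((m + 1) * m.factorial) := by ring
    _ = 3 * (r + 3 * m) * (3 ^ m * ∏ i ∈ range m, (r + 3 * i)) := by rw [h1]; ring
    _ = _ := by rw [← h]; ring

lemma padeDet_coeff_ne (n : ℕ) : (padeDet n).coeff (2 * n + 1) ≠ 0 := by
  rw [padeDet, Polynomial.coeff_sub, show 2 * n + 1 = n + (n + 1) by ring,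
    Polynomial.coeff_mul_add_eq_of_natDegree_le (padeP_natDegree n) (padeQ_natDegree (n + 1)),
    show n + (n + 1) = (n + 1) + n by ring,
    Polynomial.coeff_mul_add_eq_of_natDegree_le (padeP_natDegree (n + 1)) (padeQ_natDegree n)]
  simp only [padeP_coeff, padeQ_coeff, le_refl, if_true, padeCoeff, Nat.sub_self, Nat.sub_zero,
    mul_zero, zero_add]
  have h0 : ∀ r, triBinom r 0 = 1 := fun r => by simp [triBinom]
  simp only [h0, one_mul, mul_one]
  have h1 := triBinom_succ 2 n
  have h2 := triBinom_succ 4 n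
  have h3 := triBinom_pos (r := 2) (by norm_num) n
  have h4 := triBinom_pos (r := 4) (by norm_num) n
  intro h
  have h5 : triBinom 4 n * triBinom 2 (n + 1) = triBinom 4 (n + 1) * triBinom 2 n := by
    exact_mod_cast sub_eq_zero.1 h
  have h6 : 3 * (2 + 3 * n) * (triBinom 4 n * triBinom 2 n) =
      3 * (4 + 3 * n) * (triBinom 4 n * triBinom 2 n) := by
    calc _ = triBinom 4 n * (triBinom 2 (n + 1) * (n + 1)) := by rw [h1]; ring
      _ = (triBinom 4 n * triBinom 2 (n + 1)) * (n + 1) := by ring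
      _ = (triBinom 4 (n + 1) * (n + 1)) * triBinom 2 n := by rw [h5]; ring
      _ = _ := by rw [h2]; ring
  have := Nat.eq_of_mul_eq_mul_right (Nat.mul_pos h4 h3) h6
  omega

lemma padeDet_natDegree (n : ℕ) : (padeDet n).natDegree ≤ 2 * n + 1 := by
  have h1 := padeP_natDegree n
  have h2 := padeQ_natDegree n
  have h3 := padeP_natDegree (n + 1)
  have h4 := padeQ_natDegree (n + 1)
  refine (Polynomial.natDegree_sub_le _ _).trans (max_le ?_ ?_)
  · exact Polynomial.natDegree_mul_le.trans (by omega)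
  · exact Polynomial.natDegree_mul_le.trans (by omega)

lemma pow_dvd_expand_padeDet (n : ℕ) :
    (Polynomial.X - Polynomial.C (1 : ℂ)) ^ (2 * n + 1) ∣ Polynomial.expand ℂ 3 (padeDet n) := by
  have h : (Polynomial.X - Polynomial.C (1 : ℂ)) ^ (2 * n + 1) ∣
      Polynomial.X * Polynomial.expand ℂ 3 (padeDet n) := by
    have e : Polynomial.X * Polynomial.expand ℂ 3 (padeDet n) =
        Polynomial.expand ℂ 3 (padeP n) * padeR (n + 1) -
          Polynomial.expand ℂ 3 (padeP (n + 1)) * padeR n := by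
      rw [padeDet, padeR, padeR, map_sub, map_mul, map_mul]
      ring
    rw [e]
    refine dvd_sub (Dvd.dvd.mul_left ((pow_dvd_pow _ (by omega)).trans (pow_dvd_padeR (n + 1))) _)
      (Dvd.dvd.mul_left (pow_dvd_padeR n) _)
  refine IsCoprime.dvd_of_dvd_mul_left (IsCoprime.pow_left ?_) h
  exact ⟨-1, 1, by simp⟩

lemma padeDet_eval_ne {x : ℂ} (hx : x ≠ 1) (n : ℕ) : (padeDet n).eval x ≠ 0 := by
  have h0 : padeDet n ≠ 0 := by
    intro h
    have := padeDet_coeff_ne n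
    rw [h] at this
    simp at this
  obtain ⟨E, hE, hE1⟩ := Polynomial.exists_eq_pow_rootMultiplicity_mul_and_not_dvd _ h0 (1 : ℂ)
  set r := (padeDet n).rootMultiplicity 1 with hr
  rw [Polynomial.dvd_iff_isRoot, Polynomial.IsRoot] at hE1
  have hr1 : 2 * n + 1 ≤ r := by
    by_contra hlt
    have h1 := pow_dvd_expand_padeDet n
    have e : Polynomial.expand ℂ 3 (padeDet n) = (Polynomial.X - Polynomial.C (1 : ℂ)) ^ r *
        ((1 + Polynomial.X + Polynomial.X ^ 2) ^ r * Polynomial.expand ℂ 3 E) := by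
      rw [hE, map_mul, map_pow, map_sub, Polynomial.expand_X, Polynomial.expand_C, ← mul_assoc,
        ← mul_pow]
      congr 2
      rw [map_one]
      ring
    rw [e] at h1
    have h2 : (Polynomial.X - Polynomial.C (1 : ℂ)) ^ (r + 1) ∣ (Polynomial.X - Polynomial.C 1) ^ r *
        ((1 + Polynomial.X + Polynomial.X ^ 2) ^ r * Polynomial.expand ℂ 3 E) :=
      (pow_dvd_pow _ (by omega)).trans h1
    rw [pow_succ, mul_dvd_mul_iff_left (pow_ne_zero _ (Polynomial.X_sub_C_ne_zero 1)),
      Polynomial.dvd_iff_isRoot, Polynomial.IsRoot, Polynomial.eval_mul, Polynomial.eval_pow,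
      Polynomial.expand_eval] at h2
    simp only [Polynomial.eval_add, Polynomial.eval_one, Polynomial.eval_X, Polynomial.eval_pow,
      one_pow] at h2
    exact mul_ne_zero (pow_ne_zero _ (by norm_num)) hE1 h2
  have hE0 : E ≠ 0 := by rintro rfl; simp at hE1
  have hdeg := padeDet_natDegree n
  rw [hE, Polynomial.natDegree_mul (pow_ne_zero _ (Polynomial.X_sub_C_ne_zero 1)) hE0,
    Polynomial.natDegree_pow, Polynomial.natDegree_X_sub_C, mul_one] at hdeg
  have hE2 : E = Polynomial.C (E.coeff 0) := Polynomial.eq_C_of_natDegree_eq_zero (by omega)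
  rw [hE, Polynomial.eval_mul, Polynomial.eval_pow]
  refine mul_ne_zero (pow_ne_zero _ ?_) ?_
  · simpa [sub_eq_zero] using hx
  · rw [hE2] at hE1 ⊢
    simpa using hE1

lemma norm_padeP_eval_le (n : ℕ) {x : ℂ} (hx : ‖x‖ ≤ 1) : ‖(padeP n).eval x‖ ≤ 2 * 36 ^ n := by
  rw [padeP, Polynomial.eval_finsetSum]
  calc _ ≤ ∑ k ∈ range (n + 1), (padeCoeff n k : ℝ) := by
        refine norm_sum_le_of_le _ fun k _ => ?_
        rw [Polynomial.eval_monomial, norm_mul, norm_pow, Complex.norm_natCast]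
        exact mul_le_of_le_one_right (by positivity) (pow_le_one₀ (norm_nonneg _) hx)
    _ ≤ _ := by exact_mod_cast sum_padeCoeff_le n

lemma exp_tail_le {θ u : ℝ} (hθ : 0 ≤ θ) (hθ1 : θ ≤ 1) (hu : 0 ≤ u) (N : ℕ) :
    Real.exp (θ * u) - ∑ m ∈ range N, (θ * u) ^ m / m.factorial ≤ θ ^ N * Real.exp u := by
  have h1 : HasSum (fun m : ℕ => (θ * u) ^ m / m.factorial) (Real.exp (θ * u)) := by
    rw [Real.exp_eq_exp_ℝ]; exact NormedSpace.expSeries_div_hasSum_exp _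
  have h2 : HasSum (fun m : ℕ => u ^ m / m.factorial) (Real.exp u) := by
    rw [Real.exp_eq_exp_ℝ]; exact NormedSpace.expSeries_div_hasSum_exp _
  have h3 := (hasSum_nat_add_iff' N).2 h1
  have h4 := ((hasSum_nat_add_iff' N).2 h2).mul_left (θ ^ N)
  refine (hasSum_le (fun m => ?_) h3 h4).trans ?_
  · have : θ ^ (m + N) ≤ θ ^ N := pow_le_pow_of_le_one hθ hθ1 (by omega)
    rw [mul_pow, ← mul_div_assoc]
    gcongr
  · gcongr
    exact sub_le_self _ (sum_nonneg fun m _ => by positivity)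

lemma norm_padeR_eval_le (n : ℕ) {θ : ℝ} (hθ : |θ| ≤ 1) :
    ‖(padeR n).eval (Complex.exp (θ * Complex.I))‖ ≤
      4 * 36 ^ n * Real.exp (3 * n + 1) * |θ| ^ (2 * n + 1) := by
  set T : ℝ → ℂ := fun u => ∑ m ∈ range (2 * n + 1), (θ * Complex.I * u) ^ m / m.factorial with hT
  have hterm : ∀ u : ℝ, 0 ≤ u → u ≤ 3 * n + 1 → ‖Complex.exp (θ * Complex.I * u) - T u‖ ≤
      |θ| ^ (2 * n + 1) * Real.exp (3 * n + 1) := by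
    intro u hu hun
    have h1 := Complex.norm_exp_sub_sum_le_exp_norm_sub_sum (θ * Complex.I * u) (2 * n + 1)
    have h2 : ‖(θ * Complex.I * u : ℂ)‖ = |θ| * u := by
      rw [norm_mul, norm_mul, Complex.norm_I, Complex.norm_real, Complex.norm_real,
        Real.norm_eq_abs, Real.norm_eq_abs, abs_of_nonneg hu, mul_one]
    rw [h2] at h1
    refine (h1.trans (exp_tail_le (abs_nonneg θ) hθ hu _)).trans ?_
    gcongr
  have hmom : ∑ k ∈ range (n + 1), (padeCoeff n (n - k) : ℂ) * T (3 * k + 1) =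
      ∑ k ∈ range (n + 1), (padeCoeff n k : ℂ) * T (3 * k) := by
    simp only [hT, mul_sum]
    rw [sum_comm, sum_comm (s := range (n + 1))]
    refine sum_congr rfl fun m hm => ?_
    have h := padeCoeff_moment_pow n m (by simp at hm; omega)
    have h' := congrArg (fun z => (θ * Complex.I) ^ m / m.factorial * z) h
    simp only [mul_sum] at h'
    convert h' using 2 with k _ k _
    · push_cast; rw [mul_pow]; ring
    · push_cast; rw [mul_pow]; ring
  have heval : (padeR n).eval (Complex.exp (θ * Complex.I)) =
      ∑ k ∈ range (n + 1), (padeCoeff n (n - k) : ℂ) *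
        (Complex.exp (θ * Complex.I * (3 * k + 1 : ℝ)) - T (3 * k + 1)) -
      ∑ k ∈ range (n + 1), (padeCoeff n k : ℂ) *
        (Complex.exp (θ * Complex.I * (3 * k : ℝ)) - T (3 * k)) := by
    rw [padeR_eq, Polynomial.eval_sub, Polynomial.eval_finsetSum, Polynomial.eval_finsetSum]
    simp only [mul_sub, sum_sub_distrib]
    rw [hmom]
    simp only [Polynomial.eval_monomial, ← Complex.exp_nat_mul]
    have e1 : ∀ k : ℕ, (((3 * k + 1 : ℕ) : ℂ)) * (θ * Complex.I) =
        θ * Complex.I * ((3 * k + 1 : ℝ) : ℂ) := by intro k; push_cast; ring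
    have e2 : ∀ k : ℕ, (((3 * k : ℕ) : ℂ)) * (θ * Complex.I) =
        θ * Complex.I * ((3 * k : ℝ) : ℂ) := by intro k; push_cast; ring
    simp only [e1, e2]
    ring
  have hs1 : ∑ k ∈ range (n + 1), (padeCoeff n k : ℝ) ≤ 2 * 36 ^ n := by
    exact_mod_cast sum_padeCoeff_le n
  have hs2 : ∑ k ∈ range (n + 1), (padeCoeff n (n - k) : ℝ) ≤ 2 * 36 ^ n := by
    have := sum_range_reflect (fun k => (padeCoeff n k : ℝ)) (n + 1)
    simp only [Nat.add_sub_cancel] at this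
    rwa [this]
  set B := |θ| ^ (2 * n + 1) * Real.exp (3 * n + 1) with hB
  have hB0 : 0 ≤ B := by positivity
  rw [heval]
  refine (norm_sub_le _ _).trans ?_
  have h1 : ‖∑ k ∈ range (n + 1), (padeCoeff n (n - k) : ℂ) *
        (Complex.exp (θ * Complex.I * (3 * k + 1 : ℝ)) - T (3 * k + 1))‖ ≤ 2 * 36 ^ n * B := by
    refine (norm_sum_le_of_le (n := fun k => (padeCoeff n (n - k) : ℝ) * B) _ fun k hk => ?_).trans ?_
    · rw [norm_mul, Complex.norm_natCast]
      have hk : (k : ℝ) ≤ n := by exact_mod_cast Nat.lt_succ_iff.1 (mem_range.1 hk)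
      exact mul_le_mul_of_nonneg_left (hterm _ (by positivity) (by linarith)) (by positivity)
    · rw [← sum_mul]; gcongr
  have h2 : ‖∑ k ∈ range (n + 1), (padeCoeff n k : ℂ) *
        (Complex.exp (θ * Complex.I * (3 * k : ℝ)) - T (3 * k))‖ ≤ 2 * 36 ^ n * B := by
    refine (norm_sum_le_of_le (n := fun k => (padeCoeff n k : ℝ) * B) _ fun k hk => ?_).trans ?_
    · rw [norm_mul, Complex.norm_natCast]
      have hk : (k : ℝ) ≤ n := by exact_mod_cast Nat.lt_succ_iff.1 (mem_range.1 hk)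
      exact mul_le_mul_of_nonneg_left (hterm _ (by positivity) (by linarith)) (by positivity)
    · rw [← sum_mul]; gcongr
  calc _ ≤ 2 * 36 ^ n * B + 2 * 36 ^ n * B := add_le_add h1 h2
    _ = _ := by rw [hB]; ring

end PadeApproximation

section ThueBound

/-- The square root `√(-3 D)` attached to a cubic form of positive discriminant. -/
noncomputable def resSqrt (D : ℤ) : ℂ := Complex.I * (Real.sqrt (3 * D) : ℝ)

lemma resSqrt_sq {D : ℤ} (hD : 0 < D) : resSqrt D ^ 2 = -3 * D := by
  have h : (0 : ℝ) ≤ 3 * D := by positivity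
  rw [resSqrt, mul_pow, Complex.I_sq, ← Complex.ofReal_pow, Real.sq_sqrt h]
  push_cast; ring

lemma conj_resSqrt (D : ℤ) : (starRingEnd ℂ) (resSqrt D) = -resSqrt D := by
  simp [resSqrt]

lemma norm_resSqrt (D : ℤ) : ‖resSqrt D‖ = Real.sqrt (3 * D) := by
  simp [resSqrt, abs_of_nonneg (Real.sqrt_nonneg _)]

/-- The cubic covariant of a binary cubic form. -/
def covG {R : Type*} [CommRing R] (c : Fin 4 → R) (x y : R) : R :=
  covU c * x ^ 3 + 3 * (c 1 ^ 2 * c 2 + 9 * c 0 * c 1 * c 3 - 6 * c 0 * c 2 ^ 2) * x ^ 2 * y -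
    3 * (c 1 * c 2 ^ 2 + 9 * c 0 * c 2 * c 3 - 6 * c 1 ^ 2 * c 3) * x * y ^ 2 -
    (2 * c 2 ^ 3 + 27 * c 0 * c 3 ^ 2 - 9 * c 1 * c 2 * c 3) * y ^ 3

lemma resolvent_identity {R : Type*} [CommRing R] (c : Fin 4 → R) (s x y : R)
    (hs : s ^ 2 = -3 * cubicDisc c) :
    (covU c + 3 * s * c 0) * (2 * hessA c * x + (hessB c + s) * y) ^ 3 =
      8 * hessA c ^ 3 * (covG c x y + 3 * s * binEval (n := 3) c x y) := by
  rw [binEval_cubic]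
  have h : (covU c + 3 * s * c 0) * (2 * hessA c * x + (hessB c + s) * y) ^ 3 -
      (s ^ 2 + 3 * cubicDisc c) *
      (covU c * (3 * (2 * hessA c * x + hessB c * y) * y ^ 2 + y ^ 3 * s) +
        3 * c 0 * (3 * (2 * hessA c * x + hessB c * y) ^ 2 * y +
          3 * (2 * hessA c * x + hessB c * y) * y ^ 2 * s +
          y ^ 3 * (s ^ 2 - 3 * cubicDisc c))) =
      8 * hessA c ^ 3 * (covG c x y + 3 * s * (c 0 * x ^ 3 + c 1 * x ^ 2 * y +
        c 2 * x * y ^ 2 + c 3 * y ^ 3)) := by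
    simp only [covG, covU, hessA, hessB, cubicDisc]
    ring
  rw [← h, hs]
  ring

lemma exists_cubic_resolvent (c : Fin 4 → ℤ) (hD : 0 < cubicDisc c) (hA : 0 < hessA c) :
    ∃ ξ : ℤ → ℤ → ℂ, (∀ x y, ‖ξ x y‖ ^ 2 = hessVal c x y) ∧
      (∀ x y, ∃ g : ℤ, 2 * ξ x y ^ 3 =
        g + 3 * binEval (n := 3) c x y * resSqrt (cubicDisc c)) ∧
      (∀ x y x' y', ∃ t : ℤ, 2 * (ξ x y * (starRingEnd ℂ) (ξ x' y')) =
        t + (y * x' - x * y' : ℤ) * resSqrt (cubicDisc c)) := by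
  have hsyz := cubic_syzygy c
  have hhd := hess_disc c
  set A : ℤ := hessA c
  set B : ℤ := hessB c
  set C : ℤ := hessC c
  set Δ : ℤ := cubicDisc c
  set s := resSqrt Δ with hs
  have hs2 : s ^ 2 = -3 * (Δ : ℂ) := resSqrt_sq hD
  have hsc : (starRingEnd ℂ) s = -s := conj_resSqrt _
  have hA' : (A : ℂ) ≠ 0 := by exact_mod_cast hA.ne'
  obtain ⟨α, hα⟩ := IsAlgClosed.exists_pow_nat_eq ((covU c + 3 * s * c 0) / 2 : ℂ)
    (n := 3) (by norm_num)
  have hαc : (starRingEnd ℂ) α ^ 3 = (covU c - 3 * s * c 0) / 2 := by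
    rw [← map_pow, hα]
    simp only [map_div₀, map_add, map_mul, map_intCast, map_ofNat, hsc]
    ring
  have hnorm : α * (starRingEnd ℂ) α = A := by
    have h3 : (α * (starRingEnd ℂ) α) ^ 3 = (A : ℂ) ^ 3 := by
      rw [mul_pow, hα, hαc]
      have := congrArg (fun z : ℤ => (z : ℂ)) hsyz
      push_cast at this
      linear_combination (1 / 4 : ℂ) * this - (9 / 4 : ℂ) * (c 0 : ℂ) ^ 2 * hs2
    rw [Complex.mul_conj] at h3 ⊢
    norm_cast at h3 ⊢
    have h4 : Complex.normSq α ^ 3 = (A : ℝ) ^ 3 := by exact_mod_cast h3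
    have := (pow_left_inj₀ (Complex.normSq_nonneg α) (by positivity) (by norm_num)).1 h4
    exact_mod_cast this
  set ξ : ℤ → ℤ → ℂ := fun x y => α * (x + (B + s) / (2 * A) * y) with hξ
  have hconj : ∀ x y, (starRingEnd ℂ) (ξ x y) =
      (starRingEnd ℂ) α * (x + (B - s) / (2 * A) * y) := by
    intro x y
    simp only [hξ, map_div₀, map_add, map_mul, map_intCast, map_ofNat, hsc, sub_eq_add_neg]
  have hdisc : (4 * A * C : ℂ) = B ^ 2 + 3 * Δ := by
    have := congrArg (fun z : ℤ => (z : ℂ)) hhd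
    push_cast at this
    linear_combination this
  have hprod : ∀ x y x' y', 2 * (ξ x y * (starRingEnd ℂ) (ξ x' y')) =
      ((2 * A * x * x' + B * (x * y' + x' * y) + 2 * C * y * y' : ℤ) : ℂ) +
        (y * x' - x * y' : ℤ) * s := by
    intro x y x' y'
    rw [hconj]
    calc _ = 2 * (α * (starRingEnd ℂ) α) * ((x + (B + s) / (2 * A) * y) *
        (x' + (B - s) / (2 * A) * y')) := by simp only [hξ]; ring
      _ = _ := by
        rw [hnorm]
        push_cast
        field_simp
        linear_combination (-(y * y' : ℂ)) * hs2 - (y * y' : ℂ) * hdisc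
  refine ⟨ξ, fun x y => ?_, fun x y => ?_, fun x y x' y' => ⟨_, hprod x y x' y'⟩⟩
  · have h := hprod x y x y
    rw [Complex.mul_conj, Complex.normSq_eq_norm_sq, mul_comm x y, sub_self] at h
    have h2 : (2 * ‖ξ x y‖ ^ 2 : ℝ) = 2 * (hessVal c x y : ℤ) := by
      have : ((2 * ‖ξ x y‖ ^ 2 : ℝ) : ℂ) = ((2 * (hessVal c x y : ℤ) : ℝ) : ℂ) := by
        push_cast
        push_cast at h
        rw [h]
        simp only [hessVal, A, B, C]
        push_cast
        ring
      exact_mod_cast this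
    linarith
  · refine ⟨covG c x y, ?_⟩
    have h := resolvent_identity (fun i => (c i : ℂ)) s x y (by
      rw [hs2]; simp [Δ, cubicDisc])
    have e1 : ((A : ℤ) : ℂ) = hessA (fun i => (c i : ℂ)) := by simp [A, hessA]
    have e2 : ((B : ℤ) : ℂ) = hessB (fun i => (c i : ℂ)) := by simp [B, hessB]
    have e3 : ((covU c : ℤ) : ℂ) = covU (fun i => (c i : ℂ)) := by simp [covU]
    have e4 : ((covG c x y : ℤ) : ℂ) = covG (fun i => (c i : ℂ)) x y := by
      simp [covG, covU]
    have e5 : ((binEval (n := 3) c x y : ℤ) : ℂ) =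
        binEval (n := 3) (fun i => (c i : ℂ)) x y := by simp [binEval_cubic]
    rw [← e1, ← e2, ← e3, ← e4, ← e5] at h
    simp only [hξ, mul_pow, hα]
    have h8 : (8 * (A : ℂ) ^ 3) ≠ 0 := mul_ne_zero (by norm_num) (pow_ne_zero 3 hA')
    apply mul_left_cancel₀ h8
    calc _ = (covU c + 3 * s * c 0) * (2 * A * x + (B + s) * y) ^ 3 := by
          field_simp
          ring
      _ = _ := by rw [h]; ring

/-- The ring `ℤ[√(-3 D)]`. -/
def resRing (D : ℤ) (hD : 0 < D) : Subring ℂ where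
  carrier := {z | ∃ p q : ℤ, z = p + q * resSqrt D}
  mul_mem' := by
    rintro _ _ ⟨p, q, rfl⟩ ⟨p', q', rfl⟩
    refine ⟨p * p' - 3 * D * q * q', p * q' + q * p', ?_⟩
    push_cast
    linear_combination (q * q' : ℂ) * resSqrt_sq hD
  one_mem' := ⟨1, 0, by simp⟩
  add_mem' := by
    rintro _ _ ⟨p, q, rfl⟩ ⟨p', q', rfl⟩
    exact ⟨p + p', q + q', by push_cast; ring⟩
  zero_mem' := ⟨0, 0, by simp⟩
  neg_mem' := by
    rintro _ ⟨p, q, rfl⟩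
    exact ⟨-p, -q, by push_cast; ring⟩

lemma one_le_norm_of_mem_resRing {D : ℤ} (hD : 0 < D) {z : ℂ} (hz : z ∈ resRing D hD)
    (h0 : z ≠ 0) : 1 ≤ ‖z‖ := by
  obtain ⟨p, q, rfl⟩ := hz
  have h1 : ‖(p + q * resSqrt D : ℂ)‖ ^ 2 = ((p ^ 2 + 3 * D * q ^ 2 : ℤ) : ℝ) := by
    rw [← Complex.normSq_eq_norm_sq]
    have h : (0 : ℝ) ≤ 3 * D := by positivity
    simp only [resSqrt, Complex.normSq_apply, Complex.add_re, Complex.add_im, Complex.mul_re,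
      Complex.mul_im, Complex.intCast_re, Complex.intCast_im, Complex.I_re, Complex.I_im,
      Complex.ofReal_re, Complex.ofReal_im]
    push_cast
    have := Real.sq_sqrt h
    linear_combination (q : ℝ) ^ 2 * this
  have h2 : (1 : ℤ) ≤ p ^ 2 + 3 * D * q ^ 2 := by
    by_contra hlt
    have h3 : 0 ≤ 3 * D * q ^ 2 := by positivity
    have h4 : p ^ 2 = 0 := by nlinarith [sq_nonneg p]
    have h5 : q ^ 2 = 0 := by nlinarith [sq_nonneg q]
    apply h0
    simp [pow_eq_zero_iff (two_ne_zero) |>.1 h4, pow_eq_zero_iff (two_ne_zero) |>.1 h5]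
  have h3 : (1 : ℝ) ≤ ‖(p + q * resSqrt D : ℂ)‖ ^ 2 := by rw [h1]; exact_mod_cast h2
  exact (one_le_sq_iff₀ (norm_nonneg _)).1 h3

end ThueBound

section ThueGap

lemma abs_arg_le_of_norm_eq_one {z : ℂ} (hz : ‖z‖ = 1) : |z.arg| ≤ Real.pi / 2 * ‖z - 1‖ := by
  have h1 : z = Complex.exp (Complex.I * z.arg) := by
    conv_lhs => rw [← Complex.norm_mul_exp_arg_mul_I z, hz]
    rw [Complex.ofReal_one, one_mul, mul_comm]
  have h2 : ‖z - 1‖ = ‖2 * Real.sin (z.arg / 2)‖ := by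
    conv_lhs => rw [h1]
    exact Complex.norm_exp_I_mul_ofReal_sub_one z.arg
  have h3 := Complex.abs_arg_le_pi z
  have h4 := Real.mul_abs_le_abs_sin (x := z.arg / 2) (by
    rw [abs_div, abs_of_pos (two_pos : (0 : ℝ) < 2)]; linarith)
  rw [h2, Real.norm_eq_abs, abs_mul, abs_of_pos (two_pos : (0 : ℝ) < 2)]
  rw [abs_div, abs_of_pos (two_pos : (0 : ℝ) < 2)] at h4
  have hpi := Real.pi_pos
  have h5 : |z.arg| = Real.pi / 2 * (2 * (2 / Real.pi * (|z.arg| / 2))) := by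
    field_simp
  rw [h5]
  gcongr

lemma exists_phase {z : ℂ} (hz : z ≠ 0) {d : ℝ} (hd : ‖(starRingEnd ℂ) z ^ 3 - z ^ 3‖ ≤ d) :
    ∃ (ω : ℂ) (θ : ℝ), ω ^ 3 = 1 ∧ (starRingEnd ℂ) z = ω * Complex.exp (θ * Complex.I) * z ∧
      |θ| ≤ Real.pi / 6 * (d / ‖z‖ ^ 3) := by
  set u : ℂ := ((starRingEnd ℂ) z / z) ^ 3 with hu
  have hzn : ‖z‖ ≠ 0 := norm_ne_zero_iff.2 hz
  have hun : ‖u‖ = 1 := by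
    rw [hu, norm_pow, norm_div, Complex.norm_conj, div_self hzn, one_pow]
  have h1 := abs_arg_le_of_norm_eq_one hun
  have h2 : ‖u - 1‖ ≤ d / ‖z‖ ^ 3 := by
    have : u - 1 = ((starRingEnd ℂ) z ^ 3 - z ^ 3) / z ^ 3 := by
      rw [hu, div_pow, sub_div, div_self (pow_ne_zero 3 hz)]
    rw [this, norm_div, norm_pow]
    gcongr
  refine ⟨(starRingEnd ℂ) z / (Complex.exp ((u.arg / 3 : ℝ) * Complex.I) * z), u.arg / 3,
    ?_, ?_, ?_⟩
  · have h3 : Complex.exp ((u.arg / 3 : ℝ) * Complex.I) ^ 3 = u := by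
      rw [← Complex.exp_nat_mul]
      conv_rhs => rw [← Complex.norm_mul_exp_arg_mul_I u, hun]
      rw [Complex.ofReal_one, one_mul]
      congr 1
      push_cast
      ring
    have hu0 : u ≠ 0 := by rw [← norm_ne_zero_iff, hun]; norm_num
    rw [div_pow, mul_pow, h3, mul_comm u, ← div_div, ← div_pow, ← hu, div_self hu0]
  · have := Complex.exp_ne_zero ((u.arg / 3 : ℝ) * Complex.I)
    field_simp
  · rw [abs_div, abs_of_pos (by norm_num : (0 : ℝ) < 3)]
    have hpi := Real.pi_pos
    calc |u.arg| / 3 ≤ Real.pi / 2 * ‖u - 1‖ / 3 := by gcongr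
      _ = Real.pi / 6 * ‖u - 1‖ := by ring
      _ ≤ _ := by gcongr

/-- Data of an integral point in the resolvent setting. -/
structure ResPoint (D : ℤ) (E : ℝ) (ω ξ : ℂ) (θ : ℝ) : Prop where
  ne_zero : ξ ≠ 0
  conj_eq : (starRingEnd ℂ) ξ = ω * Complex.exp (θ * Complex.I) * ξ
  phase_le : |θ| ≤ E / ‖ξ‖ ^ 3
  cube_ne : (starRingEnd ℂ) ξ ^ 3 ≠ ξ ^ 3
  cube_mem : ∃ p q : ℤ, 2 * ξ ^ 3 = p + q * resSqrt D

lemma norm_eq_one_of_cube {ω : ℂ} (h : ω ^ 3 = 1) : ‖ω‖ = 1 := by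
  have : ‖ω‖ ^ 3 = 1 := by rw [← norm_pow, h, norm_one]
  exact (pow_eq_one_iff_of_nonneg (norm_nonneg _) (by norm_num)).1 this

lemma norm_exp_mul_I_sub_one_le (θ : ℝ) : ‖Complex.exp (θ * Complex.I) - 1‖ ≤ |θ| := by
  rw [mul_comm, ← Real.norm_eq_abs]
  exact Real.norm_exp_I_mul_ofReal_sub_one_le

lemma ResPoint.gap {D : ℤ} {E : ℝ} {ω ξ₁ ξ₂ : ℂ} {θ₁ θ₂ : ℝ} (hω : ω ^ 3 = 1)
    (h₁ : ResPoint D E ω ξ₁ θ₁) (h₂ : ResPoint D E ω ξ₂ θ₂) (hle : ‖ξ₁‖ ≤ ‖ξ₂‖)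
    (hE : 0 ≤ E) (hdet : ∃ t r : ℤ, r ≠ 0 ∧ 2 * (ξ₁ * (starRingEnd ℂ) ξ₂) = t + r * resSqrt D) :
    Real.sqrt (3 * D) * ‖ξ₁‖ ^ 2 ≤ 2 * E * ‖ξ₂‖ := by
  obtain ⟨t, r, hr, h⟩ := hdet
  have hp1 := norm_pos_iff.2 h₁.ne_zero
  have hp2 := norm_pos_iff.2 h₂.ne_zero
  have hc : 2 * (ξ₂ * (starRingEnd ℂ) ξ₁) = t - r * resSqrt D := by
    have := congrArg (starRingEnd ℂ) h
    simp only [map_mul, map_add, map_ofNat, Complex.conj_conj, map_intCast, conj_resSqrt] at this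
    rw [mul_comm ξ₂, this]; ring
  have h3 : ξ₁ * (starRingEnd ℂ) ξ₂ - ξ₂ * (starRingEnd ℂ) ξ₁ = r * resSqrt D := by
    linear_combination (1 / 2 : ℂ) * h - (1 / 2 : ℂ) * hc
  have h4 : ξ₁ * (starRingEnd ℂ) ξ₂ - ξ₂ * (starRingEnd ℂ) ξ₁ =
      ω * ξ₁ * ξ₂ * ((Complex.exp (θ₂ * Complex.I) - 1) - (Complex.exp (θ₁ * Complex.I) - 1)) := by
    rw [h₁.conj_eq, h₂.conj_eq]; ring
  have h5 : Real.sqrt (3 * D) ≤ ‖(r * resSqrt D : ℂ)‖ := by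
    rw [norm_mul, norm_resSqrt, Complex.norm_intCast]
    refine le_mul_of_one_le_left (Real.sqrt_nonneg _) ?_
    exact_mod_cast Int.one_le_abs hr
  rw [← h3, h4, norm_mul, norm_mul, norm_mul, norm_eq_one_of_cube hω, one_mul] at h5
  have h6 : ‖(Complex.exp (θ₂ * Complex.I) - 1) - (Complex.exp (θ₁ * Complex.I) - 1)‖ ≤
      2 * (E / ‖ξ₁‖ ^ 3) := by
    refine (norm_sub_le _ _).trans ?_
    have e1 := (norm_exp_mul_I_sub_one_le θ₁).trans h₁.phase_le
    have e2 := (norm_exp_mul_I_sub_one_le θ₂).trans h₂.phase_le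
    have e3 : E / ‖ξ₂‖ ^ 3 ≤ E / ‖ξ₁‖ ^ 3 := by gcongr
    linarith
  calc Real.sqrt (3 * D) * ‖ξ₁‖ ^ 2 ≤ (‖ξ₁‖ * ‖ξ₂‖ * (2 * (E / ‖ξ₁‖ ^ 3))) * ‖ξ₁‖ ^ 2 := by
        gcongr
        exact h5.trans (by gcongr)
    _ = _ := by field_simp

/-- The auxiliary linear form built from the Padé approximants. -/
noncomputable def padeForm (n : ℕ) (ξ₁ ξ₂ : ℂ) : ℂ :=
  2 ^ (n + 1) * ξ₁ ^ (3 * n) * (ξ₁ * (starRingEnd ℂ) ξ₂ *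
    (padeP n).eval ((starRingEnd ℂ) ξ₁ ^ 3 / ξ₁ ^ 3) -
    ξ₂ * (starRingEnd ℂ) ξ₁ * (padeQ n).eval ((starRingEnd ℂ) ξ₁ ^ 3 / ξ₁ ^ 3))

lemma padeForm_mem {D : ℤ} (hD : 0 < D) {ξ₁ ξ₂ : ℂ} (h0 : ξ₁ ≠ 0) (n : ℕ)
    (h₁ : 2 * ξ₁ ^ 3 ∈ resRing D hD) (h₁' : 2 * (starRingEnd ℂ) ξ₁ ^ 3 ∈ resRing D hD)
    (h : 2 * (ξ₁ * (starRingEnd ℂ) ξ₂) ∈ resRing D hD)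
    (h' : 2 * (ξ₂ * (starRingEnd ℂ) ξ₁) ∈ resRing D hD) :
    padeForm n ξ₁ ξ₂ ∈ resRing D hD := by
  have key : ∀ a : ℕ → ℕ, 2 ^ n * ξ₁ ^ (3 * n) *
      ∑ k ∈ range (n + 1), (a k : ℂ) * ((starRingEnd ℂ) ξ₁ ^ 3 / ξ₁ ^ 3) ^ k ∈ resRing D hD := by
    intro a
    rw [mul_sum]
    refine sum_mem fun k hk => ?_
    have hk : k ≤ n := Nat.lt_succ_iff.1 (mem_range.1 hk)
    obtain ⟨m, rfl⟩ := Nat.exists_eq_add_of_le hk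
    have e : 2 ^ (k + m) * ξ₁ ^ (3 * (k + m)) *
        ((a k : ℂ) * ((starRingEnd ℂ) ξ₁ ^ 3 / ξ₁ ^ 3) ^ k) =
        a k * ((2 * (starRingEnd ℂ) ξ₁ ^ 3) ^ k * (2 * ξ₁ ^ 3) ^ m) := by
      have hk : ((starRingEnd ℂ) ξ₁ ^ 3 / ξ₁ ^ 3) ^ k * (ξ₁ ^ 3) ^ k =
          ((starRingEnd ℂ) ξ₁ ^ 3) ^ k := by
        rw [← mul_pow, div_mul_cancel₀ _ (pow_ne_zero 3 h0)]
      linear_combination (2 ^ (k + m) * (a k : ℂ) * (ξ₁ ^ 3) ^ m) * hk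
    rw [e]
    exact mul_mem (natCast_mem _ _) (mul_mem (pow_mem h₁' _) (pow_mem h₁ _))
  have hP := key (fun k => padeCoeff n k)
  have hQ := key (fun k => padeCoeff n (n - k))
  have e : padeForm n ξ₁ ξ₂ = 2 * (ξ₁ * (starRingEnd ℂ) ξ₂) * (2 ^ n * ξ₁ ^ (3 * n) *
      ∑ k ∈ range (n + 1), (padeCoeff n k : ℂ) * ((starRingEnd ℂ) ξ₁ ^ 3 / ξ₁ ^ 3) ^ k) -
      2 * (ξ₂ * (starRingEnd ℂ) ξ₁) * (2 ^ n * ξ₁ ^ (3 * n) *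
      ∑ k ∈ range (n + 1), (padeCoeff n (n - k) : ℂ) *
        ((starRingEnd ℂ) ξ₁ ^ 3 / ξ₁ ^ 3) ^ k) := by
    rw [padeForm, padeP, padeQ, Polynomial.eval_finsetSum, Polynomial.eval_finsetSum]
    simp only [Polynomial.eval_monomial]
    ring
  rw [e]
  exact sub_mem (mul_mem h hP) (mul_mem h' hQ)

lemma padeForm_ne_zero {ξ₁ ξ₂ : ℂ} (h1 : ξ₁ ≠ 0) (h2 : ξ₂ ≠ 0)
    (hne : (starRingEnd ℂ) ξ₁ ^ 3 ≠ ξ₁ ^ 3) (n : ℕ) :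
    padeForm n ξ₁ ξ₂ ≠ 0 ∨ padeForm (n + 1) ξ₁ ξ₂ ≠ 0 := by
  by_contra! hcon
  obtain ⟨ha, hb⟩ := hcon
  set x := (starRingEnd ℂ) ξ₁ ^ 3 / ξ₁ ^ 3 with hx
  have hx1 : x ≠ 1 := by
    rw [hx, Ne, div_eq_one_iff_eq (pow_ne_zero 3 h1)]; exact hne
  have key : ∀ n, padeForm n ξ₁ ξ₂ = 0 →
      ξ₁ * (starRingEnd ℂ) ξ₂ * (padeP n).eval x = ξ₂ * (starRingEnd ℂ) ξ₁ * (padeQ n).eval x := by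
    intro n h
    rw [padeForm] at h
    exact sub_eq_zero.1 ((mul_eq_zero.1 h).resolve_left
      (mul_ne_zero (pow_ne_zero _ two_ne_zero) (pow_ne_zero _ h1)))
  have ka := key n ha
  have kb := key (n + 1) hb
  have hdet := padeDet_eval_ne hx1 n
  apply hdet
  have hc : ξ₁ * (starRingEnd ℂ) ξ₂ ≠ 0 := mul_ne_zero h1 (by simpa using h2)
  apply mul_left_cancel₀ hc
  rw [mul_zero, padeDet, Polynomial.eval_sub, Polynomial.eval_mul, Polynomial.eval_mul]
  linear_combination (padeQ (n + 1)).eval x * ka - (padeQ n).eval x * kb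

lemma norm_padeForm_le {D : ℤ} {E : ℝ} {ω ξ₁ ξ₂ : ℂ} {θ₁ θ₂ : ℝ} (hω : ω ^ 3 = 1)
    (h₁ : ResPoint D E ω ξ₁ θ₁) (h₂ : ResPoint D E ω ξ₂ θ₂) (hE : 0 ≤ E)
    (hE1 : E ≤ ‖ξ₁‖ ^ 3) (n : ℕ) :
    ‖padeForm n ξ₁ ξ₂‖ ≤ 1500 ^ (n + 1) *
      (E * ‖ξ₁‖ ^ (3 * n + 1) / ‖ξ₂‖ ^ 2 + E ^ (2 * n + 1) * ‖ξ₂‖ / ‖ξ₁‖ ^ (3 * n + 2)) := by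
  have hp1 := norm_pos_iff.2 h₁.ne_zero
  have hp2 := norm_pos_iff.2 h₂.ne_zero
  have hx : (starRingEnd ℂ) ξ₁ ^ 3 / ξ₁ ^ 3 = Complex.exp (θ₁ * Complex.I) ^ 3 := by
    have := h₁.ne_zero
    rw [h₁.conj_eq, mul_pow, mul_pow, hω]
    field_simp
  set w := Complex.exp (θ₁ * Complex.I) with hw
  have hR : (padeR n).eval w = w * (padeQ n).eval (w ^ 3) - (padeP n).eval (w ^ 3) := by
    simp [padeR, Polynomial.expand_eval]
  have e : padeForm n ξ₁ ξ₂ = 2 ^ (n + 1) * ω * ξ₁ ^ (3 * n + 1) * ξ₂ *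
      ((Complex.exp (θ₂ * Complex.I) - 1) * (padeP n).eval (w ^ 3) - (padeR n).eval w) := by
    rw [padeForm, hx, hR, h₁.conj_eq, h₂.conj_eq]
    ring
  have hθ : |θ₁| ≤ 1 := h₁.phase_le.trans (div_le_one_of_le₀ hE1 (by positivity))
  have hwn : ‖w‖ = 1 := Complex.norm_exp_ofReal_mul_I _
  have b1 : ‖(Complex.exp (θ₂ * Complex.I) - 1) * (padeP n).eval (w ^ 3)‖ ≤
      E / ‖ξ₂‖ ^ 3 * (2 * 36 ^ n) := by
    rw [norm_mul]
    gcongr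
    · exact (norm_exp_mul_I_sub_one_le θ₂).trans h₂.phase_le
    · exact norm_padeP_eval_le n (by rw [norm_pow, hwn, one_pow])
  have b2 : ‖(padeR n).eval w‖ ≤ 4 * 36 ^ n * Real.exp (3 * n + 1) * (E / ‖ξ₁‖ ^ 3) ^ (2 * n + 1) := by
    refine (norm_padeR_eval_le n hθ).trans ?_
    gcongr
    exact h₁.phase_le
  have hexp : 8 * 72 ^ n * Real.exp (3 * n + 1) ≤ 1500 ^ (n + 1) := by
    have he : Real.exp 1 < 2.7182818286 := Real.exp_one_lt_d9
    have : Real.exp (3 * n + 1) = Real.exp 1 ^ (3 * n + 1) := by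
      rw [← Real.exp_nat_mul]; push_cast; ring_nf
    rw [this]
    calc 8 * 72 ^ n * Real.exp 1 ^ (3 * n + 1) ≤ 8 * 72 ^ n * (2.7182818286 : ℝ) ^ (3 * n + 1) := by
          gcongr
      _ = (72 * (2.7182818286 : ℝ) ^ 3) ^ n * (8 * 2.7182818286) := by
          rw [mul_pow, pow_succ _ (3 * n), pow_mul]; ring
      _ ≤ 1500 ^ n * 1500 := by gcongr <;> norm_num
      _ = _ := by ring
  rw [e, norm_mul, norm_mul, norm_mul, norm_mul, norm_eq_one_of_cube hω, norm_pow, norm_pow,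
    Complex.norm_ofNat, mul_one]
  have b3 : ‖(Complex.exp (θ₂ * Complex.I) - 1) * (padeP n).eval (w ^ 3) - (padeR n).eval w‖ ≤
      4 * 36 ^ n * Real.exp (3 * n + 1) * (E / ‖ξ₂‖ ^ 3 + (E / ‖ξ₁‖ ^ 3) ^ (2 * n + 1)) := by
    refine (norm_sub_le _ _).trans ((add_le_add b1 b2).trans ?_)
    rw [mul_add]
    gcongr ?_ + _
    rw [mul_comm]
    gcongr ?_ * _
    have : 1 ≤ Real.exp (3 * n + 1) := Real.one_le_exp (by positivity)
    nlinarith [pow_pos (show (0 : ℝ) < 36 by norm_num) n]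
  calc _ ≤ 2 ^ (n + 1) * ‖ξ₁‖ ^ (3 * n + 1) * ‖ξ₂‖ *
        (4 * 36 ^ n * Real.exp (3 * n + 1) * (E / ‖ξ₂‖ ^ 3 + (E / ‖ξ₁‖ ^ 3) ^ (2 * n + 1))) := by
        gcongr
    _ = (8 * 72 ^ n * Real.exp (3 * n + 1)) * (E * ‖ξ₁‖ ^ (3 * n + 1) / ‖ξ₂‖ ^ 2 +
        E ^ (2 * n + 1) * ‖ξ₂‖ / ‖ξ₁‖ ^ (3 * n + 2)) := by
        rw [show (72 : ℝ) = 2 * 36 by norm_num, mul_pow, div_pow, ← pow_mul]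
        have e1 : ‖ξ₁‖ ^ (3 * (2 * n + 1)) = ‖ξ₁‖ ^ (3 * n + 1) * ‖ξ₁‖ ^ (3 * n + 2) := by
          rw [← pow_add]; congr 1; ring
        rw [e1]
        field_simp
        ring
    _ ≤ _ := by gcongr

lemma ResPoint.not_far {D : ℤ} (hD : 0 < D) {E : ℝ} {ω ξ₁ ξ₂ : ℂ} {θ₁ θ₂ : ℝ} (hω : ω ^ 3 = 1)
    (h₁ : ResPoint D E ω ξ₁ θ₁) (h₂ : ResPoint D E ω ξ₂ θ₂) (hE : 1 ≤ E)
    (hdet : ∃ t r : ℤ, 2 * (ξ₁ * (starRingEnd ℂ) ξ₂) = t + r * resSqrt D)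
    (hbig : 3000 ^ 7 * E ^ 3 ≤ ‖ξ₁‖) : ‖ξ₂‖ < ‖ξ₁‖ ^ 10 := by
  by_contra! hfar
  set s := ‖ξ₁‖ with hs
  set t := ‖ξ₂‖ with ht
  have hE3 : E ≤ E ^ 3 := le_self_pow₀ hE (by norm_num)
  have hE31 : 1 ≤ E ^ 3 := hE.trans hE3
  have hs1 : 3000 ^ 7 ≤ s := by nlinarith
  have hsE : E ≤ s ^ 3 := by
    have : s ≤ s ^ 3 := le_self_pow₀ (by linarith) (by norm_num)
    nlinarith
  have hs0 : 0 < s := by linarith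
  obtain ⟨n, hn1, hn2⟩ : ∃ n : ℕ, (s ^ 2) ^ n ≤ t ∧ t < (s ^ 2) ^ (n + 1) :=
    exists_nat_pow_near (by
      have : (1 : ℝ) ≤ s ^ 10 := one_le_pow₀ (by linarith)
      linarith) (by nlinarith)
  have hn5 : 5 ≤ n := by
    by_contra! hlt
    have : (s ^ 2) ^ (n + 1) ≤ s ^ 10 := by
      rw [← pow_mul]
      exact pow_le_pow_right₀ (by linarith) (by omega)
    linarith
  have ht0 : 0 < t := lt_of_lt_of_le (by positivity) hn1
  obtain ⟨p, q, hpq⟩ := h₁.cube_mem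
  obtain ⟨a, b, hab⟩ := hdet
  have m1 : 2 * ξ₁ ^ 3 ∈ resRing D hD := ⟨p, q, hpq⟩
  have m2 : 2 * (starRingEnd ℂ) ξ₁ ^ 3 ∈ resRing D hD := by
    refine ⟨p, -q, ?_⟩
    have := congrArg (starRingEnd ℂ) hpq
    simp only [map_mul, map_add, map_ofNat, map_pow, map_intCast, conj_resSqrt] at this
    rw [this]; push_cast; ring
  have m3 : 2 * (ξ₁ * (starRingEnd ℂ) ξ₂) ∈ resRing D hD := ⟨a, b, hab⟩
  have m4 : 2 * (ξ₂ * (starRingEnd ℂ) ξ₁) ∈ resRing D hD := by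
    refine ⟨a, -b, ?_⟩
    have := congrArg (starRingEnd ℂ) hab
    simp only [map_mul, map_add, map_ofNat, map_intCast, conj_resSqrt, Complex.conj_conj] at this
    rw [mul_comm ξ₂, this]; push_cast; ring
  have hmain : ∃ n', (n' = n ∨ n' = n + 1) ∧ 1 ≤ 1500 ^ (n' + 1) *
      (E * s ^ (3 * n' + 1) / t ^ 2 + E ^ (2 * n' + 1) * t / s ^ (3 * n' + 2)) := by
    rcases padeForm_ne_zero h₁.ne_zero h₂.ne_zero h₁.cube_ne n with h | h
    · exact ⟨n, Or.inl rfl, (one_le_norm_of_mem_resRing hD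
        (padeForm_mem hD h₁.ne_zero _ m1 m2 m3 m4) h).trans
        (norm_padeForm_le hω h₁ h₂ (by linarith) hsE _)⟩
    · exact ⟨n + 1, Or.inr rfl, (one_le_norm_of_mem_resRing hD
        (padeForm_mem hD h₁.ne_zero _ m1 m2 m3 m4) h).trans
        (norm_padeForm_le hω h₁ h₂ (by linarith) hsE _)⟩
  obtain ⟨n', hn', h⟩ := hmain
  have hs1' : 1 ≤ s := by linarith
  have k1 : E * s ^ (3 * n' + 1) / t ^ 2 ≤ E * s ^ 4 / s ^ n := by
    rw [div_le_div_iff₀ (by positivity) (by positivity)]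
    calc E * s ^ (3 * n' + 1) * s ^ n ≤ E * s ^ (3 * (n + 1) + 1) * s ^ n := by
          gcongr
          omega
      _ = E * s ^ 4 * ((s ^ 2) ^ n) ^ 2 := by ring
      _ ≤ _ := by gcongr
  have k2 : E ^ (2 * n' + 1) * t / s ^ (3 * n' + 2) ≤ E ^ (2 * n + 3) / s ^ n := by
    rw [div_le_div_iff₀ (by positivity) (by positivity)]
    calc E ^ (2 * n' + 1) * t * s ^ n ≤ E ^ (2 * n + 3) * (s ^ 2) ^ (n + 1) * s ^ n := by
          gcongr ?_ * ?_ * _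
          · exact pow_le_pow_right₀ hE (by omega)
      _ = E ^ (2 * n + 3) * s ^ (3 * n + 2) := by ring
      _ ≤ _ := by
          gcongr
          omega
  have k3 : (1500 : ℝ) ^ (n' + 1) ≤ 1500 ^ (n + 2) := pow_le_pow_right₀ (by norm_num) (by omega)
  have k4 : s ^ n ≤ 1500 ^ (n + 2) * (E * s ^ 4) + 1500 ^ (n + 2) * E ^ (2 * n + 3) := by
    have : 1 ≤ 1500 ^ (n + 2) * (E * s ^ 4 / s ^ n + E ^ (2 * n + 3) / s ^ n) :=
      h.trans (by gcongr)
    rw [← add_div, ← mul_div_assoc, le_div_iff₀ (by positivity)] at this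
    linarith
  obtain ⟨m, rfl⟩ := Nat.exists_eq_add_of_le hn5
  have k5 : 2 * (1500 ^ (5 + m + 2) * (E * s ^ 4)) < s ^ (5 + m) := by
    have e1 : (3000 ^ 7 * E) ^ (m + 1) ≤ s ^ (m + 1) := by
      gcongr
      nlinarith
    have e2 : (3000 : ℝ) ^ (m + 7) * E ≤ (3000 ^ 7 * E) ^ (m + 1) := by
      rw [mul_pow, ← pow_mul]
      gcongr
      · norm_num
      · omega
      · exact le_self_pow₀ hE (by omega)
    have e3 : 2 * (1500 : ℝ) ^ (m + 7) < 3000 ^ (m + 7) := by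
      rw [show (3000 : ℝ) = 2 * 1500 by norm_num, mul_pow]
      have : (2 : ℝ) < 2 ^ (m + 7) := by
        calc (2 : ℝ) < 2 ^ 7 := by norm_num
          _ ≤ _ := pow_le_pow_right₀ (by norm_num) (by omega)
      gcongr
    calc 2 * (1500 ^ (5 + m + 2) * (E * s ^ 4)) = (2 * 1500 ^ (m + 7)) * E * s ^ 4 := by ring
      _ < 3000 ^ (m + 7) * E * s ^ 4 := by gcongr
      _ ≤ s ^ (m + 1) * s ^ 4 := by gcongr; exact e2.trans e1
      _ = _ := by ring
  have k6 : 2 * (1500 ^ (5 + m + 2) * E ^ (2 * (5 + m) + 3)) < s ^ (5 + m) := by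
    have e1 : (3000 ^ 7 * E ^ 3) ^ (5 + m) ≤ s ^ (5 + m) := by gcongr
    have e2 : (3000 : ℝ) ^ (m + 7) * E ^ (2 * (5 + m) + 3) ≤ (3000 ^ 7 * E ^ 3) ^ (5 + m) := by
      rw [mul_pow, ← pow_mul, ← pow_mul]
      gcongr
      · norm_num
      · omega
      · omega
    have e3 : 2 * (1500 : ℝ) ^ (m + 7) < 3000 ^ (m + 7) := by
      rw [show (3000 : ℝ) = 2 * 1500 by norm_num, mul_pow]
      have : (2 : ℝ) < 2 ^ (m + 7) := by
        calc (2 : ℝ) < 2 ^ 7 := by norm_num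
          _ ≤ _ := pow_le_pow_right₀ (by norm_num) (by omega)
      gcongr
    calc 2 * (1500 ^ (5 + m + 2) * E ^ (2 * (5 + m) + 3)) =
        (2 * 1500 ^ (m + 7)) * E ^ (2 * (5 + m) + 3) := by ring
      _ < 3000 ^ (m + 7) * E ^ (2 * (5 + m) + 3) := by gcongr
      _ ≤ s ^ (5 + m) := e2.trans e1
  linarith

end ThueGap

section ThueCount

lemma eq_of_binEval_eq_of_det_eq_zero {c : Fin 4 → ℤ} {m x y x' y' : ℤ} (hm : m ≠ 0)
    (h : binEval (n := 3) c x y = m) (h' : binEval (n := 3) c x' y' = m)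
    (hdet : y * x' - x * y' = 0) : x = x' ∧ y = y' := by
  rw [binEval_cubic] at h h'
  have hodd : Odd 3 := by decide
  have h1 : m * x' ^ 3 = m * x ^ 3 := by
    rw [← h]
    nth_rewrite 2 [h]
    rw [← h']
    have e : y * x' = x * y' := by linarith
    linear_combination (c 1 * x ^ 2 * x' ^ 2 + c 2 * x * x' * (y * x' + x * y') +
      c 3 * ((y * x') ^ 2 + (y * x') * (x * y') + (x * y') ^ 2)) * e
  have h2 : m * y' ^ 3 = m * y ^ 3 := by
    rw [← h]
    nth_rewrite 2 [h]
    rw [← h']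
    have e : y * x' = x * y' := by linarith
    linear_combination -(c 2 * y ^ 2 * y' ^ 2 + c 1 * y * y' * (y * x' + x * y') +
      c 0 * ((y * x') ^ 2 + (y * x') * (x * y') + (x * y') ^ 2)) * e
  exact ⟨(hodd.pow_inj.1 (mul_left_cancel₀ hm h1)).symm,
    (hodd.pow_inj.1 (mul_left_cancel₀ hm h2)).symm⟩

lemma exists_resPoints {c : Fin 4 → ℤ} (hD : 0 < cubicDisc c) (hA : 0 < hessA c) {m : ℤ}
    (hm : m ≠ 0) :
    ∃ ξ : ℤ × ℤ → ℂ, ∃ ω : ℤ × ℤ → ℂ, ∃ θ : ℤ × ℤ → ℝ,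
      (∀ v, ‖ξ v‖ ^ 2 = hessVal c v.1 v.2) ∧
      (∀ v v', ∃ t : ℤ, 2 * (ξ v * (starRingEnd ℂ) (ξ v')) =
        t + (v.2 * v'.1 - v.1 * v'.2 : ℤ) * resSqrt (cubicDisc c)) ∧
      ∀ v : ℤ × ℤ, binEval (n := 3) c v.1 v.2 = m → ω v ^ 3 = 1 ∧
        ResPoint (cubicDisc c) (3 * Real.sqrt (cubicDisc c : ℤ) * |(m : ℝ)|) (ω v) (ξ v) (θ v) := by
  obtain ⟨ξ, h1, h2, h3⟩ := exists_cubic_resolvent c hD hA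
  have hs0 : resSqrt (cubicDisc c) ≠ 0 := by
    rw [← norm_ne_zero_iff, norm_resSqrt]
    have : (0 : ℝ) < 3 * (cubicDisc c : ℤ) := by
      have : (0 : ℝ) < (cubicDisc c : ℤ) := by exact_mod_cast hD
      linarith
    exact (Real.sqrt_pos.2 this).ne'
  have key : ∀ v : ℤ × ℤ, ∃ (ω : ℂ) (θ : ℝ), binEval (n := 3) c v.1 v.2 = m → ω ^ 3 = 1 ∧
      ResPoint (cubicDisc c) (3 * Real.sqrt (cubicDisc c : ℤ) * |(m : ℝ)|) ω (ξ v.1 v.2) θ := by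
    intro v
    by_cases hv : binEval (n := 3) c v.1 v.2 = m
    swap
    · exact ⟨0, 0, fun h => absurd h hv⟩
    obtain ⟨g, hg⟩ := h2 v.1 v.2
    rw [hv] at hg
    have hgc := congrArg (starRingEnd ℂ) hg
    simp only [map_mul, map_add, map_ofNat, map_pow, map_intCast, conj_resSqrt] at hgc
    have hdiff : (starRingEnd ℂ) (ξ v.1 v.2) ^ 3 - ξ v.1 v.2 ^ 3 =
        -(3 * m * resSqrt (cubicDisc c)) := by
      linear_combination (1 / 2 : ℂ) * hgc - (1 / 2 : ℂ) * hg
    have hm' : (m : ℂ) ≠ 0 := by exact_mod_cast hm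
    have hne : (starRingEnd ℂ) (ξ v.1 v.2) ^ 3 ≠ ξ v.1 v.2 ^ 3 := by
      rw [← sub_ne_zero, hdiff, neg_ne_zero]
      exact mul_ne_zero (mul_ne_zero (by norm_num) hm') hs0
    have hz : ξ v.1 v.2 ≠ 0 := by
      intro h
      rw [h] at hne
      simp at hne
    obtain ⟨ω, θ, hω, hconj, hθ⟩ := exists_phase hz (d := 3 * |(m : ℝ)| * Real.sqrt (3 * (cubicDisc c : ℤ)))
      (by rw [hdiff, norm_neg, norm_mul, norm_mul, norm_resSqrt, Complex.norm_ofNat,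
            Complex.norm_intCast])
    refine ⟨ω, θ, fun _ => ⟨hω, hz, hconj, hθ.trans ?_, hne, g, 3 * m, ?_⟩⟩
    · rw [← mul_div_assoc]
      refine div_le_div_of_nonneg_right ?_ (by positivity)
      rw [Real.sqrt_mul (by norm_num)]
      have hpi := Real.pi_lt_d2
      have hpi0 := Real.pi_pos
      have h3 : Real.sqrt 3 ≤ 1.8 := by
        rw [Real.sqrt_le_left (by norm_num)]; norm_num
      have : Real.pi * Real.sqrt 3 ≤ 6 := by nlinarith [Real.sqrt_nonneg 3]
      calc Real.pi / 6 * (3 * |(m : ℝ)| * (Real.sqrt 3 * Real.sqrt (cubicDisc c : ℤ))) =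
          (Real.pi * Real.sqrt 3) / 2 * (Real.sqrt (cubicDisc c : ℤ) * |(m : ℝ)|) := by ring
        _ ≤ 6 / 2 * (Real.sqrt (cubicDisc c : ℤ) * |(m : ℝ)|) := by gcongr
        _ = _ := by ring
    · rw [hg]; push_cast; ring
  choose ω θ hωθ using key
  exact ⟨fun v => ξ v.1 v.2, ω, θ, fun v => h1 _ _, fun v v' => h3 _ _ _ _, hωθ⟩

lemma gap_sequence_absurd {M L E : ℝ} (hM : 1 ≤ M) (hE : E ≤ 45 * L ^ 2 * M) (hE0 : 0 ≤ E)
    (hL : 3000 ^ 7 * 45 ^ 3 * 4 ^ 7 * M ^ 10 ≤ L) (s : Fin 8 → ℝ) (h0 : L ≤ s 0)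
    (hmono : Monotone s)
    (hgap : ∀ i j : Fin 8, i < j → s i ^ 2 ≤ 4 * M * s j)
    (hfar : 3000 ^ 7 * E ^ 3 ≤ s 3 → s 7 < s 3 ^ 10) : False := by
  have hM10 : 1 ≤ M ^ 10 := one_le_pow₀ hM
  have hL1 : 1 ≤ L := by nlinarith
  have hs : ∀ i, L ≤ s i := fun i => h0.trans (hmono (Fin.zero_le i))
  have hs0 : ∀ i, 0 < s i := fun i => by linarith [hs i]
  have g : ∀ (i j : Fin 8) (a : ℝ) (k l : ℕ), i < j → 0 ≤ a → a ^ k ≤ (4 * M) ^ l * s i →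
      a ^ (k * 2) ≤ (4 * M) ^ (l * 2 + 1) * s j := by
    intro i j a k l hij ha h
    calc a ^ (k * 2) = (a ^ k) ^ 2 := by rw [pow_mul]
      _ ≤ ((4 * M) ^ l * s i) ^ 2 := by gcongr
      _ = ((4 * M) ^ l) ^ 2 * s i ^ 2 := by ring
      _ ≤ ((4 * M) ^ l) ^ 2 * (4 * M * s j) := by gcongr; exact hgap i j hij
      _ = _ := by ring
  have a0 : L ^ 1 ≤ (4 * M) ^ 0 * s 0 := by simpa using h0
  have a1 := g 0 1 L 1 0 (by decide) (by linarith) a0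
  have a2 := g 1 2 L _ _ (by decide) (by linarith) a1
  have a3 := g 2 3 L _ _ (by decide) (by linarith) a2
  have b3 : s 3 ^ 1 ≤ (4 * M) ^ 0 * s 3 := by simp
  have b4 := g 3 4 (s 3) 1 0 (by decide) (hs0 3).le b3
  have b5 := g 4 5 (s 3) _ _ (by decide) (hs0 3).le b4
  have b6 := g 5 6 (s 3) _ _ (by decide) (hs0 3).le b5
  have b7 := g 6 7 (s 3) _ _ (by decide) (hs0 3).le b6
  norm_num at a3 b7
  have hbig : 3000 ^ 7 * E ^ 3 ≤ s 3 := by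
    have e1 : E ^ 3 ≤ (45 * L ^ 2 * M) ^ 3 := by gcongr
    have e2 : 3000 ^ 7 * E ^ 3 * (4 * M) ^ 7 ≤ (4 * M) ^ 7 * s 3 := by
      calc 3000 ^ 7 * E ^ 3 * (4 * M) ^ 7 ≤ 3000 ^ 7 * (45 * L ^ 2 * M) ^ 3 * (4 * M) ^ 7 := by
            gcongr
        _ = (3000 ^ 7 * 45 ^ 3 * 4 ^ 7 * M ^ 10) * L ^ 6 := by ring
        _ ≤ L * L ^ 6 := by gcongr
        _ ≤ L ^ 8 := by
            rw [← pow_succ']; exact pow_le_pow_right₀ hL1 (by norm_num)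
        _ ≤ _ := a3
    have : 0 < (4 * M) ^ 7 := by positivity
    nlinarith
  have hlt := hfar hbig
  have e3 : (4 * M) ^ 3 ≤ s 3 := by
    refine le_trans ?_ (hs 3)
    refine le_trans ?_ hL
    have : M ^ 3 ≤ M ^ 10 := pow_le_pow_right₀ hM (by norm_num)
    nlinarith
  have e4 : (4 * M) ^ 15 * s 3 ^ 10 ≤ (4 * M) ^ 15 * s 7 := by
    calc (4 * M) ^ 15 * s 3 ^ 10 = ((4 * M) ^ 3) ^ 5 * s 3 ^ 10 := by ring
      _ ≤ s 3 ^ 5 * s 3 ^ 10 := by gcongr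
      _ = s 3 ^ 15 := by ring
      _ ≤ s 3 ^ 16 := pow_le_pow_right₀ (hL1.trans (hs 3)) (by norm_num)
      _ ≤ _ := b7
  have : s 3 ^ 10 ≤ s 7 := le_of_mul_le_mul_left e4 (by positivity)
  linarith

/-- A cubic form of positive discriminant whose Hessian has no small values takes a given nonzero
value at most `21` times. -/
theorem card_solutions_le (m : ℤ) (hm : m ≠ 0) : ∃ L₀ : ℝ, ∀ L : ℝ, L₀ ≤ L → ∀ c : Fin 4 → ℤ,
    0 < cubicDisc c → ((cubicDisc c : ℤ) : ℝ) ≤ 200 * L ^ 4 → 0 < hessA c →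
    (∀ x y : ℤ, (x, y) ≠ 0 → L ^ 2 ≤ ((hessVal c x y : ℤ) : ℝ)) →
    ∀ S : Finset (ℤ × ℤ), (∀ v ∈ S, binEval (n := 3) c v.1 v.2 = m) → #S ≤ 21 := by
  refine ⟨3000 ^ 7 * 45 ^ 3 * 4 ^ 7 * |(m : ℝ)| ^ 10, fun L hL c hD hD2 hA hH S hS => ?_⟩
  have hM : 1 ≤ |(m : ℝ)| := by exact_mod_cast Int.one_le_abs hm
  have hL0 : 0 < L := lt_of_lt_of_le (by positivity) hL
  obtain ⟨ξ, ω, θ, hnorm, hpair, hres⟩ := exists_resPoints hD hA hm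
  set E := 3 * Real.sqrt (cubicDisc c : ℤ) * |(m : ℝ)| with hE
  have hD1 : (1 : ℝ) ≤ (cubicDisc c : ℤ) := by exact_mod_cast hD
  have hsq1 : 1 ≤ Real.sqrt (cubicDisc c : ℤ) := by rwa [Real.one_le_sqrt]
  have hE1 : 1 ≤ E := by rw [hE]; nlinarith
  have hE2 : E ≤ 45 * L ^ 2 * |(m : ℝ)| := by
    have : Real.sqrt (cubicDisc c : ℤ) ≤ 15 * L ^ 2 := by
      rw [Real.sqrt_le_left (by positivity)]
      nlinarith [pow_pos hL0 4]
    rw [hE]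
    gcongr ?_ * _
    linarith
  by_contra! hlt
  have hcardω : #(Polynomial.nthRootsFinset 3 (1 : ℂ)) ≤ 3 := by
    rw [Polynomial.nthRootsFinset_def]
    exact (Multiset.toFinset_card_le _).trans (Polynomial.card_nthRoots _ _)
  obtain ⟨ω₀, hω₀, hfib⟩ := exists_lt_card_fiber_of_mul_lt_card_of_maps_to (s := S)
    (t := Polynomial.nthRootsFinset 3 (1 : ℂ)) (f := ω) (n := 7)
    (fun v hv => (Polynomial.mem_nthRootsFinset (by norm_num) 1).2 (hres v (hS v hv)).1)
    (by omega)
  obtain ⟨T, hTS, hT⟩ := exists_subset_card_eq (Nat.succ_le_of_lt hfib)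
  set e := T.equivFinOfCardEq hT with he
  set f : Fin 8 → ℤ × ℤ := fun i => (e.symm i : ℤ × ℤ) with hf
  set σ := Tuple.sort (fun i => ‖ξ (f i)‖) with hσ
  have hmono : Monotone (fun i => ‖ξ (f (σ i))‖) := Tuple.monotone_sort (fun i => ‖ξ (f i)‖)
  have hmem : ∀ i, f i ∈ S ∧ ω (f i) = ω₀ := fun i => mem_filter.1 (hTS (e.symm i).2)
  have hpt : ∀ i, ω₀ ^ 3 = 1 ∧ ResPoint (cubicDisc c) E ω₀ (ξ (f i)) (θ (f i)) := by
    intro i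
    have := hres _ (hS _ (hmem i).1)
    rwa [(hmem i).2] at this
  have hdet : ∀ i j, i ≠ j → (f i).2 * (f j).1 - (f i).1 * (f j).2 ≠ 0 := by
    intro i j hij h
    obtain ⟨h1, h2⟩ := eq_of_binEval_eq_of_det_eq_zero hm (hS _ (hmem i).1) (hS _ (hmem j).1) h
    exact hij (e.symm.injective (Subtype.ext (Prod.ext h1 h2)))
  refine gap_sequence_absurd hM hE2 (by linarith) hL (fun i => ‖ξ (f (σ i))‖) ?_ hmono ?_ ?_
  · have hne : f (σ 0) ≠ 0 := by
      intro h0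
      have := hS _ (hmem (σ 0)).1
      rw [h0, binEval_cubic] at this
      simp at this
      exact hm this.symm
    have h1 := hH (f (σ 0)).1 (f (σ 0)).2 hne
    rw [← hnorm] at h1
    exact (pow_le_pow_iff_left₀ hL0.le (norm_nonneg _) two_ne_zero).1 h1
  · intro i j hij
    have hne := hdet (σ i) (σ j) (fun h => hij.ne (σ.injective h))
    obtain ⟨t, ht⟩ := hpair (f (σ i)) (f (σ j))
    have h := (hpt (σ i)).2.gap (hpt (σ i)).1 (hpt (σ j)).2 (hmono hij.le) (by linarith)
      ⟨t, _, hne, ht⟩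
    rw [Real.sqrt_mul (by norm_num), hE] at h
    have h3 : 1.7 ≤ Real.sqrt 3 := Real.le_sqrt_of_sq_le (by norm_num)
    set a := ‖ξ (f (σ i))‖
    set b := ‖ξ (f (σ j))‖
    have hb : 0 ≤ b := norm_nonneg _
    have h4 : Real.sqrt 3 * a ^ 2 ≤ 6 * |(m : ℝ)| * b := by
      refine le_of_mul_le_mul_left ?_ (lt_of_lt_of_le one_pos hsq1)
      linarith
    have h5 : 0 ≤ |(m : ℝ)| * b := by positivity
    nlinarith [sq_nonneg a]
  · intro hbig
    obtain ⟨t, ht⟩ := hpair (f (σ 3)) (f (σ 7))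
    exact (hpt (σ 3)).2.not_far hD (hpt (σ 3)).1 (hpt (σ 7)).2 hE1 ⟨t, _, ht⟩ hbig

end ThueCount

section Reduction

lemma exists_coprime_small_value {p q r : ℝ} (hp : 0 < p)
    (hΔ' : 4 * p * r - q ^ 2 ≤ 5) :
    ∃ x y : ℤ, IsCoprime x y ∧ p * x ^ 2 + q * x * y + r * y ^ 2 ≤ 9 / 4 := by
  suffices h : ∃ x y : ℤ, (x ≠ 0 ∨ y ≠ 0) ∧ p * (x : ℝ) ^ 2 + q * x * y + r * y ^ 2 ≤ 9 / 4 by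
    obtain ⟨x, y, hne, h⟩ := h
    have hg : 0 < Int.gcd x y := Int.gcd_pos_iff.2 hne
    obtain ⟨x', y', hco, hx, hy⟩ := Int.exists_gcd_one hg
    refine ⟨x', y', Int.isCoprime_iff_gcd_eq_one.2 hco, ?_⟩
    have hg1 : (1 : ℝ) ≤ Int.gcd x y := by exact_mod_cast hg
    have hx' : (x : ℝ) = x' * Int.gcd x y := by exact_mod_cast hx
    have hy' : (y : ℝ) = y' * Int.gcd x y := by exact_mod_cast hy
    rw [hx', hy'] at h
    set g : ℝ := ((Int.gcd x y : ℕ) : ℝ)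
    have h1 : (p * x' ^ 2 + q * x' * y' + r * y' ^ 2) * g ^ 2 ≤ 9 / 4 := by linarith
    by_contra! h2
    nlinarith [one_le_pow₀ hg1 (n := 2)]
  rcases lt_or_ge p 1 with h1 | h1
  · exact ⟨1, 0, by simp, by norm_num; linarith⟩
  have hs1 : 1 ≤ Real.sqrt p := by rwa [Real.one_le_sqrt]
  have hn : 0 < ⌊Real.sqrt p⌋₊ := Nat.floor_pos.2 hs1
  obtain ⟨j, k, hk, hkn, hjk⟩ := Real.exists_int_int_abs_mul_sub_le (-q / (2 * p)) hn
  refine ⟨j, k, Or.inr hk.ne', ?_⟩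
  have hfl : Real.sqrt p < ⌊Real.sqrt p⌋₊ + 1 := Nat.lt_floor_add_one _
  have hfl2 : (⌊Real.sqrt p⌋₊ : ℝ) ≤ Real.sqrt p := Nat.floor_le (by linarith)
  have hk2 : (k : ℝ) ≤ Real.sqrt p := le_trans (by exact_mod_cast hkn) hfl2
  have hk0 : (0 : ℝ) < k := by exact_mod_cast hk
  have hsq : Real.sqrt p ^ 2 = p := Real.sq_sqrt hp.le
  have e1 : p * (k * (-q / (2 * p)) - j) ^ 2 ≤ 1 := by
    have h2 : |k * (-q / (2 * p)) - j| ≤ 1 / Real.sqrt p :=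
      hjk.trans (one_div_le_one_div_of_le (by linarith) hfl.le)
    have h3 := pow_le_pow_left₀ (abs_nonneg _) h2 2
    rw [sq_abs, div_pow, hsq, one_pow, le_div_iff₀ hp] at h3
    linarith
  have e2 : (4 * p * r - q ^ 2) * k ^ 2 / (4 * p) ≤ 5 / 4 := by
    have : (k : ℝ) ^ 2 ≤ p := by rw [← hsq]; gcongr
    rw [div_le_div_iff₀ (by positivity) (by norm_num)]
    nlinarith [sq_nonneg (k : ℝ)]
  have e3 : p * (j : ℝ) ^ 2 + q * j * k + r * k ^ 2 =
      p * (k * (-q / (2 * p)) - j) ^ 2 + (4 * p * r - q ^ 2) * k ^ 2 / (4 * p) := by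
    field_simp; ring
  linarith

lemma exists_real_linear_factor (c : Fin 4 → ℝ) : ∃ α β P Q R : ℝ,
    c 0 = α * P ∧ c 1 = α * Q - β * P ∧ c 2 = α * R - β * Q ∧ c 3 = -(β * R) := by
  by_cases h0 : c 0 = 0
  · exact ⟨0, -1, c 1, c 2, c 3, by simp [h0], by ring, by ring, by ring⟩
  obtain ⟨τ, hτ⟩ : ∃ τ : ℝ, τ ^ 3 + c 1 / c 0 * τ ^ 2 + c 2 / c 0 * τ + c 3 / c 0 = 0 := by
    set u := c 1 / c 0
    set v := c 2 / c 0
    set w := c 3 / c 0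
    set K := 1 + |u| + |v| + |w| with hK
    have hcont : ContinuousOn (fun t : ℝ => t ^ 3 + u * t ^ 2 + v * t + w) (Set.Icc (-K) K) := by
      fun_prop
    have hu := abs_nonneg u
    have hv := abs_nonneg v
    have hw := abs_nonneg w
    have hK1 : 1 ≤ K := by linarith
    have b1 : |u| * K ^ 2 + |v| * K + |w| ≤ K ^ 3 := by
      have : |u| * K ^ 2 + |v| * K + |w| ≤ (|u| + |v| + |w|) * K ^ 2 := by
        nlinarith [mul_nonneg hv (by linarith : 0 ≤ K - 1), mul_nonneg hw (by nlinarith : 0 ≤ K ^ 2 - 1)]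
      have : K ^ 3 = (1 + |u| + |v| + |w|) * K ^ 2 := by rw [hK]; ring
      nlinarith [sq_nonneg K]
    have hmem : (0 : ℝ) ∈ Set.Icc ((-K) ^ 3 + u * (-K) ^ 2 + v * (-K) + w)
        (K ^ 3 + u * K ^ 2 + v * K + w) := by
      have hK2 : 0 ≤ K ^ 2 := sq_nonneg K
      have hK0 : 0 ≤ K := by linarith
      constructor
      · nlinarith [mul_le_mul_of_nonneg_right (le_abs_self u) hK2,
          mul_le_mul_of_nonneg_right (neg_abs_le v) hK0, le_abs_self w]
      · nlinarith [mul_le_mul_of_nonneg_right (neg_abs_le u) hK2,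
          mul_le_mul_of_nonneg_right (neg_abs_le v) hK0, neg_abs_le w]
    obtain ⟨τ, -, hτ⟩ := intermediate_value_Icc (by linarith) hcont hmem
    exact ⟨τ, hτ⟩
  refine ⟨1, τ, c 0, c 1 + τ * c 0, c 2 + τ * c 1 + τ ^ 2 * c 0, by ring, by ring, by ring, ?_⟩
  field_simp at hτ
  linear_combination hτ

lemma exists_covariant_of_disc_neg (c : Fin 4 → ℝ) (hD : cubicDisc c < 0) : ∃ p q r : ℝ, 0 < p ∧
    0 < 4 * p * r - q ^ 2 ∧ 4 * p * r - q ^ 2 ≤ 5 ∧ ∀ x y : ℝ,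
      binEval (n := 3) c x y ^ 2 ≤
        Real.sqrt |cubicDisc c| * (p * x ^ 2 + q * x * y + r * y ^ 2) ^ 3 ∧
      |hessVal c x y| ≤ Real.sqrt |cubicDisc c| * (p * x ^ 2 + q * x * y + r * y ^ 2) := by
  obtain ⟨α, β, P, Q, R, hfac, hP⟩ : ∃ α β P Q R : ℝ, (c 0 = α * P ∧ c 1 = α * Q - β * P ∧
      c 2 = α * R - β * Q ∧ c 3 = -(β * R)) ∧ 0 ≤ P := by
    obtain ⟨α, β, P, Q, R, h0, h1, h2, h3⟩ := exists_real_linear_factor c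
    rcases le_total 0 P with hP | hP
    · exact ⟨α, β, P, Q, R, ⟨h0, h1, h2, h3⟩, hP⟩
    · exact ⟨-α, -β, -P, -Q, -R, ⟨by rw [h0]; ring, by rw [h1]; ring, by rw [h2]; ring,
        by rw [h3]; ring⟩, by linarith⟩
  obtain ⟨h0, h1, h2, h3⟩ := hfac
  set Δ := 4 * P * R - Q ^ 2 with hΔ
  set ρ := P * β ^ 2 + Q * β * α + R * α ^ 2 with hρ
  have hDeq : cubicDisc c = -(Δ * ρ ^ 2) := by
    simp only [cubicDisc, h0, h1, h2, h3, hΔ, hρ]; ring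
  have hΔ0 : 0 < Δ := by
    by_contra! h
    nlinarith [mul_nonneg (neg_nonneg.2 h) (sq_nonneg ρ)]
  have hP0 : 0 < P := by
    refine lt_of_le_of_ne hP fun h => ?_
    rw [hΔ, ← h] at hΔ0
    nlinarith [sq_nonneg Q]
  have hq : ∀ x y : ℝ, 0 ≤ P * x ^ 2 + Q * x * y + R * y ^ 2 := by
    intro x y
    have : 0 ≤ 4 * P * (P * x ^ 2 + Q * x * y + R * y ^ 2) := by
      have : 4 * P * (P * x ^ 2 + Q * x * y + R * y ^ 2) = (2 * P * x + Q * y) ^ 2 + Δ * y ^ 2 := by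
        rw [hΔ]; ring
      rw [this]; positivity
    exact nonneg_of_mul_nonneg_right this (by positivity)
  have hρ0 : 0 < ρ := by
    refine lt_of_le_of_ne (hq β α) fun h => ?_
    have h' : ρ = 0 := h.symm
    rw [hDeq, h'] at hD
    simp at hD
  set w := Real.sqrt Δ with hw
  have hw0 : 0 < w := Real.sqrt_pos.2 hΔ0
  have hw2 : w ^ 2 = Δ := Real.sq_sqrt hΔ0.le
  have hsD : Real.sqrt |cubicDisc c| = w * ρ := by
    rw [hDeq, abs_neg, abs_of_pos (by positivity), ← hw2, ← mul_pow, Real.sqrt_sq (by positivity)]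
  have hdisc : 4 * (w / ρ * α ^ 2 + P / w) * (w / ρ * β ^ 2 + R / w) -
      (-(2 * (w / ρ) * α * β) + Q / w) ^ 2 = 5 := by
    have : 4 * (w / ρ * α ^ 2 + P / w) * (w / ρ * β ^ 2 + R / w) -
      (-(2 * (w / ρ) * α * β) + Q / w) ^ 2 = Δ / w ^ 2 + 4 * ρ / ρ := by
      rw [hΔ]
      field_simp
      rw [hρ]; ring
    rw [this, hw2, div_self hΔ0.ne', mul_div_assoc, div_self hρ0.ne']
    norm_num
  refine ⟨w / ρ * α ^ 2 + P / w, -(2 * (w / ρ) * α * β) + Q / w, w / ρ * β ^ 2 + R / w,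
    by positivity, by rw [hdisc]; norm_num, hdisc.le, fun x y => ?_⟩
  rw [hsD]
  have hqv := hq x y
  set qv := P * x ^ 2 + Q * x * y + R * y ^ 2 with hqv_def
  set l := α * x - β * y with hl
  have hval : (w / ρ * α ^ 2 + P / w) * x ^ 2 + (-(2 * (w / ρ) * α * β) + Q / w) * x * y +
      (w / ρ * β ^ 2 + R / w) * y ^ 2 = w / ρ * l ^ 2 + qv / w := by
    rw [hl, hqv_def]; ring
  have hF : binEval (n := 3) c x y = l * qv := by
    rw [binEval_cubic, h0, h1, h2, h3, hl, hqv_def]; ring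
  have hH : hessVal c x y = ρ * qv - Δ * l ^ 2 := by
    simp only [hessVal, hessA, hessB, hessC]
    rw [h0, h1, h2, h3, hl, hqv_def, hρ, hΔ]; ring
  rw [hval, hF, hH]
  have e1 : l ^ 2 ≤ ρ / w * (w / ρ * l ^ 2 + qv / w) := by
    have : ρ / w * (w / ρ * l ^ 2 + qv / w) = l ^ 2 + ρ * qv / w ^ 2 := by field_simp
    rw [this]
    have : 0 ≤ ρ * qv / w ^ 2 := by positivity
    linarith
  have e2 : qv ≤ w * (w / ρ * l ^ 2 + qv / w) := by
    have : w * (w / ρ * l ^ 2 + qv / w) = w ^ 2 / ρ * l ^ 2 + qv := by field_simp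
    rw [this]
    have : 0 ≤ w ^ 2 / ρ * l ^ 2 := by positivity
    linarith
  constructor
  · calc (l * qv) ^ 2 = l ^ 2 * qv ^ 2 := by ring
      _ ≤ (ρ / w * (w / ρ * l ^ 2 + qv / w)) * (w * (w / ρ * l ^ 2 + qv / w)) ^ 2 := by gcongr
      _ = _ := by field_simp
  · have : w * ρ * (w / ρ * l ^ 2 + qv / w) = Δ * l ^ 2 + ρ * qv := by
      rw [← hw2]; field_simp
    rw [this, abs_le]
    have : 0 ≤ Δ * l ^ 2 := by positivity
    have : 0 ≤ ρ * qv := by positivity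
    constructor <;> linarith

lemma exists_covariant_of_disc_pos (c : Fin 4 → ℝ) (hD : 0 < cubicDisc c) : ∃ p q r : ℝ,
    0 < 4 * p * r - q ^ 2 ∧ 4 * p * r - q ^ 2 ≤ 5 ∧ 0 < p ∧ ∀ x y : ℝ,
      binEval (n := 3) c x y ^ 2 ≤
        Real.sqrt |cubicDisc c| * (p * x ^ 2 + q * x * y + r * y ^ 2) ^ 3 ∧
      |hessVal c x y| ≤ Real.sqrt |cubicDisc c| * (p * x ^ 2 + q * x * y + r * y ^ 2) := by
  rw [abs_of_pos hD]
  set w := Real.sqrt (cubicDisc c) with hw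
  have hw0 : 0 < w := Real.sqrt_pos.2 hD
  have hw2 : w ^ 2 = cubicDisc c := Real.sq_sqrt hD.le
  have hdisc : 4 * (hessA c / w) * (hessC c / w) - (hessB c / w) ^ 2 = 3 := by
    have : 4 * (hessA c / w) * (hessC c / w) - (hessB c / w) ^ 2 =
        (4 * hessA c * hessC c - hessB c ^ 2) / w ^ 2 := by ring
    rw [this, hess_disc, hw2, mul_div_assoc, div_self hD.ne', mul_one]
  have hsyz := fun x y : ℝ => cubic_syzygy (substForm c x (-y) y x)
  have hA3 : ∀ x y : ℝ, 0 ≤ 4 * hessVal c x y ^ 3 - 27 * binEval (n := 3) c x y ^ 2 *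
      cubicDisc c := by
    intro x y
    rcases eq_or_ne (x ^ 2 + y ^ 2) 0 with h | h
    · have hx : x = 0 := by nlinarith [sq_nonneg x, sq_nonneg y]
      have hy : y = 0 := by nlinarith [sq_nonneg x, sq_nonneg y]
      simp [hx, hy, hessVal, binEval_cubic]
    · have := hsyz x y
      have e0 : substForm c x (-y) y x 0 = binEval (n := 3) c x y := by
        rw [binEval_cubic]; rfl
      rw [cubicDisc_substForm, hessA_substForm, e0] at this
      have hpos : 0 < (x * x - -y * y) ^ 6 := by
        have : x * x - -y * y = x ^ 2 + y ^ 2 := by ring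
        rw [this]
        have : 0 < x ^ 2 + y ^ 2 := lt_of_le_of_ne (by positivity) h.symm
        positivity
      refine nonneg_of_mul_nonneg_right (a := (x * x - -y * y) ^ 6) ?_ hpos
      nlinarith [sq_nonneg (covU (substForm c x (-y) y x))]
  have hH0 : ∀ x y : ℝ, 0 ≤ hessVal c x y := by
    intro x y
    by_contra! h
    have h1 := hA3 x y
    have h2 : hessVal c x y ^ 3 < 0 := Odd.pow_neg (by decide) h
    nlinarith [mul_nonneg (sq_nonneg (binEval (n := 3) c x y)) hD.le]
  have hA0 : 0 < hessA c := by
    have h1 := hH0 1 0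
    simp only [hessVal] at h1
    have h2 : 0 ≤ hessA c := by linarith
    refine lt_of_le_of_ne h2 fun h => ?_
    have := hess_disc c
    rw [← h] at this
    nlinarith [sq_nonneg (hessB c)]
  refine ⟨hessA c / w, hessB c / w, hessC c / w, by rw [hdisc]; norm_num, by rw [hdisc]; norm_num,
    by positivity, fun x y => ?_⟩
  have hval : hessA c / w * x ^ 2 + hessB c / w * x * y + hessC c / w * y ^ 2 =
      hessVal c x y / w := by
    simp only [hessVal]; ring
  rw [hval, abs_of_nonneg (hH0 x y), mul_div_cancel₀ _ hw0.ne']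
  refine ⟨?_, le_rfl⟩
  have h1 := hA3 x y
  have h2 : w * (hessVal c x y / w) ^ 3 = hessVal c x y ^ 3 / w ^ 2 := by field_simp
  rw [h2, le_div_iff₀ (by positivity), hw2]
  have h3 : 0 ≤ binEval (n := 3) c x y ^ 2 * cubicDisc c := by positivity
  linarith

lemma map_cubicDisc {R S : Type*} [CommRing R] [CommRing S] (f : R →+* S) (c : Fin 4 → R) :
    cubicDisc (fun i => f (c i)) = f (cubicDisc c) := by
  simp only [cubicDisc, map_sub, map_add, map_mul, map_pow, map_ofNat]

lemma map_hessVal {R S : Type*} [CommRing R] [CommRing S] (f : R →+* S) (c : Fin 4 → R) (x y : R) :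
    hessVal (fun i => f (c i)) (f x) (f y) = f (hessVal c x y) := by
  simp only [hessVal, hessA, hessB, hessC, map_sub, map_add, map_mul, map_pow, map_ofNat]

lemma map_binEval {R S : Type*} [CommRing R] [CommRing S] (f : R →+* S) (c : Fin 4 → R) (x y : R) :
    binEval (n := 3) (fun i => f (c i)) (f x) (f y) = f (binEval (n := 3) c x y) := by
  simp [binEval_cubic]

lemma exists_reduced_vector (c : Fin 4 → ℤ) (hD : cubicDisc c ≠ 0) : ∃ x y : ℤ, IsCoprime x y ∧
    binEval (n := 3) c x y ^ 4 ≤ 256 * |cubicDisc c| ∧ hessVal c x y ^ 2 ≤ 9 * |cubicDisc c| := by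
  set f := Int.castRingHom ℝ with hf
  set c' : Fin 4 → ℝ := fun i => f (c i) with hc'
  have hDc : cubicDisc c' = f (cubicDisc c) := map_cubicDisc f c
  have hDf : f (cubicDisc c) = ((cubicDisc c : ℤ) : ℝ) := rfl
  obtain ⟨p, q, r, hp, h1, h2, h3⟩ : ∃ p q r : ℝ, 0 < p ∧
    0 < 4 * p * r - q ^ 2 ∧ 4 * p * r - q ^ 2 ≤ 5 ∧ ∀ x y : ℝ,
      binEval (n := 3) c' x y ^ 2 ≤
        Real.sqrt |cubicDisc c'| * (p * x ^ 2 + q * x * y + r * y ^ 2) ^ 3 ∧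
      |hessVal c' x y| ≤ Real.sqrt |cubicDisc c'| * (p * x ^ 2 + q * x * y + r * y ^ 2) := by
    rcases lt_or_gt_of_ne hD with h | h
    · exact exists_covariant_of_disc_neg c' (by rw [hDc, hDf]; exact_mod_cast h)
    · obtain ⟨p, q, r, h1, h2, h3, h4⟩ := exists_covariant_of_disc_pos c'
        (by rw [hDc, hDf]; exact_mod_cast h)
      exact ⟨p, q, r, h3, h1, h2, h4⟩
  obtain ⟨x, y, hco, hxy⟩ := exists_coprime_small_value hp h2
  obtain ⟨h4, h5⟩ := h3 x y
  have e1 : binEval (n := 3) c' x y = f (binEval (n := 3) c x y) := map_binEval f c x y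
  have e2 : hessVal c' x y = f (hessVal c x y) := map_hessVal f c x y
  rw [e1, hDc] at h4
  rw [e2, hDc] at h5
  set w := Real.sqrt |f (cubicDisc c)|
  have hw0 : 0 ≤ w := Real.sqrt_nonneg _
  have hw2 : w ^ 2 = |f (cubicDisc c)| := Real.sq_sqrt (abs_nonneg _)
  set v := p * (x : ℝ) ^ 2 + q * x * y + r * y ^ 2
  have hv0 : 0 ≤ v := by
    have : 0 ≤ 4 * p * v := by
      have : 4 * p * v = (2 * p * x + q * y) ^ 2 + (4 * p * r - q ^ 2) * y ^ 2 := by ring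
      rw [this]; positivity
    exact nonneg_of_mul_nonneg_right this (by positivity)
  refine ⟨x, y, hco, ?_, ?_⟩
  · have : (f (binEval (n := 3) c x y)) ^ 4 ≤ 256 * |f (cubicDisc c)| := by
      calc (f (binEval (n := 3) c x y)) ^ 4 = (f (binEval (n := 3) c x y) ^ 2) ^ 2 := by ring
        _ ≤ (w * v ^ 3) ^ 2 := by gcongr
        _ ≤ (w * (9 / 4) ^ 3) ^ 2 := by gcongr
        _ = w ^ 2 * ((9 / 4) ^ 6) := by ring
        _ ≤ w ^ 2 * 256 := by gcongr; norm_num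
        _ = _ := by rw [hw2]; ring
    simp only [hf, eq_intCast] at this
    exact_mod_cast this
  · have : (f (hessVal c x y)) ^ 2 ≤ 9 * |f (cubicDisc c)| := by
      calc (f (hessVal c x y)) ^ 2 = |f (hessVal c x y)| ^ 2 := (sq_abs _).symm
        _ ≤ (w * v) ^ 2 := by gcongr
        _ ≤ (w * (9 / 4)) ^ 2 := by gcongr
        _ = w ^ 2 * ((9 / 4) ^ 2) := by ring
        _ ≤ w ^ 2 * 9 := by gcongr; norm_num
        _ = _ := by rw [hw2]; ring
    simp only [hf, eq_intCast] at this
    exact_mod_cast this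

/-- Reduced representatives for classes of cubic forms. -/
structure IsReducedCubic (c : Fin 4 → ℤ) : Prop where
  disc_ne : cubicDisc c ≠ 0
  lead : c 0 ^ 4 ≤ 256 * |cubicDisc c|
  hess : hessA c ^ 2 ≤ 9 * |cubicDisc c|
  shift : c 0 ≠ 0 → 0 ≤ c 1 ∧ c 1 < 3 * |c 0|
  shift' : c 0 = 0 → 0 ≤ c 2 ∧ c 2 < 2 * |c 1|

lemma exists_isReducedCubic (c : Fin 4 → ℤ) (hD : cubicDisc c ≠ 0) :
    ∃ c', FormEquiv (n := 3) c c' ∧ cubicDisc c' = cubicDisc c ∧ IsReducedCubic c' := by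
  obtain ⟨x, y, ⟨u, v, huv⟩, h1, h2⟩ := exists_reduced_vector c hD
  have hdet : x * u - -v * y = 1 := by linarith
  set g := substForm c x (-v) y u with hg
  have hgD : cubicDisc g = cubicDisc c := by rw [hg, cubicDisc_substForm, hdet]; ring
  have hg0 : g 0 = binEval (n := 3) c x y := by rw [binEval_cubic]; rfl
  have hgA : hessA g = hessVal c x y := by rw [hg, hessA_substForm, hdet]; ring
  have hcg : FormEquiv (n := 3) c g := formEquiv_iff.2 ⟨x, -v, y, u, by rw [hdet]; simp, rfl⟩
  have shear : ∀ t : ℤ, FormEquiv (n := 3) c (substForm g 1 t 0 1) ∧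
      cubicDisc (substForm g 1 t 0 1) = cubicDisc c ∧
      substForm g 1 t 0 1 0 = binEval (n := 3) c x y ∧
      hessA (substForm g 1 t 0 1) = hessVal c x y := by
    intro t
    refine ⟨formEquiv_equivalence.trans hcg (formEquiv_iff.2 ⟨1, t, 0, 1, by simp, rfl⟩), ?_, ?_, ?_⟩
    · rw [cubicDisc_substForm, hgD]; ring
    · rw [← hg0]; simp [substForm]
    · rw [hessA_substForm, ← hgA]; simp [hessVal]
  by_cases h0 : g 0 = 0
  · have hg1 : g 1 ≠ 0 := by
      intro h
      apply hD
      rw [← hgD, cubicDisc, h0, h]; ring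
    obtain ⟨s1, s2, s3, s4⟩ := shear (-((g 2) / (2 * g 1)))
    refine ⟨_, s1, s2, ⟨by rwa [s2], by rwa [s3, s2], by rwa [s4, s2], fun h => ?_, fun _ => ?_⟩⟩
    · exact absurd (by rw [s3, ← hg0, h0]) h
    · have e2 : substForm g 1 (-((g 2) / (2 * g 1))) 0 1 2 = g 2 % (2 * g 1) := by
        rw [Int.emod_def]; simp [substForm, h0]; ring
      have e1 : substForm g 1 (-((g 2) / (2 * g 1))) 0 1 1 = g 1 := by simp [substForm, h0]
      rw [e1, e2]
      have hne : 2 * g 1 ≠ 0 := mul_ne_zero two_ne_zero hg1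
      refine ⟨Int.emod_nonneg _ hne, ?_⟩
      have := Int.emod_lt_abs (g 2) hne
      rwa [abs_mul, abs_two] at this
  · obtain ⟨s1, s2, s3, s4⟩ := shear (-((g 1) / (3 * g 0)))
    refine ⟨_, s1, s2, ⟨by rwa [s2], by rwa [s3, s2], by rwa [s4, s2], fun _ => ?_, fun h => ?_⟩⟩
    · have e1 : substForm g 1 (-((g 1) / (3 * g 0))) 0 1 1 = g 1 % (3 * g 0) := by
        rw [Int.emod_def]; simp [substForm]; ring
      rw [e1, s3, ← hg0]
      have hne : 3 * g 0 ≠ 0 := mul_ne_zero three_ne_zero h0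
      refine ⟨Int.emod_nonneg _ hne, ?_⟩
      have := Int.emod_lt_abs (g 1) hne
      rwa [abs_mul, show |(3 : ℤ)| = 3 from rfl] at this
    · exact absurd (by rw [hg0, ← s3, h]) h0

end Reduction

section ReducedCount

lemma card_le_sum_of_fiber_le {α β : Type*} [DecidableEq β] {S : Finset α} {t : Finset β}
    {f : α → β} (hf : ∀ x ∈ S, f x ∈ t) {g : β → ℝ}
    (hg : ∀ y ∈ t, (#{x ∈ S | f x = y} : ℝ) ≤ g y) : (#S : ℝ) ≤ ∑ y ∈ t, g y := by
  rw [card_eq_sum_card_fiberwise (f := f) (s := S) (t := t) hf]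
  push_cast
  exact sum_le_sum hg

lemma card_le_mul_of_fiber_le {α β : Type*} [DecidableEq β] {S : Finset α} {f : α → β} {k : ℕ}
    (hk : #(S.image f) ≤ k) {g : ℝ} (hg0 : 0 ≤ g)
    (hg : ∀ y ∈ S.image f, (#{x ∈ S | f x = y} : ℝ) ≤ g) : (#S : ℝ) ≤ k * g := by
  refine (card_le_sum_of_fiber_le (t := S.image f) (g := fun _ => g)
    (fun x hx => mem_image_of_mem f hx) hg).trans ?_
  rw [sum_const, nsmul_eq_mul]
  gcongr

lemma card_int_le {S : Finset ℤ} {ℓ : ℝ} (hℓ : 0 ≤ ℓ)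
    (h : ∀ x ∈ S, ∀ y ∈ S, x ≤ y → (y : ℝ) - x ≤ ℓ) : (#S : ℝ) ≤ ℓ + 1 := by
  rcases S.eq_empty_or_nonempty with rfl | hne
  · simp; linarith
  have h1 := h _ (S.min'_mem hne) _ (S.max'_mem hne) (S.min'_le_max' hne)
  have h2 : #S ≤ #(Icc (S.min' hne) (S.max' hne)) :=
    card_le_card fun x hx => mem_Icc.2 ⟨S.min'_le x hx, S.le_max' x hx⟩
  rw [Int.card_Icc] at h2
  have h3 : ((S.max' hne + 1 - S.min' hne).toNat : ℤ) = S.max' hne + 1 - S.min' hne :=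
    Int.toNat_of_nonneg (by linarith [S.min'_le_max' hne])
  have h4 : (#S : ℤ) ≤ S.max' hne + 1 - S.min' hne := by rw [← h3]; exact_mod_cast h2
  have h5 : (#S : ℝ) ≤ S.max' hne + 1 - S.min' hne := by exact_mod_cast h4
  linarith

lemma sq_sub_le_of_near {U V T R : ℝ} (hV : 0 ≤ V) (hVU : V ≤ U) (hU' : |U ^ 2 - T| ≤ R)
    (hV' : |V ^ 2 - T| ≤ R) : (U - V) ^ 2 ≤ 2 * R ∧ (U - V) ^ 4 * |T| ≤ 20 * R ^ 3 := by
  rw [abs_le] at hU' hV'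
  have h1 : (U - V) * (U + V) ≤ 2 * R := by nlinarith
  have h0 : 0 ≤ U - V := by linarith
  have h2 : (U - V) ^ 2 ≤ 2 * R := by nlinarith
  have hR : 0 ≤ R := by nlinarith [sq_nonneg (U - V)]
  refine ⟨h2, ?_⟩
  have h4 : (U - V) ^ 4 ≤ 4 * R ^ 2 := by
    calc (U - V) ^ 4 = ((U - V) ^ 2) ^ 2 := by ring
      _ ≤ (2 * R) ^ 2 := by gcongr
      _ = _ := by ring
  rcases le_or_gt |T| (4 * R) with hT | hT
  · calc (U - V) ^ 4 * |T| ≤ 4 * R ^ 2 * (4 * R) := by gcongr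
      _ ≤ _ := by nlinarith [pow_nonneg hR 3]
  · have hT0 : 0 ≤ T := by
      by_contra! h
      rw [abs_of_neg h] at hT
      nlinarith [sq_nonneg U]
    rw [abs_of_nonneg hT0] at hT ⊢
    have h5 : T ≤ 2 * (U + V) ^ 2 := by nlinarith
    have h6 : ((U - V) * (U + V)) ^ 2 ≤ (2 * R) ^ 2 :=
      pow_le_pow_left₀ (mul_nonneg h0 (by linarith)) h1 2
    calc (U - V) ^ 4 * T ≤ (U - V) ^ 4 * (2 * (U + V) ^ 2) := by gcongr
      _ = 2 * (U - V) ^ 2 * ((U - V) * (U + V)) ^ 2 := by ring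
      _ ≤ 2 * (2 * R) * (2 * R) ^ 2 := by gcongr
      _ ≤ _ := by nlinarith [pow_nonneg hR 3]

/-- The nonnegative fourth root of the absolute value. -/
noncomputable def fourthRoot (x : ℝ) : ℝ := Real.sqrt (Real.sqrt |x|)

lemma fourthRoot_nonneg (x : ℝ) : 0 ≤ fourthRoot x := Real.sqrt_nonneg _

lemma fourthRoot_pow (x : ℝ) : fourthRoot x ^ 4 = |x| := by
  rw [fourthRoot, show 4 = 2 * 2 from rfl, pow_mul, Real.sq_sqrt (Real.sqrt_nonneg _),
    Real.sq_sqrt (abs_nonneg _)]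

lemma fourthRoot_pos {x : ℝ} (hx : x ≠ 0) : 0 < fourthRoot x :=
  Real.sqrt_pos.2 (Real.sqrt_pos.2 (abs_pos.2 hx))

lemma sum_inv_fourthRoot_cube_le (J : ℕ) :
    ∑ j ∈ Icc 1 J, 1 / fourthRoot j ^ 3 ≤ 4 * fourthRoot J := by
  induction J with
  | zero => simpa using fourthRoot_nonneg 0
  | succ J ih =>
    rw [sum_Icc_succ_top (by omega)]
    set s := fourthRoot (J + 1 : ℕ) with hs
    set t := fourthRoot J with ht
    have hs0 : 0 < s := fourthRoot_pos (by positivity)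
    have ht0 : 0 ≤ t := fourthRoot_nonneg _
    have e : s ^ 4 - t ^ 4 = 1 := by
      rw [hs, ht, fourthRoot_pow, fourthRoot_pow, Nat.abs_cast, Nat.abs_cast]; push_cast; ring
    have hts : t ≤ s := by
      refine le_of_pow_le_pow_left₀ (n := 4) (by norm_num) hs0.le ?_
      linarith
    have key : 1 / s ^ 3 ≤ 4 * (s - t) := by
      rw [div_le_iff₀ (by positivity), ← e]
      have : s ^ 4 - t ^ 4 = (s - t) * (s ^ 3 + s ^ 2 * t + s * t ^ 2 + t ^ 3) := by ring
      rw [this]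
      have h1 : s ^ 2 * t ≤ s ^ 2 * s := by gcongr
      have h2 : s * t ^ 2 ≤ s * s ^ 2 := by gcongr
      have h3 : t ^ 3 ≤ s ^ 3 := by gcongr
      nlinarith [sub_nonneg.2 hts]
    linarith

lemma sum_inv_fourthRoot_sq_le (J : ℕ) :
    ∑ j ∈ Icc 1 J, 1 / fourthRoot j ^ 2 ≤ 2 * Real.sqrt J := by
  have hsq : ∀ j : ℕ, fourthRoot j ^ 2 = Real.sqrt j := fun j => by
    rw [fourthRoot, Real.sq_sqrt (Real.sqrt_nonneg _), Nat.abs_cast]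
  simp only [hsq]
  induction J with
  | zero => simp
  | succ J ih =>
    rw [sum_Icc_succ_top (by omega)]
    set s := Real.sqrt (J + 1 : ℕ) with hs
    set t := Real.sqrt J with ht
    have hs0 : 0 < s := Real.sqrt_pos.2 (by positivity)
    have e : s ^ 2 - t ^ 2 = 1 := by
      rw [hs, ht, Real.sq_sqrt (by positivity), Real.sq_sqrt (by positivity)]; push_cast; ring
    have hts : t ≤ s := Real.sqrt_le_sqrt (by push_cast; linarith)
    have key : 1 / s ≤ 2 * (s - t) := by
      rw [div_le_iff₀ hs0, ← e]
      nlinarith [sub_nonneg.2 hts]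
    linarith

lemma sum_inv_sq_le (J : ℕ) : ∑ j ∈ Icc 1 J, 1 / (j : ℝ) ^ 2 ≤ 2 := by
  suffices h : ∑ j ∈ Icc 1 J, 1 / (j : ℝ) ^ 2 ≤ 2 - 2 / ((J : ℝ) + 1) by
    have : 0 < 2 / ((J : ℝ) + 1) := by positivity
    linarith
  induction J with
  | zero => simp
  | succ J ih =>
    rw [sum_Icc_succ_top (by omega)]
    push_cast
    have e : 2 / ((J : ℝ) + 1) - 2 / ((J : ℝ) + 1 + 1) = 2 / (((J : ℝ) + 1) * (J + 1 + 1)) := by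
      field_simp; ring
    have : 1 / ((J : ℝ) + 1) ^ 2 ≤ 2 / (((J : ℝ) + 1) * (J + 1 + 1)) := by
      rw [div_le_div_iff₀ (by positivity) (by positivity)]
      nlinarith [(Nat.cast_nonneg J : (0 : ℝ) ≤ J)]
    linarith

lemma card_lastCoeff_le {a b c : ℤ} (ha : a ≠ 0) {Y : ℝ} (hY : 0 < Y) {S : Finset ℤ}
    (hS : ∀ d ∈ S, |((cubicDisc ![a, b, c, d] : ℤ) : ℝ)| < Y ^ 8) {ℓ : ℝ} (hℓ0 : 0 ≤ ℓ)
    (hℓ : ∀ t : ℝ, t ^ 2 * |(a : ℝ)| ^ 2 ≤ Y ^ 8 →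
      t ^ 4 * (|(a : ℝ)| ^ 2 * |((b ^ 2 - 3 * a * c : ℤ) : ℝ)| ^ 3) ≤ Y ^ 24 → t ≤ ℓ) :
    (#S : ℝ) ≤ 2 * (ℓ + 1) := by
  set U : ℤ → ℤ := fun d => covU ![a, b, c, d] with hU
  have hUval : ∀ d, U d = 2 * b ^ 3 + 27 * a ^ 2 * d - 9 * a * b * c := fun d => by
    simp [hU, covU]
  have ha2 : (0 : ℝ) < (a : ℝ) ^ 2 := by positivity
  have hnear : ∀ d ∈ S, |((U d : ℤ) : ℝ) ^ 2 - 4 * ((b ^ 2 - 3 * a * c : ℤ) : ℝ) ^ 3| ≤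
      27 * (a : ℝ) ^ 2 * Y ^ 8 := by
    intro d hd
    have h1 := cubic_syzygy ![a, b, c, d]
    have h2 : ((U d : ℤ) : ℝ) ^ 2 - 4 * ((b ^ 2 - 3 * a * c : ℤ) : ℝ) ^ 3 =
        -(27 * (a : ℝ) ^ 2 * ((cubicDisc ![a, b, c, d] : ℤ) : ℝ)) := by
      have : (U d) ^ 2 - 4 * (b ^ 2 - 3 * a * c) ^ 3 = -(27 * a ^ 2 * cubicDisc ![a, b, c, d]) := by
        simp only [hessA, Matrix.cons_val] at h1
        linarith
      exact_mod_cast this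
    rw [h2, abs_neg, abs_mul, abs_of_pos (by positivity : (0 : ℝ) < 27 * (a : ℝ) ^ 2)]
    exact mul_le_mul_of_nonneg_left (hS d hd).le (by positivity)
  have hpair : ∀ x ∈ S, ∀ y ∈ S, 0 ≤ U x → 0 ≤ U y → x ≤ y → (y : ℝ) - x ≤ ℓ := by
    intro x hx y hy hx0 _ hxy
    have hle : U x ≤ U y := by
      rw [hUval, hUval]
      have : 27 * a ^ 2 * x ≤ 27 * a ^ 2 * y := by gcongr
      linarith
    obtain ⟨h1, h2⟩ := sq_sub_le_of_near (by exact_mod_cast hx0) (by exact_mod_cast hle)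
      (hnear y hy) (hnear x hx)
    have hdiff : ((U y : ℤ) : ℝ) - ((U x : ℤ) : ℝ) = 27 * (a : ℝ) ^ 2 * ((y : ℝ) - x) := by
      rw [hUval, hUval]; push_cast; ring
    rw [hdiff] at h1 h2
    refine hℓ _ ?_ ?_
    · rw [sq_abs]
      refine le_of_mul_le_mul_left ?_ (by positivity : (0 : ℝ) < 54 * (a : ℝ) ^ 2)
      nlinarith [mul_nonneg (sq_nonneg ((a : ℝ) ^ 2)) (sq_nonneg ((y : ℝ) - x))]
    · rw [sq_abs]
      rw [abs_mul, abs_pow, abs_of_pos (by norm_num : (0 : ℝ) < 4)] at h2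
      set T := |((b ^ 2 - 3 * a * c : ℤ) : ℝ)| ^ 3
      have hT : 0 ≤ T := by positivity
      have h3 : ((y : ℝ) - x) ^ 4 * ((a : ℝ) ^ 2 * T) * (4 * 27 ^ 4 * (a : ℝ) ^ 6) ≤
          Y ^ 24 * (20 * 27 ^ 3 * (a : ℝ) ^ 6) := by linarith
      have h4 : Y ^ 24 * (20 * 27 ^ 3 * (a : ℝ) ^ 6) ≤ Y ^ 24 * (4 * 27 ^ 4 * (a : ℝ) ^ 6) := by
        gcongr ?_ * (?_ * _)
        norm_num
      exact le_of_mul_le_mul_right (h3.trans h4) (by positivity)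
  have hpair' : ∀ x ∈ S, ∀ y ∈ S, U x < 0 → U y < 0 → x ≤ y → (y : ℝ) - x ≤ ℓ := by
    intro x hx y hy _ hy0 hxy
    have hle : U x ≤ U y := by
      rw [hUval, hUval]
      have : 27 * a ^ 2 * x ≤ 27 * a ^ 2 * y := by gcongr
      linarith
    have hny := hnear y hy
    have hnx := hnear x hx
    rw [← neg_sq ((U y : ℤ) : ℝ)] at hny
    rw [← neg_sq ((U x : ℤ) : ℝ)] at hnx
    obtain ⟨h1, h2⟩ := sq_sub_le_of_near (U := -((U x : ℤ) : ℝ)) (V := -((U y : ℤ) : ℝ))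
      (by rw [neg_nonneg]; exact_mod_cast hy0.le) (by rw [neg_le_neg_iff]; exact_mod_cast hle)
      hnx hny
    have hdiff : -((U x : ℤ) : ℝ) - -((U y : ℤ) : ℝ) = 27 * (a : ℝ) ^ 2 * ((y : ℝ) - x) := by
      rw [hUval, hUval]; push_cast; ring
    rw [hdiff] at h1 h2
    refine hℓ _ ?_ ?_
    · rw [sq_abs]
      refine le_of_mul_le_mul_left ?_ (by positivity : (0 : ℝ) < 54 * (a : ℝ) ^ 2)
      nlinarith [mul_nonneg (sq_nonneg ((a : ℝ) ^ 2)) (sq_nonneg ((y : ℝ) - x))]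
    · rw [sq_abs]
      rw [abs_mul, abs_pow, abs_of_pos (by norm_num : (0 : ℝ) < 4)] at h2
      set T := |((b ^ 2 - 3 * a * c : ℤ) : ℝ)| ^ 3
      have hT : 0 ≤ T := by positivity
      have h3 : ((y : ℝ) - x) ^ 4 * ((a : ℝ) ^ 2 * T) * (4 * 27 ^ 4 * (a : ℝ) ^ 6) ≤
          Y ^ 24 * (20 * 27 ^ 3 * (a : ℝ) ^ 6) := by linarith
      have h4 : Y ^ 24 * (20 * 27 ^ 3 * (a : ℝ) ^ 6) ≤ Y ^ 24 * (4 * 27 ^ 4 * (a : ℝ) ^ 6) := by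
        gcongr ?_ * (?_ * _)
        norm_num
      exact le_of_mul_le_mul_right (h3.trans h4) (by positivity)
  have hsplit := card_filter_add_card_filter_not (s := S) (fun d => 0 ≤ U d)
  have hc1 := card_int_le (S := S.filter fun d => 0 ≤ U d) hℓ0 fun x hx y hy hxy =>
    hpair x (mem_filter.1 hx).1 y (mem_filter.1 hy).1 (mem_filter.1 hx).2 (mem_filter.1 hy).2 hxy
  have hc2 := card_int_le (S := S.filter fun d => ¬ 0 ≤ U d) hℓ0 fun x hx y hy hxy =>
    hpair' x (mem_filter.1 hx).1 y (mem_filter.1 hy).1 (not_le.1 (mem_filter.1 hx).2)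
      (not_le.1 (mem_filter.1 hy).2) hxy
  rw [← hsplit]
  push_cast
  linarith

end ReducedCount

section ReducedCountTotal

lemma cubic_eta (c : Fin 4 → ℤ) : c = ![c 0, c 1, c 2, c 3] := by
  funext i
  fin_cases i <;> rfl

lemma card_fixed_two_le {a b : ℤ} (ha : a ≠ 0) {Y : ℝ} (hY : 1 ≤ Y) {S : Finset (Fin 4 → ℤ)}
    (hS : ∀ c ∈ S, IsReducedCubic c ∧ ((|cubicDisc c| : ℤ) : ℝ) < Y ^ 8 ∧ c 0 = a ∧ c 1 = b) :
    (#S : ℝ) ≤ 8 * Y ^ 4 / |(a : ℝ)| + 4 + 16 * Y ^ 7 / fourthRoot a ^ 6 := by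
  have hY0 : 0 < Y := by linarith
  have ha' : (a : ℝ) ≠ 0 := by exact_mod_cast ha
  have habs : 0 < |(a : ℝ)| := abs_pos.2 ha'
  set s := fourthRoot a with hs
  have hs0 : 0 < s := fourthRoot_pos ha'
  have hs4 : s ^ 4 = |(a : ℝ)| := fourthRoot_pow _
  set k : (Fin 4 → ℤ) → ℕ := fun c => (hessA c).natAbs / (3 * a.natAbs) with hk
  set J := ⌊Y ^ 4 / |(a : ℝ)|⌋₊ with hJ
  have hJle : (J : ℝ) ≤ Y ^ 4 / |(a : ℝ)| := Nat.floor_le (by positivity)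
  have h3a : 0 < 3 * a.natAbs := by have := Int.natAbs_pos.2 ha; omega
  have hkJ : ∀ c ∈ S, k c ∈ insert 0 (Icc 1 J) := by
    intro c hc
    obtain ⟨hr, hD, h0, h1⟩ := hS c hc
    suffices k c ≤ J by
      rw [mem_insert, mem_Icc]; omega
    refine Nat.le_floor ?_
    have hA : |((hessA c : ℤ) : ℝ)| ≤ 3 * Y ^ 4 := by
      refine abs_le_of_sq_le_sq ?_ (by positivity)
      have : ((hessA c : ℤ) : ℝ) ^ 2 ≤ 9 * ((|cubicDisc c| : ℤ) : ℝ) := by exact_mod_cast hr.hess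
      calc ((hessA c : ℤ) : ℝ) ^ 2 ≤ 9 * Y ^ 8 := by linarith
        _ = _ := by ring
    have e1 : k c * (3 * a.natAbs) ≤ (hessA c).natAbs := Nat.div_mul_le_self _ _
    have e2 : (k c : ℝ) * (3 * |(a : ℝ)|) ≤ |((hessA c : ℤ) : ℝ)| := by
      have : ((k c * (3 * a.natAbs) : ℕ) : ℝ) ≤ ((hessA c).natAbs : ℕ) := by exact_mod_cast e1
      push_cast [Nat.cast_natAbs] at this
      exact this
    rw [le_div_iff₀ habs]
    linarith
  have hfib : ∀ j ∈ insert 0 (Icc 1 J), ∀ ℓ : ℝ, 0 ≤ ℓ → (∀ t : ℝ, t ^ 2 * |(a : ℝ)| ^ 2 ≤ Y ^ 8 →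
      t ^ 4 * (|(a : ℝ)| ^ 5 * (j : ℝ) ^ 3) ≤ Y ^ 24 → t ≤ ℓ) →
      (#{c ∈ S | k c = j} : ℝ) ≤ 4 * (ℓ + 1) := by
    intro j _ ℓ hℓ0 hℓ
    have := card_le_mul_of_fiber_le (S := {c ∈ S | k c = j}) (f := fun c => c 2) (k := 2)
      (g := 2 * (ℓ + 1)) ?_ (by positivity) ?_
    · push_cast at this; linarith
    · have hcard : #(univ : Finset Bool) = 2 := rfl
      rw [← hcard]
      refine card_le_card_of_injOn (fun z => decide (0 ≤ b ^ 2 - 3 * a * z))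
        (fun _ _ => mem_coe.2 (mem_univ _)) ?_
      intro z hz w hw hzw
      simp only [coe_image, Set.mem_image, mem_coe, mem_filter] at hz hw
      obtain ⟨c, ⟨hc, hcj⟩, rfl⟩ := hz
      obtain ⟨c', ⟨hc', hcj'⟩, rfl⟩ := hw
      obtain ⟨-, -, h0, h1⟩ := hS c hc
      obtain ⟨-, -, h0', h1'⟩ := hS c' hc'
      have e1 : hessA c = b ^ 2 - 3 * a * c 2 := by rw [hessA, h0, h1]
      have e2 : hessA c' = b ^ 2 - 3 * a * c' 2 := by rw [hessA, h0', h1']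
      simp only [decide_eq_decide] at hzw
      rw [← e1, ← e2] at hzw
      have l1 : (hessA c).natAbs < (j + 1) * (3 * a.natAbs) := by
        exact (Nat.div_lt_iff_lt_mul h3a).1 (Nat.lt_succ_of_le hcj.le)
      have l2 : j * (3 * a.natAbs) ≤ (hessA c).natAbs := by
        rw [← hcj]; exact Nat.div_mul_le_self _ _
      have l3 : (hessA c').natAbs < (j + 1) * (3 * a.natAbs) := by
        exact (Nat.div_lt_iff_lt_mul h3a).1 (Nat.lt_succ_of_le hcj'.le)
      have l4 : j * (3 * a.natAbs) ≤ (hessA c').natAbs := by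
        rw [← hcj']; exact Nat.div_mul_le_self _ _
      rw [add_one_mul] at l1 l3
      generalize j * (3 * a.natAbs) = M at l1 l2 l3 l4
      have l5 : |hessA c - hessA c'| < 3 * |a| := by
        rw [abs_lt, Int.abs_eq_natAbs]
        constructor <;> omega
      have l6 : hessA c - hessA c' = 3 * a * (c' 2 - c 2) := by rw [e1, e2]; ring
      rw [l6, abs_mul, abs_mul, show |(3 : ℤ)| = 3 from rfl] at l5
      have l7 : |c' 2 - c 2| < 1 := by
        by_contra! h
        have : 3 * |a| * 1 ≤ 3 * |a| * |c' 2 - c 2| := by gcongr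
        linarith
      have := Int.abs_lt_one_iff.1 l7
      show c 2 = c' 2
      linarith
    · intro z hz
      rw [mem_image] at hz
      obtain ⟨c, hc, rfl⟩ := hz
      have hcS := (mem_filter.1 hc).1
      have hcj := (mem_filter.1 hc).2
      obtain ⟨-, -, h0, h1⟩ := hS c hcS
      have e1 : hessA c = b ^ 2 - 3 * a * c 2 := by rw [hessA, h0, h1]
      set T := {c' ∈ {c ∈ S | k c = j} | c' 2 = c 2} with hT
      have hTmem : ∀ c' ∈ T, c' = ![a, b, c 2, c' 3] ∧ ((|cubicDisc c'| : ℤ) : ℝ) < Y ^ 8 := by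
        intro c' hc'
        rw [hT, mem_filter, mem_filter] at hc'
        obtain ⟨-, h8, h0', h1'⟩ := hS c' hc'.1.1
        refine ⟨?_, h8⟩
        rw [← h0', ← h1', ← hc'.2]
        exact cubic_eta c'
      have hinj : Set.InjOn (fun c' : Fin 4 → ℤ => c' 3) T := by
        intro x hx y hy hxy
        simp only at hxy
        rw [(hTmem x hx).1, (hTmem y hy).1, hxy]
      rw [← card_image_of_injOn hinj]
      refine card_lastCoeff_le (a := a) (b := b) (c := c 2) ha hY0 ?_ hℓ0 fun t h1 h2 => ?_
      · intro d hd
        obtain ⟨c', hc', rfl⟩ := mem_image.1 hd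
        have := hTmem c' hc'
        rw [← this.1]
        exact_mod_cast this.2
      · refine hℓ t h1 (le_trans ?_ h2)
        refine mul_le_mul_of_nonneg_left ?_ (by positivity)
        have l2 : j * (3 * a.natAbs) ≤ (hessA c).natAbs := by
          rw [← hcj]; exact Nat.div_mul_le_self _ _
        have l3 : (j : ℝ) * (3 * |(a : ℝ)|) ≤ |((hessA c : ℤ) : ℝ)| := by
          have : ((j * (3 * a.natAbs) : ℕ) : ℝ) ≤ ((hessA c).natAbs : ℕ) := by exact_mod_cast l2
          push_cast [Nat.cast_natAbs] at this
          exact this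
        rw [← e1]
        have l4 : |(a : ℝ)| * j ≤ |((hessA c : ℤ) : ℝ)| := by
          nlinarith [mul_nonneg (Nat.cast_nonneg j : (0 : ℝ) ≤ j) habs.le]
        calc |(a : ℝ)| ^ 5 * (j : ℝ) ^ 3 = |(a : ℝ)| ^ 2 * (|(a : ℝ)| * j) ^ 3 := by ring
          _ ≤ _ := by gcongr
  have hsum := card_le_sum_of_fiber_le (S := S) (t := insert 0 (Icc 1 J)) (f := k) hkJ
    (g := fun j => if j = 0 then 4 * (Y ^ 4 / |(a : ℝ)| + 1) else
      4 * (Y ^ 6 / s ^ 5 * (1 / fourthRoot j ^ 3) + 1)) ?_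
  swap
  · intro j hj
    split_ifs with h0
    · refine hfib j hj _ (by positivity) fun t h1 _ => ?_
      rw [le_div_iff₀ habs]
      refine le_of_pow_le_pow_left₀ two_ne_zero (by positivity) ?_
      linarith
    · have hj0 : (j : ℝ) ≠ 0 := by exact_mod_cast h0
      have hfj := fourthRoot_pos hj0
      refine hfib j hj _ (by positivity) fun t _ h2 => ?_
      rw [div_mul_div_comm, mul_one, le_div_iff₀ (by positivity)]
      refine le_of_pow_le_pow_left₀ four_ne_zero (by positivity) ?_
      have h4 : fourthRoot j ^ 4 = j := by rw [fourthRoot_pow, Nat.abs_cast]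
      calc (t * (s ^ 5 * fourthRoot j ^ 3)) ^ 4 = t ^ 4 * ((s ^ 4) ^ 5 * (fourthRoot j ^ 4) ^ 3) := by
            ring
        _ ≤ Y ^ 24 := by rw [hs4, h4]; exact h2
        _ = _ := by ring
  refine hsum.trans ?_
  rw [sum_insert (by simp), if_pos rfl]
  have hrest : ∑ j ∈ Icc 1 J, (if j = 0 then 4 * (Y ^ 4 / |(a : ℝ)| + 1) else
      4 * (Y ^ 6 / s ^ 5 * (1 / fourthRoot j ^ 3) + 1)) =
      4 * (Y ^ 6 / s ^ 5) * ∑ j ∈ Icc 1 J, 1 / fourthRoot j ^ 3 + 4 * J := by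
    rw [mul_sum, show (4 * J : ℝ) = ∑ j ∈ Icc 1 J, (4 : ℝ) by simp; ring, ← sum_add_distrib]
    refine sum_congr rfl fun j hj => ?_
    rw [if_neg (by have := (mem_Icc.1 hj).1; omega)]
    ring
  rw [hrest]
  have hfJ : fourthRoot J ≤ Y / s := by
    refine le_of_pow_le_pow_left₀ four_ne_zero (by positivity) ?_
    rw [fourthRoot_pow, Nat.abs_cast, div_pow, hs4]
    exact hJle
  have : 4 * (Y ^ 6 / s ^ 5) * ∑ j ∈ Icc 1 J, 1 / fourthRoot j ^ 3 ≤ 16 * Y ^ 7 / s ^ 6 := by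
    calc 4 * (Y ^ 6 / s ^ 5) * ∑ j ∈ Icc 1 J, 1 / fourthRoot j ^ 3 ≤
          4 * (Y ^ 6 / s ^ 5) * (4 * (Y / s)) := by
            gcongr
            exact (sum_inv_fourthRoot_cube_le J).trans (by gcongr)
      _ = _ := by field_simp; ring
  have e8 : 8 * Y ^ 4 / |(a : ℝ)| = 4 * (Y ^ 4 / |(a : ℝ)|) + 4 * (Y ^ 4 / |(a : ℝ)|) := by ring
  rw [e8]
  linarith

lemma card_reduced_lead_ne_zero_le {Y : ℝ} (hY : 1 ≤ Y) {S : Finset (Fin 4 → ℤ)}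
    (hS : ∀ c ∈ S, IsReducedCubic c ∧ ((|cubicDisc c| : ℤ) : ℝ) < Y ^ 8 ∧ c 0 ≠ 0) :
    (#S : ℝ) ≤ 1000 * Y ^ 8 := by
  have hY0 : 0 < Y := by linarith
  have hlead : ∀ c ∈ S, |((c 0 : ℤ) : ℝ)| ≤ 4 * Y ^ 2 := by
    intro c hc
    obtain ⟨hr, hD, -⟩ := hS c hc
    refine le_of_pow_le_pow_left₀ four_ne_zero (by positivity) ?_
    have : ((c 0 : ℤ) : ℝ) ^ 4 ≤ 256 * ((|cubicDisc c| : ℤ) : ℝ) := by exact_mod_cast hr.lead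
    have e : |((c 0 : ℤ) : ℝ)| ^ 4 = ((c 0 : ℤ) : ℝ) ^ 4 := by
      rw [← abs_pow, abs_of_nonneg (by positivity)]
    rw [e]
    calc ((c 0 : ℤ) : ℝ) ^ 4 ≤ 256 * Y ^ 8 := by linarith
      _ = _ := by ring
  set N := ⌊4 * Y ^ 2⌋₊ with hN
  have hNle : (N : ℝ) ≤ 4 * Y ^ 2 := Nat.floor_le (by positivity)
  have hsum := card_le_sum_of_fiber_le (S := S) (t := Icc 1 N) (f := fun c => (c 0).natAbs)
    (g := fun n => 144 * Y ^ 4 + 96 * Y ^ 7 * (1 / fourthRoot n ^ 2)) ?_ ?_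
  · refine hsum.trans ?_
    rw [sum_add_distrib, ← mul_sum _ _ (96 * Y ^ 7)]
    have h1 := sum_inv_fourthRoot_sq_le N
    have h2 : Real.sqrt N ≤ 2 * Y := by
      rw [Real.sqrt_le_left (by positivity)]
      linarith
    have h3 : ∑ n ∈ Icc 1 N, 144 * Y ^ 4 ≤ 576 * Y ^ 6 := by
      rw [sum_const, Nat.card_Icc, nsmul_eq_mul, Nat.add_sub_cancel]
      calc (N : ℝ) * (144 * Y ^ 4) ≤ 4 * Y ^ 2 * (144 * Y ^ 4) := by gcongr
        _ = _ := by ring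
    have h4 : 96 * Y ^ 7 * ∑ n ∈ Icc 1 N, 1 / fourthRoot n ^ 2 ≤ 384 * Y ^ 8 := by
      calc 96 * Y ^ 7 * ∑ n ∈ Icc 1 N, 1 / fourthRoot n ^ 2 ≤ 96 * Y ^ 7 * (2 * (2 * Y)) := by
            gcongr; linarith
        _ = _ := by ring
    have h5 : Y ^ 6 ≤ Y ^ 8 := pow_le_pow_right₀ hY (by norm_num)
    have h6 : 0 < Y ^ 8 := by positivity
    linarith
  · intro c hc
    have h1 := hlead c hc
    have h2 := Int.natAbs_pos.2 (hS c hc).2.2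
    refine mem_Icc.2 ⟨h2, Nat.le_floor ?_⟩
    rwa [Nat.cast_natAbs, Int.cast_abs]
  · intro n hn
    obtain ⟨hn1, hnN⟩ := mem_Icc.1 hn
    have hn0 : (0 : ℝ) < n := by exact_mod_cast hn1
    have hf := fourthRoot_pos hn0.ne'
    have hn4 : (n : ℝ) ≤ 4 * Y ^ 2 := le_trans (by exact_mod_cast hnN) hNle
    have := card_le_mul_of_fiber_le (S := {c ∈ S | (c 0).natAbs = n}) (f := fun c => c 0) (k := 2)
      (g := 72 * Y ^ 4 + 48 * Y ^ 7 * (1 / fourthRoot n ^ 2)) ?_ (by positivity) ?_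
    · push_cast at this; linarith
    · refine le_trans (card_le_card (t := {(n : ℤ), -(n : ℤ)}) ?_) card_le_two
      intro a ha
      obtain ⟨c, hc, rfl⟩ := mem_image.1 ha
      have := (mem_filter.1 hc).2
      rw [mem_insert, mem_singleton]
      omega
    · intro a ha
      obtain ⟨c₀, hc₀, rfl⟩ := mem_image.1 ha
      have han := (mem_filter.1 hc₀).2
      set a := c₀ 0 with ha_def
      have ha0 : a ≠ 0 := by omega
      have haR : |(a : ℝ)| = n := by rw [← han, Nat.cast_natAbs, Int.cast_abs]
      have hfa : fourthRoot a = fourthRoot n := by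
        rw [fourthRoot, fourthRoot, haR, abs_of_pos hn0]
      have hmem : ∀ c ∈ {c ∈ {c ∈ S | (c 0).natAbs = n} | c 0 = a},
          IsReducedCubic c ∧ ((|cubicDisc c| : ℤ) : ℝ) < Y ^ 8 ∧ c 0 = a := by
        intro c hc
        rw [mem_filter, mem_filter] at hc
        exact ⟨(hS c hc.1.1).1, (hS c hc.1.1).2.1, hc.2⟩
      have := card_le_mul_of_fiber_le (S := {c ∈ {c ∈ S | (c 0).natAbs = n} | c 0 = a})
        (f := fun c => c 1) (k := 3 * n)
        (g := 8 * Y ^ 4 / |(a : ℝ)| + 4 + 16 * Y ^ 7 / fourthRoot a ^ 6) ?_ ?_ ?_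
      · refine this.trans ?_
        rw [haR, hfa]
        have e4 : fourthRoot n ^ 4 = n := by rw [fourthRoot_pow, Nat.abs_cast]
        have e6 : 16 * Y ^ 7 / fourthRoot n ^ 6 = 16 * Y ^ 7 * (1 / fourthRoot n ^ 2) / n := by
          generalize fourthRoot n = f at e4 hf
          rw [← e4]; field_simp
        rw [e6]
        push_cast
        have e7 : 3 * (n : ℝ) * (8 * Y ^ 4 / n + 4 + 16 * Y ^ 7 * (1 / fourthRoot n ^ 2) / n) =
            24 * Y ^ 4 + 12 * n + 48 * Y ^ 7 * (1 / fourthRoot n ^ 2) := by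
          field_simp; ring
        rw [e7]
        have : Y ^ 2 ≤ Y ^ 4 := pow_le_pow_right₀ hY (by norm_num)
        linarith
      · have hcard : #(Ico (0 : ℤ) (3 * n)) = 3 * n := by
          rw [Int.card_Ico]; omega
        rw [← hcard]
        refine card_le_card fun b hb => ?_
        obtain ⟨c, hc, rfl⟩ := mem_image.1 hb
        obtain ⟨hr, -, h0⟩ := hmem c hc
        have := hr.shift (by rw [h0]; exact ha0)
        rw [h0, Int.abs_eq_natAbs, han] at this
        rw [mem_Ico]
        omega
      · rw [haR, hfa]; positivity
      · intro b _
        refine card_fixed_two_le (b := b) ha0 hY fun c hc => ?_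
        rw [mem_filter] at hc
        have := hmem c hc.1
        exact ⟨this.1, this.2.1, this.2.2, hc.2⟩

lemma card_reduced_lead_zero_le {Y : ℝ} (hY : 1 ≤ Y) {S : Finset (Fin 4 → ℤ)}
    (hS : ∀ c ∈ S, IsReducedCubic c ∧ ((|cubicDisc c| : ℤ) : ℝ) < Y ^ 8 ∧ c 0 = 0) :
    (#S : ℝ) ≤ 100 * Y ^ 8 := by
  have hY0 : 0 < Y := by linarith
  have hc1 : ∀ c ∈ S, c 1 ≠ 0 ∧ |((c 1 : ℤ) : ℝ)| ≤ 2 * Y ^ 2 := by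
    intro c hc
    obtain ⟨hr, hD, h0⟩ := hS c hc
    refine ⟨fun h => hr.disc_ne (by rw [cubicDisc, h0, h]; ring), ?_⟩
    refine le_of_pow_le_pow_left₀ four_ne_zero (by positivity) ?_
    have h1 : hessA c = c 1 ^ 2 := by rw [hessA, h0]; ring
    have : ((hessA c : ℤ) : ℝ) ^ 2 ≤ 9 * ((|cubicDisc c| : ℤ) : ℝ) := by exact_mod_cast hr.hess
    rw [h1] at this
    push_cast at this hD
    have e : |((c 1 : ℤ) : ℝ)| ^ 4 = ((c 1 : ℝ) ^ 2) ^ 2 := by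
      rw [← abs_pow, abs_of_nonneg (by positivity)]; ring
    rw [e]
    calc ((c 1 : ℝ) ^ 2) ^ 2 ≤ 9 * Y ^ 8 := by linarith
      _ ≤ 16 * Y ^ 8 := by gcongr; norm_num
      _ = _ := by ring
  set N := ⌊2 * Y ^ 2⌋₊ with hN
  have hNle : (N : ℝ) ≤ 2 * Y ^ 2 := Nat.floor_le (by positivity)
  have hsum := card_le_sum_of_fiber_le (S := S) (t := Icc 1 N) (f := fun c => (c 1).natAbs)
    (g := fun n => 8 * Y ^ 2 + 4 * Y ^ 8 * (1 / (n : ℝ) ^ 2)) ?_ ?_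
  · refine hsum.trans ?_
    rw [sum_add_distrib, ← mul_sum _ _ (4 * Y ^ 8)]
    have h1 := sum_inv_sq_le N
    have h3 : ∑ n ∈ Icc 1 N, 8 * Y ^ 2 ≤ 16 * Y ^ 4 := by
      rw [sum_const, Nat.card_Icc, nsmul_eq_mul, Nat.add_sub_cancel]
      calc (N : ℝ) * (8 * Y ^ 2) ≤ 2 * Y ^ 2 * (8 * Y ^ 2) := by gcongr
        _ = _ := by ring
    have h4 : 4 * Y ^ 8 * ∑ n ∈ Icc 1 N, 1 / (n : ℝ) ^ 2 ≤ 4 * Y ^ 8 * 2 := by gcongr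
    have h5 : Y ^ 4 ≤ Y ^ 8 := pow_le_pow_right₀ hY (by norm_num)
    have h6 : 0 < Y ^ 8 := by positivity
    linarith
  · intro c hc
    obtain ⟨h1, h2⟩ := hc1 c hc
    refine mem_Icc.2 ⟨Int.natAbs_pos.2 h1, Nat.le_floor ?_⟩
    rwa [Nat.cast_natAbs, Int.cast_abs]
  · intro n hn
    obtain ⟨hn1, hnN⟩ := mem_Icc.1 hn
    have hn0 : (0 : ℝ) < n := by exact_mod_cast hn1
    have hn4 : (n : ℝ) ≤ 2 * Y ^ 2 := le_trans (by exact_mod_cast hnN) hNle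
    have := card_le_mul_of_fiber_le (S := {c ∈ S | (c 1).natAbs = n}) (f := fun c => c 1) (k := 2)
      (g := 4 * Y ^ 2 + 2 * Y ^ 8 * (1 / (n : ℝ) ^ 2)) ?_ (by positivity) ?_
    · push_cast at this; linarith
    · refine le_trans (card_le_card (t := {(n : ℤ), -(n : ℤ)}) ?_) card_le_two
      intro a ha
      obtain ⟨c, hc, rfl⟩ := mem_image.1 ha
      have := (mem_filter.1 hc).2
      rw [mem_insert, mem_singleton]
      omega
    · intro b hb
      obtain ⟨c₀, hc₀, rfl⟩ := mem_image.1 hb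
      have han := (mem_filter.1 hc₀).2
      set b := c₀ 1 with hb_def
      have hb0 : b ≠ 0 := by omega
      have hbR : |(b : ℝ)| = n := by rw [← han, Nat.cast_natAbs, Int.cast_abs]
      have hmem : ∀ c ∈ {c ∈ {c ∈ S | (c 1).natAbs = n} | c 1 = b},
          IsReducedCubic c ∧ ((|cubicDisc c| : ℤ) : ℝ) < Y ^ 8 ∧ c 0 = 0 ∧ c 1 = b := by
        intro c hc
        rw [mem_filter, mem_filter] at hc
        exact ⟨(hS c hc.1.1).1, (hS c hc.1.1).2.1, (hS c hc.1.1).2.2, hc.2⟩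
      have := card_le_mul_of_fiber_le (S := {c ∈ {c ∈ S | (c 1).natAbs = n} | c 1 = b})
        (f := fun c => c 2) (k := 2 * n) (g := Y ^ 8 / (n : ℝ) ^ 3 + 1) ?_ (by positivity) ?_
      · refine this.trans ?_
        push_cast
        have e7 : 2 * (n : ℝ) * (Y ^ 8 / n ^ 3 + 1) = 2 * n + 2 * Y ^ 8 * (1 / (n : ℝ) ^ 2) := by
          field_simp; ring
        rw [e7]
        linarith
      · have hcard : #(Ico (0 : ℤ) (2 * n)) = 2 * n := by
          rw [Int.card_Ico]; omega
        rw [← hcard]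
        refine card_le_card fun b hb => ?_
        obtain ⟨c, hc, rfl⟩ := mem_image.1 hb
        obtain ⟨hr, -, h0, h1⟩ := hmem c hc
        have := hr.shift' h0
        rw [h1, Int.abs_eq_natAbs, han] at this
        rw [mem_Ico]
        omega
      · intro z _
        set T := {c' ∈ {c ∈ {c ∈ S | (c 1).natAbs = n} | c 1 = b} | c' 2 = z} with hT
        have hTmem : ∀ c' ∈ T, c' = ![0, b, z, c' 3] ∧ ((|cubicDisc c'| : ℤ) : ℝ) < Y ^ 8 := by
          intro c' hc'
          rw [hT, mem_filter] at hc'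
          obtain ⟨-, h8, h0', h1'⟩ := hmem c' hc'.1
          refine ⟨?_, h8⟩
          rw [← h0', ← h1', ← hc'.2]
          exact cubic_eta c'
        have hinj : Set.InjOn (fun c' : Fin 4 → ℤ => c' 3) T := by
          intro x hx y hy hxy
          simp only at hxy
          rw [(hTmem x hx).1, (hTmem y hy).1, hxy]
        rw [← card_image_of_injOn hinj]
        refine card_int_le (by positivity) ?_
        intro x hx y hy hxy
        obtain ⟨c, hc, rfl⟩ := mem_image.1 hx
        obtain ⟨c', hc', rfl⟩ := mem_image.1 hy
        obtain ⟨e1, d1⟩ := hTmem c hc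
        obtain ⟨e2, d2⟩ := hTmem c' hc'
        set d := c 3
        set d' := c' 3
        have hdisc : ∀ d : ℤ, cubicDisc ![0, b, z, d] = b ^ 2 * z ^ 2 - 4 * b ^ 3 * d := fun d => by
          simp [cubicDisc]
        rw [e1, hdisc] at d1
        rw [e2, hdisc] at d2
        push_cast at d1 d2
        have h3 : |4 * (b : ℝ) ^ 3 * ((d' : ℝ) - d)| ≤ 2 * Y ^ 8 := by
          rw [abs_lt] at d1 d2
          rw [abs_le]
          constructor <;> linarith
        have hdd : (0 : ℝ) ≤ (d' : ℝ) - d := by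
          have : (d : ℝ) ≤ d' := by exact_mod_cast hxy
          linarith
        rw [abs_mul, abs_mul, abs_pow, hbR, abs_of_nonneg hdd,
          abs_of_pos (by norm_num : (0 : ℝ) < 4)] at h3
        rw [le_div_iff₀ (by positivity)]
        have h4 : 0 ≤ (n : ℝ) ^ 3 * ((d' : ℝ) - d) := by positivity
        linarith

/-- There are `O(X)` classes of integral binary cubic forms with `0 < |disc| < X`. -/
theorem card_classes_le {X : ℝ} (hX : 1 ≤ X) :
    (Quot.mk (@FormEquiv 3) '' {c : Fin 4 → ℤ | ∃ D : ℤ, IsDisc c D ∧ 0 < |D| ∧ (|D| : ℝ) < X}).Finite ∧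
    (Nat.card (Quot.mk (@FormEquiv 3) ''
      {c : Fin 4 → ℤ | ∃ D : ℤ, IsDisc c D ∧ 0 < |D| ∧ (|D| : ℝ) < X}) : ℝ) ≤ 1100 * X := by
  classical
  set Q := Quot.mk (@FormEquiv 3) ''
    {c : Fin 4 → ℤ | ∃ D : ℤ, IsDisc c D ∧ 0 < |D| ∧ (|D| : ℝ) < X} with hQ
  set Y := X ^ (1 / 8 : ℝ) with hYdef
  have hY : 1 ≤ Y := Real.one_le_rpow hX (by norm_num)
  have hY8 : Y ^ 8 = X := by
    rw [hYdef, ← Real.rpow_natCast, ← Real.rpow_mul (by linarith)]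
    norm_num
  have hrep : ∀ z ∈ Q, ∃ c, IsReducedCubic c ∧ ((|cubicDisc c| : ℤ) : ℝ) < Y ^ 8 ∧
      Quot.mk (@FormEquiv 3) c = z := by
    rintro z ⟨c, ⟨D, hD, h0, hlt⟩, rfl⟩
    rw [eq_cubicDisc_of_isDisc hD] at h0 hlt
    obtain ⟨c', h1, h2, h3⟩ := exists_isReducedCubic c (abs_pos.1 h0)
    refine ⟨c', h3, ?_, (Quot.sound h1).symm⟩
    rw [h2, hY8]
    exact_mod_cast hlt
  choose! r hr1 hr2 hr3 using hrep
  have hbound : ∀ T : Finset (Quot (@FormEquiv 3)), ↑T ⊆ Q → (#T : ℝ) ≤ 1100 * X := by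
    intro T hT
    have hinj : Set.InjOn r T := fun x hx y hy hxy => by
      rw [← hr3 x (hT hx), ← hr3 y (hT hy), hxy]
    rw [← card_image_of_injOn hinj, ← card_filter_add_card_filter_not (s := T.image r) (fun c => c 0 = 0)]
    have hmem : ∀ c ∈ T.image r, IsReducedCubic c ∧ ((|cubicDisc c| : ℤ) : ℝ) < Y ^ 8 := by
      intro c hc
      obtain ⟨z, hz, rfl⟩ := mem_image.1 hc
      exact ⟨hr1 z (hT hz), hr2 z (hT hz)⟩
    have h1 := card_reduced_lead_zero_le hY (S := {c ∈ T.image r | c 0 = 0}) fun c hc =>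
      ⟨(hmem c (mem_filter.1 hc).1).1, (hmem c (mem_filter.1 hc).1).2, (mem_filter.1 hc).2⟩
    have h2 := card_reduced_lead_ne_zero_le hY (S := {c ∈ T.image r | ¬ c 0 = 0}) fun c hc =>
      ⟨(hmem c (mem_filter.1 hc).1).1, (hmem c (mem_filter.1 hc).1).2, (mem_filter.1 hc).2⟩
    rw [hY8] at h1 h2
    push_cast
    linarith
  have hfin : Q.Finite := by
    by_contra hinf
    obtain ⟨T, hT, hcard⟩ := Set.Infinite.exists_subset_card_eq hinf (⌊1100 * X⌋₊ + 1)
    have := hbound T hT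
    rw [hcard] at this
    push_cast at this
    linarith [Nat.lt_floor_add_one (1100 * X)]
  refine ⟨hfin, ?_⟩
  have := hbound hfin.toFinset (by simp)
  rwa [← Set.ncard_eq_toFinset_card Q hfin] at this

end ReducedCountTotal

section FiniteFieldRepresentation

variable {k : Type*} [Field k]

lemma substForm_inverse (c : Fin 4 → k) {p q r s : k} (hd : p * s - q * r ≠ 0) :
    substForm (substForm c p q r s) (s / (p * s - q * r)) (-q / (p * s - q * r))
      (-r / (p * s - q * r)) (p / (p * s - q * r)) = c := by
  rw [substForm_substForm]
  have e1 : p * (s / (p * s - q * r)) + q * (-r / (p * s - q * r)) = 1 := by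
    rw [← div_self hd]; ring
  have e2 : p * (-q / (p * s - q * r)) + q * (p / (p * s - q * r)) = 0 := by ring
  have e3 : r * (s / (p * s - q * r)) + s * (-r / (p * s - q * r)) = 0 := by ring
  have e4 : r * (-q / (p * s - q * r)) + s * (p / (p * s - q * r)) = 1 := by
    rw [← div_self hd]; ring
  rw [e1, e2, e3, e4, substForm_one]

lemma substForm_injective {p q r s : k} (hd : p * s - q * r ≠ 0) :
    Function.Injective fun c : Fin 4 → k => substForm c p q r s := fun c c' h => by
  rw [← substForm_inverse c hd, ← substForm_inverse c' hd]
  simp only at h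
  rw [h]

lemma substForm_apply_zero (c : Fin 4 → k) (p q r s : k) :
    substForm c p q r s 0 = binEval (n := 3) c p r := by
  rw [binEval_cubic]; simp [substForm]

lemma substForm_apply_three (c : Fin 4 → k) (p q r s : k) :
    substForm c p q r s 3 = binEval (n := 3) c q s := by
  rw [binEval_cubic]; simp [substForm]

lemma exists_det_ne_zero {p r : k} (h : (p, r) ≠ 0) : ∃ q s : k, p * s - q * r ≠ 0 := by
  by_cases hp : p = 0
  · have hr : r ≠ 0 := fun hr => h (by rw [hp, hr]; rfl)
    exact ⟨1, 0, by simpa [hp] using hr⟩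
  · exact ⟨0, 1, by simpa using hp⟩

variable [Fintype k] [DecidableEq k]

lemma card_forms_value_le {v : k × k} (hv : v ≠ 0) (m : k) :
    #{c : Fin 4 → k | binEval (n := 3) c v.1 v.2 = m} ≤ Fintype.card k ^ 3 := by
  obtain ⟨q, s, hd⟩ := exists_det_ne_zero hv
  have : Fintype.card k ^ 3 = #(univ : Finset (k × k × k)) := by
    rw [card_univ, Fintype.card_prod, Fintype.card_prod]; ring
  rw [this]
  refine card_le_card_of_injOn (fun c => (substForm c v.1 q v.2 s 1, substForm c v.1 q v.2 s 2,
    substForm c v.1 q v.2 s 3)) (fun _ _ => mem_coe.2 (mem_univ _)) ?_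
  intro c hc c' hc' h
  simp only [Prod.mk.injEq] at h
  refine substForm_injective hd ?_
  have h0 : substForm c v.1 q v.2 s 0 = substForm c' v.1 q v.2 s 0 := by
    rw [substForm_apply_zero, substForm_apply_zero, (mem_filter.1 hc).2, (mem_filter.1 hc').2]
  funext i
  fin_cases i
  exacts [h0, h.1, h.2.1, h.2.2]

lemma le_card_forms_value {v : k × k} (hv : v ≠ 0) (m : k) :
    Fintype.card k ^ 3 ≤ #{c : Fin 4 → k | binEval (n := 3) c v.1 v.2 = m} := by
  obtain ⟨q, s, hd⟩ := exists_det_ne_zero hv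
  have : Fintype.card k ^ 3 = #(univ : Finset (k × k × k)) := by
    rw [card_univ, Fintype.card_prod, Fintype.card_prod]; ring
  rw [this]
  set D := v.1 * s - q * v.2 with hD
  have hd' : s / D * (v.1 / D) - -q / D * (-v.2 / D) ≠ 0 := by
    have : s / D * (v.1 / D) - -q / D * (-v.2 / D) = D / (D * D) := by
      rw [div_mul_div_comm, div_mul_div_comm, ← sub_div]
      congr 1
      rw [hD]; ring
    rw [this]
    exact div_ne_zero hd (mul_ne_zero hd hd)
  refine card_le_card_of_injOn (fun z => substForm ![m, z.1, z.2.1, z.2.2] (s / D) (-q / D)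
    (-v.2 / D) (v.1 / D)) ?_ ?_
  · intro z _
    refine mem_coe.2 (mem_filter.2 ⟨mem_univ _, ?_⟩)
    rw [binEval_substForm]
    have e1 : s / D * v.1 + -q / D * v.2 = 1 := by rw [← div_self hd, hD]; ring
    have e2 : -v.2 / D * v.1 + v.1 / D * v.2 = 0 := by ring
    rw [e1, e2, binEval_cubic]
    simp
  · intro z _ z' _ h
    have := substForm_injective hd' h
    have h1 := congrFun this 1
    have h2 := congrFun this 2
    have h3 := congrFun this 3
    simp at h1 h2 h3
    exact Prod.ext h1 (Prod.ext h2 h3)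

lemma card_forms_two_values_le {v w : k × k} (hd : v.1 * w.2 - w.1 * v.2 ≠ 0) (m : k) :
    #{c : Fin 4 → k | binEval (n := 3) c v.1 v.2 = m ∧ binEval (n := 3) c w.1 w.2 = m} ≤
      Fintype.card k ^ 2 := by
  have : Fintype.card k ^ 2 = #(univ : Finset (k × k)) := by
    rw [card_univ, Fintype.card_prod]; ring
  rw [this]
  refine card_le_card_of_injOn (fun c => (substForm c v.1 w.1 v.2 w.2 1,
    substForm c v.1 w.1 v.2 w.2 2)) (fun _ _ => mem_coe.2 (mem_univ _)) ?_
  intro c hc c' hc' h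
  simp only [Prod.mk.injEq] at h
  refine substForm_injective hd ?_
  have h0 : substForm c v.1 w.1 v.2 w.2 0 = substForm c' v.1 w.1 v.2 w.2 0 := by
    rw [substForm_apply_zero, substForm_apply_zero, (mem_filter.1 hc).2.1, (mem_filter.1 hc').2.1]
  have h3 : substForm c v.1 w.1 v.2 w.2 3 = substForm c' v.1 w.1 v.2 w.2 3 := by
    rw [substForm_apply_three, substForm_apply_three, (mem_filter.1 hc).2.2,
      (mem_filter.1 hc').2.2]
  funext i
  fin_cases i
  exacts [h0, h.1, h.2, h3]

lemma card_forms_pair_le {m : k} (hm : m ≠ 0) {v : k × k} (hv : v ≠ 0) (w : k × k) :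
    #{c : Fin 4 → k | binEval (n := 3) c v.1 v.2 = m ∧ binEval (n := 3) c w.1 w.2 = m} ≤
      Fintype.card k ^ 2 + if ∃ t : k, t ^ 3 = 1 ∧ w = (t * v.1, t * v.2) then
        Fintype.card k ^ 3 else 0 := by
  by_cases hd : v.1 * w.2 - w.1 * v.2 = 0
  swap
  · exact (card_forms_two_values_le hd m).trans (Nat.le_add_right _ _)
  split_ifs with ht
  · refine le_trans (card_le_card ?_) ((card_forms_value_le hv m).trans (Nat.le_add_left _ _))
    intro c hc
    rw [mem_filter] at hc ⊢
    exact ⟨hc.1, hc.2.1⟩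
  · rw [card_eq_zero.2]
    · exact Nat.zero_le _
    · rw [filter_eq_empty_iff]
      rintro c - ⟨h1, h2⟩
      obtain ⟨t, rfl⟩ : ∃ t : k, w = (t * v.1, t * v.2) := by
        by_cases hx : v.1 = 0
        · have hy : v.2 ≠ 0 := fun hy => hv (Prod.ext hx hy)
          refine ⟨w.2 / v.2, Prod.ext ?_ ?_⟩
          · have : w.1 = 0 := by
              rw [hx, zero_mul, zero_sub, neg_eq_zero] at hd
              exact (mul_eq_zero.1 hd).resolve_right hy
            simp [this, hx]
          · field_simp
        · refine ⟨w.1 / v.1, Prod.ext ?_ ?_⟩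
          · field_simp
          · field_simp
            linear_combination hd
      refine ht ⟨t, ?_, rfl⟩
      refine mul_right_cancel₀ hm ?_
      rw [binEval_cubic] at h1 h2
      rw [one_mul]
      nth_rewrite 2 [← h2]
      rw [← h1]
      ring

lemma card_forms_not_represent_mul_le {m : k} (hm : m ≠ 0) :
    ((#{c : Fin 4 → k | ∀ v : k × k, binEval (n := 3) c v.1 v.2 ≠ m} : ℕ) : ℝ) *
      ((Fintype.card k : ℝ) ^ 2 - 1) ≤ (Fintype.card k : ℝ) ^ 4 * (3 * Fintype.card k + 1) := by
  set Q : ℝ := ((Fintype.card k : ℕ) : ℝ) with hQ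
  have hQ1 : 1 < Q := by
    rw [hQ]; exact_mod_cast Fintype.one_lt_card
  set N : (Fin 4 → k) → ℝ := fun c =>
    ∑ v : k × k, if binEval (n := 3) c v.1 v.2 = m then 1 else 0 with hN
  have hzero : ∀ c : Fin 4 → k, binEval (n := 3) c 0 0 ≠ m := by
    intro c h
    rw [binEval_cubic] at h
    simp at h
    exact hm h.symm
  have hcardV : (#(univ : Finset (Fin 4 → k)) : ℝ) = Q ^ 4 := by
    rw [card_univ, Fintype.card_fun, Fintype.card_fin]; push_cast; rfl
  have hcardP : (#(univ.erase (0 : k × k)) : ℝ) = Q ^ 2 - 1 := by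
    rw [card_erase_of_mem (mem_univ _), card_univ, Fintype.card_prod, Nat.cast_sub
      (Nat.mul_pos Fintype.card_pos Fintype.card_pos)]
    push_cast; ring
  have hfirst : (Q ^ 2 - 1) * Q ^ 3 ≤ ∑ c, N c := by
    rw [hN, sum_comm, ← hcardP, ← nsmul_eq_mul, ← sum_const]
    refine le_trans (sum_le_sum fun v hv => ?_) (sum_le_sum_of_subset_of_nonneg
      (erase_subset (0 : k × k) univ) fun v _ _ => by positivity)
    rw [sum_boole]
    rw [hQ]
    exact_mod_cast le_card_forms_value (ne_of_mem_erase hv) m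
  have hsecond : ∑ c, N c ^ 2 ≤ (Q ^ 2 - 1) * (Q ^ 4 + 3 * Q ^ 3) := by
    have e1 : ∀ c, N c ^ 2 = ∑ v : k × k, ∑ w : k × k,
        if binEval (n := 3) c v.1 v.2 = m ∧ binEval (n := 3) c w.1 w.2 = m then (1 : ℝ) else 0 := by
      intro c
      rw [sq, hN, sum_mul_sum]
      refine sum_congr rfl fun v _ => sum_congr rfl fun w _ => ?_
      rw [ite_zero_mul_ite_zero, mul_one]
    simp only [e1]
    rw [sum_comm, ← hcardP, ← nsmul_eq_mul, ← sum_const, ← sum_erase (univ : Finset (k × k)) (a := 0)]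
    swap
    · refine sum_eq_zero fun c _ => sum_eq_zero fun w _ => if_neg fun h => hzero c h.1
    refine sum_le_sum fun v hv => ?_
    rw [sum_comm]
    have hv0 := ne_of_mem_erase hv
    calc ∑ w : k × k, ∑ c : Fin 4 → k, (if binEval (n := 3) c v.1 v.2 = m ∧
          binEval (n := 3) c w.1 w.2 = m then (1 : ℝ) else 0) ≤
        ∑ w : k × k, (Q ^ 2 + if ∃ t : k, t ^ 3 = 1 ∧ w = (t * v.1, t * v.2) then Q ^ 3 else 0) := by
          refine sum_le_sum fun w _ => ?_
          rw [sum_boole]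
          have := card_forms_pair_le hm hv0 w
          rw [hQ]
          exact_mod_cast this
      _ = Q ^ 4 + #{w : k × k | ∃ t : k, t ^ 3 = 1 ∧ w = (t * v.1, t * v.2)} * Q ^ 3 := by
          rw [sum_add_distrib, sum_const, card_univ, Fintype.card_prod, ← sum_filter, sum_const]
          simp only [nsmul_eq_mul]
          push_cast
          ring
      _ ≤ _ := by
          gcongr
          have : #{w : k × k | ∃ t : k, t ^ 3 = 1 ∧ w = (t * v.1, t * v.2)} ≤ 3 := by
            refine le_trans (card_le_card (t := (Polynomial.nthRootsFinset 3 (1 : k)).image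
              fun t => (t * v.1, t * v.2)) ?_) (card_image_le.trans ?_)
            · intro w hw
              obtain ⟨t, ht, rfl⟩ := (mem_filter.1 hw).2
              exact mem_image.2 ⟨t, (Polynomial.mem_nthRootsFinset (by norm_num) 1).2 ht, rfl⟩
            · rw [Polynomial.nthRootsFinset_def]
              exact (Multiset.toFinset_card_le _).trans (Polynomial.card_nthRoots _ _)
          exact_mod_cast this
  set K : ℝ := ((#{c : Fin 4 → k | ∀ v : k × k, binEval (n := 3) c v.1 v.2 ≠ m} : ℕ) : ℝ) with hK
  have hvar : K * ((Q ^ 2 - 1) / Q) ^ 2 ≤ ∑ c, (N c - (Q ^ 2 - 1) / Q) ^ 2 := by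
    rw [hK, ← nsmul_eq_mul, ← sum_const]
    refine le_trans (sum_le_sum fun c hc => ?_) (sum_le_sum_of_subset_of_nonneg
      (filter_subset _ _) fun c _ _ => sq_nonneg _)
    have : N c = 0 := sum_eq_zero fun v _ => if_neg ((mem_filter.1 hc).2 v)
    rw [this, zero_sub, neg_sq]
  have hexp : ∑ c, (N c - (Q ^ 2 - 1) / Q) ^ 2 =
      ∑ c, N c ^ 2 - 2 * ((Q ^ 2 - 1) / Q) * ∑ c, N c + Q ^ 4 * ((Q ^ 2 - 1) / Q) ^ 2 := by
    rw [← hcardV, ← nsmul_eq_mul, ← sum_const, mul_sum, ← sum_sub_distrib, ← sum_add_distrib]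
    exact sum_congr rfl fun c _ => by ring
  have hQ2 : 0 < Q ^ 2 - 1 := by nlinarith
  have h3 : 2 * ((Q ^ 2 - 1) / Q) * ((Q ^ 2 - 1) * Q ^ 3) ≤ 2 * ((Q ^ 2 - 1) / Q) * ∑ c, N c := by
    gcongr
  have h4 : K * ((Q ^ 2 - 1) / Q) ^ 2 ≤ (Q ^ 2 - 1) * Q ^ 2 * (3 * Q + 1) := by
    refine hvar.trans ?_
    rw [hexp]
    have e1 : 2 * ((Q ^ 2 - 1) / Q) * ((Q ^ 2 - 1) * Q ^ 3) = 2 * ((Q ^ 2 - 1) ^ 2 * Q ^ 2) := by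
      field_simp
    have e2 : Q ^ 4 * ((Q ^ 2 - 1) / Q) ^ 2 = (Q ^ 2 - 1) ^ 2 * Q ^ 2 := by field_simp
    rw [e2]
    rw [e1] at h3
    linarith
  rw [div_pow, ← mul_div_assoc, div_le_iff₀ (by positivity)] at h4
  refine le_of_mul_le_mul_left ?_ hQ2
  linarith

end FiniteFieldRepresentation

section FiniteFieldSolvability

variable {k : Type*} [Field k]

lemma hessB_substForm_shear (c : Fin 4 → k) (h2 : (2 : k) ≠ 0) (hA : hessA c ≠ 0) :
    hessB (substForm c 1 (-(hessB c / (2 * hessA c))) 0 1) = 0 := by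
  rw [hessB_substForm]
  field_simp
  ring

lemma hessA_substForm_shear (c : Fin 4 → k) (t : k) : hessA (substForm c 1 t 0 1) = hessA c := by
  rw [hessA_substForm]
  simp [hessVal]

lemma cubicDisc_substForm_shear (c : Fin 4 → k) (t : k) :
    cubicDisc (substForm c 1 t 0 1) = cubicDisc c := by
  rw [cubicDisc_substForm]
  simp

lemma exists_binEval_eq_of_cubicDisc_eq_zero (c : Fin 4 → k) (h2 : (2 : k) ≠ 0)
    (h3' : (3 : k) ≠ 0) (hA : hessA c ≠ 0) (hD : cubicDisc c = 0) (m : k) :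
    ∃ x y : k, binEval (n := 3) c x y = m := by
  set t := -(hessB c / (2 * hessA c)) with ht
  set c' := substForm c 1 t 0 1 with hc'
  have hB' : hessB c' = 0 := hessB_substForm_shear c h2 hA
  have hA' : hessA c' ≠ 0 := by rwa [hessA_substForm_shear]
  have hC' : hessC c' = 0 := by
    have h1 := hess_disc c'
    rw [cubicDisc_substForm_shear, hD, hB'] at h1
    have h4 : (4 : k) ≠ 0 := by
      rw [show (4 : k) = 2 * 2 by norm_num]; exact mul_ne_zero h2 h2
    have : 4 * hessA c' * hessC c' = 0 := by linear_combination h1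
    exact (mul_eq_zero.1 this).resolve_left (mul_ne_zero h4 hA')
  have h3 : c' 2 = 0 := by
    have : c' 2 * hessA c' = 0 := by
      simp only [hessA, hessB, hessC] at *
      linear_combination c' 1 * hB' - 3 * c' 0 * hC'
    exact (mul_eq_zero.1 this).resolve_right hA'
  have hb : c' 1 ≠ 0 := by
    rintro h
    apply hA'
    simp [hessA, h3, h]
  have hd : c' 3 = 0 := by
    have : 3 * c' 1 * c' 3 = 0 := by
      rw [hessC, h3] at hC'
      linear_combination -hC'
    exact (mul_eq_zero.1 this).resolve_left (mul_ne_zero h3' hb)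
  refine ⟨1 + t * ((m - c' 0) / c' 1), (m - c' 0) / c' 1, ?_⟩
  have := binEval_substForm c 1 t 0 1 1 ((m - c' 0) / c' 1)
  rw [← hc', binEval_cubic, h3, hd] at this
  simp only [one_mul, mul_one, zero_mul, zero_add] at this
  rw [← this]
  field_simp
  ring

lemma card_binEval_hessVal_le_aux [Fintype k] [DecidableEq k] (c : Fin 4 → k) (h2 : (2 : k) ≠ 0)
    (h3 : (3 : k) ≠ 0) (hA : hessA c ≠ 0) (hB : hessB c = 0) (hD : cubicDisc c ≠ 0) (f e : k) :
    #{v : k × k | binEval (n := 3) c v.1 v.2 = f ∧ hessVal c v.1 v.2 = e} ≤ 12 := by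
  have hC : hessC c ≠ 0 := by
    intro hC
    have h1 := hess_disc c
    rw [hC, hB] at h1
    have : 3 * cubicDisc c = 0 := by linear_combination -h1
    exact (mul_ne_zero h3 hD) this
  set A := hessA c with hAdef
  set C := hessC c with hCdef
  set g := A * c 3 - c 1 * C with hg
  set l := A * c 2 - c 0 * C with hl
  have hlead : 9 * (-C * l ^ 2 - A * g ^ 2) = -(16 * A ^ 2 * C ^ 2) := by
    have hB2 : c 1 * c 2 = 9 * c 0 * c 3 := by
      simp only [hessB] at hB; linear_combination hB
    have e1 : 3 * l = 4 * c 2 * A := by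
      simp only [hl, hAdef, hCdef, hessA, hessC]; linear_combination (-c 1) * hB2
    have e2 : g = 4 * c 3 * A := by
      simp only [hg, hAdef, hCdef, hessA, hessC]; linear_combination (-c 2) * hB2
    have e3 : C * c 2 ^ 2 + 9 * A * c 3 ^ 2 = C ^ 2 := by
      simp only [hAdef, hCdef, hessA, hessC]; linear_combination (3 * c 2 * c 3) * hB2
    rw [e2]
    linear_combination (-C) * (3 * l + 4 * c 2 * A) * e1 - 16 * A ^ 2 * e3
  have hlead0 : -C * l ^ 2 - A * g ^ 2 ≠ 0 := by
    intro h0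
    rw [h0, mul_zero, eq_comm, neg_eq_zero] at hlead
    have h16 : (16 : k) ≠ 0 := by
      rw [show (16 : k) = 2 ^ 4 by norm_num]; exact pow_ne_zero _ h2
    exact mul_ne_zero (mul_ne_zero h16 (pow_ne_zero 2 hA)) (pow_ne_zero 2 hC) hlead
  have key : ∀ x y : k, binEval (n := 3) c x y = f → hessVal c x y = e →
      (e - C * y ^ 2) * (c 0 * e + l * y ^ 2) ^ 2 - A * (A * f - c 1 * e * y - g * y ^ 3) ^ 2 = 0 := by
    intro x y hf he
    have he' : A * x ^ 2 + C * y ^ 2 = e := by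
      rw [hessVal, hB] at he; linear_combination he
    rw [binEval_cubic] at hf
    have e1 : A * f - c 1 * e * y - g * y ^ 3 = A * x * (c 0 * x ^ 2 + c 2 * y ^ 2) := by
      rw [← hf, ← he', hg]; ring
    rw [e1, ← he', hl]
    ring
  set P : Polynomial k := Polynomial.C (-C * l ^ 2 - A * g ^ 2) * Polynomial.X ^ 6 +
    Polynomial.C (e * l ^ 2 - 2 * C * c 0 * e * l - 2 * A * c 1 * e * g) * Polynomial.X ^ 4 +
    Polynomial.C (2 * A * A * f * g) * Polynomial.X ^ 3 +
    Polynomial.C (2 * e * c 0 * e * l - C * (c 0 * e) ^ 2 - A * (c 1 * e) ^ 2) * Polynomial.X ^ 2 +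
    Polynomial.C (2 * A * A * f * c 1 * e) * Polynomial.X +
    Polynomial.C (e * (c 0 * e) ^ 2 - A * (A * f) ^ 2) with hP
  have hPdeg : P.natDegree ≤ 6 := by
    rw [hP]; compute_degree
  have hP6 : P.coeff 6 = -C * l ^ 2 - A * g ^ 2 := by
    rw [hP]
    simp only [Polynomial.coeff_add, Polynomial.coeff_C_mul, Polynomial.coeff_X_pow,
      Polynomial.coeff_X, Polynomial.coeff_C]
    norm_num
  have hP0 : P ≠ 0 := by
    intro h
    rw [h, Polynomial.coeff_zero] at hP6
    exact hlead0 hP6.symm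
  have hroots : #P.roots.toFinset ≤ 6 :=
    (Multiset.toFinset_card_le _).trans ((Polynomial.card_roots' P).trans hPdeg)
  have h12 : (12 : ℕ) = 2 * 6 := by norm_num
  rw [h12]
  refine (card_le_mul_card_image_of_maps_to (t := P.roots.toFinset) (f := Prod.snd) ?_ 2 ?_).trans
    (Nat.mul_le_mul_left 2 hroots)
  · intro v hv
    obtain ⟨-, hf, he⟩ := mem_filter.1 hv
    rw [Multiset.mem_toFinset, Polynomial.mem_roots hP0, Polynomial.IsRoot.def, hP]
    simp only [Polynomial.eval_add, Polynomial.eval_mul, Polynomial.eval_C, Polynomial.eval_pow,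
      Polynomial.eval_X]
    linear_combination key _ _ hf he
  · intro y _
    by_contra! h
    obtain ⟨v, hv, w, hw, z, hz, hvw, hvz, hwz⟩ := two_lt_card.1 h
    simp only [mem_filter, mem_univ, true_and] at hv hw hz
    have hsq : ∀ v : k × k, (binEval (n := 3) c v.1 v.2 = f ∧ hessVal c v.1 v.2 = e) ∧ v.2 = y →
        A * v.1 ^ 2 + C * y ^ 2 = e := by
      rintro v ⟨⟨-, he⟩, rfl⟩
      rw [hessVal, hB] at he; linear_combination he
    have aux : ∀ v w : k × k, v.2 = y → w.2 = y → A * v.1 ^ 2 + C * y ^ 2 = e →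
        A * w.1 ^ 2 + C * y ^ 2 = e → v ≠ w → v.1 + w.1 = 0 := by
      intro v w hv hw h1 h2 hne
      have : A * ((v.1 - w.1) * (v.1 + w.1)) = 0 := by linear_combination h1 - h2
      rcases mul_eq_zero.1 ((mul_eq_zero.1 this).resolve_left hA) with h | h
      · exact absurd (Prod.ext (sub_eq_zero.1 h) (hv.trans hw.symm)) hne
      · exact h
    have a1 := aux v w hv.2 hw.2 (hsq v hv) (hsq w hw) hvw
    have a2 := aux v z hv.2 hz.2 (hsq v hv) (hsq z hz) hvz
    exact hwz (Prod.ext (by linear_combination a1 - a2) (hw.2.trans hz.2.symm))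

lemma card_binEval_hessVal_le [Fintype k] [DecidableEq k] (c : Fin 4 → k) (h2 : (2 : k) ≠ 0)
    (h3 : (3 : k) ≠ 0) (hA : hessA c ≠ 0) (hD : cubicDisc c ≠ 0) (f e : k) :
    #{v : k × k | binEval (n := 3) c v.1 v.2 = f ∧ hessVal c v.1 v.2 = e} ≤ 12 := by
  set t := -(hessB c / (2 * hessA c)) with ht
  refine le_trans (card_le_card_of_injOn (fun v : k × k => (v.1 - t * v.2, v.2)) ?_ ?_)
    (card_binEval_hessVal_le_aux (substForm c 1 t 0 1) h2 h3 (by rwa [hessA_substForm_shear])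
      (hessB_substForm_shear c h2 hA) (by rwa [cubicDisc_substForm_shear]) f e)
  · intro v hv
    obtain ⟨-, hf, he⟩ := mem_filter.1 hv
    refine mem_coe.2 (mem_filter.2 ⟨mem_univ _, ?_, ?_⟩)
    · rw [binEval_substForm, ← hf]; congr 1 <;> ring
    · rw [hessVal_substForm, ← he]
      simp only [hessVal]; ring
  · intro v _ w _ h
    simp only [Prod.mk.injEq] at h
    exact Prod.ext (by linear_combination h.1 + t * h.2) h.2

lemma exists_binEval_eq_of_hessA_ne_zero [Fintype k] [DecidableEq k] (c : Fin 4 → k)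
    (h2 : (2 : k) ≠ 0) (h3 : (3 : k) ≠ 0) (hq : 3000 ≤ Fintype.card k) (hA : hessA c ≠ 0)
    {m : k} (hm : m ≠ 0) : ∃ x y : k, binEval (n := 3) c x y = m := by
  by_cases hD : cubicDisc c = 0
  · exact exists_binEval_eq_of_cubicDisc_eq_zero c h2 h3 hA hD m
  by_contra! hno
  set bad : Finset (Fin 4 → k) := {c : Fin 4 → k | ∀ v : k × k, binEval (n := 3) c v.1 v.2 ≠ m}
    with hbad
  have hK := card_forms_not_represent_mul_le hm
  rw [← hbad] at hK
  set T : Finset (k × k × k × k) := {g : k × k × k × k | g.1 * g.2.2.2 - g.2.1 * g.2.2.1 ≠ 0}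
    with hT
  have hTcard : (Fintype.card k - 1) ^ 2 * Fintype.card k ^ 2 ≤ #T := by
    have : (Fintype.card k - 1) ^ 2 * Fintype.card k ^ 2 =
        #(((univ.erase (0 : k)) ×ˢ (univ.erase (0 : k))) ×ˢ (univ : Finset (k × k))) := by
      rw [card_product, card_product, card_erase_of_mem (mem_univ _), card_univ, card_univ,
        Fintype.card_prod]
      ring
    rw [this]
    refine card_le_card_of_injOn (fun z => (z.1.1, z.2.1, z.2.2,
      (z.1.2 + z.2.1 * z.2.2) / z.1.1)) ?_ ?_
    · intro z hz
      simp only [coe_product, Set.mem_prod, mem_coe, mem_erase] at hz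
      refine mem_coe.2 (mem_filter.2 ⟨mem_univ _, ?_⟩)
      have h0 := hz.1.1.1
      have : z.1.1 * ((z.1.2 + z.2.1 * z.2.2) / z.1.1) - z.2.1 * z.2.2 = z.1.2 := by
        field_simp; ring
      simp only
      rw [this]
      exact hz.1.2.1
    · intro z hz z' hz' h
      simp only [coe_product, Set.mem_prod, mem_coe, mem_erase] at hz
      have h0 := hz.1.1.1
      simp only [Prod.mk.injEq] at h
      obtain ⟨h1, h2, h3, h4⟩ := h
      rw [← h1, ← h2, ← h3] at h4
      have h5 : z.1.2 = z'.1.2 := by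
        field_simp at h4
        exact add_right_cancel h4
      exact Prod.ext (Prod.ext h1 h5) (Prod.ext h2 h3)
  have hfib : #T ≤ 864 * #bad := by
    refine (card_le_mul_card_image_of_maps_to (t := bad)
      (f := fun g => substForm c g.1 g.2.1 g.2.2.1 g.2.2.2) ?_ 864 ?_)
    · intro g _
      refine mem_filter.2 ⟨mem_univ _, fun v => ?_⟩
      rw [binEval_substForm]
      exact hno _ _
    · intro G _
      set R : Finset k := (Polynomial.nthRootsFinset 6 (cubicDisc G / cubicDisc c)) with hR
      have hRcard : #R ≤ 6 := by
        rw [hR, Polynomial.nthRootsFinset_def]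
        exact (Multiset.toFinset_card_le _).trans (Polynomial.card_nthRoots _ _)
      set S : k → k → Finset (k × k) := fun f e =>
        {v : k × k | binEval (n := 3) c v.1 v.2 = f ∧ hessVal c v.1 v.2 = e} with hS
      refine le_trans (card_le_card_of_injOn (t := R.biUnion fun δ =>
        S (G 0) (hessA G / δ ^ 2) ×ˢ S (G 3) (hessC G / δ ^ 2))
        (fun g => ((g.1, g.2.2.1), (g.2.1, g.2.2.2))) ?_ ?_) (card_biUnion_le.trans ?_)
      · intro g hg
        obtain ⟨hgT, rfl⟩ := mem_filter.1 hg
        have hδ := (mem_filter.1 hgT).2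
        refine mem_coe.2 (mem_biUnion.2 ⟨g.1 * g.2.2.2 - g.2.1 * g.2.2.1, ?_, ?_⟩)
        · rw [hR, Polynomial.mem_nthRootsFinset (by norm_num), cubicDisc_substForm,
            mul_div_cancel_right₀ _ hD]
        · rw [mem_product, hS]
          simp only [mem_filter, mem_univ, true_and]
          refine ⟨⟨(substForm_apply_zero _ _ _ _ _).symm, ?_⟩,
            (substForm_apply_three _ _ _ _ _).symm, ?_⟩
          · rw [hessA_substForm, mul_div_cancel_left₀ _ (pow_ne_zero 2 hδ)]
          · rw [hessC_substForm, mul_div_cancel_left₀ _ (pow_ne_zero 2 hδ)]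
      · intro g _ g' _ h
        simp only [Prod.mk.injEq] at h
        exact Prod.ext h.1.1 (Prod.ext h.2.1 (Prod.ext h.1.2 h.2.2))
      · refine le_trans (sum_le_card_nsmul _ _ 144 fun δ _ => ?_) ?_
        · rw [card_product]
          exact (Nat.mul_le_mul (card_binEval_hessVal_le c h2 h3 hA hD _ _)
            (card_binEval_hessVal_le c h2 h3 hA hD _ _)).trans (by norm_num)
        · rw [smul_eq_mul]; omega
  have h1 : ((Fintype.card k : ℝ) - 1) ^ 2 * (Fintype.card k : ℝ) ^ 2 ≤ 864 * (#bad : ℝ) := by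
    have := hTcard.trans hfib
    rw [← Nat.cast_le (α := ℝ)] at this
    push_cast [Nat.cast_sub (Fintype.card_pos (α := k) : 1 ≤ Fintype.card k)] at this
    exact this
  have hq' : (3000 : ℝ) ≤ (Fintype.card k : ℝ) := by exact_mod_cast hq
  set q : ℝ := ((Fintype.card k : ℕ) : ℝ)
  have hq2 : 0 < q ^ 2 - 1 := by nlinarith
  have h5 : (q - 1) ^ 2 * q ^ 2 * (q ^ 2 - 1) ≤ 864 * (q ^ 4 * (3 * q + 1)) := by
    calc _ ≤ 864 * (#bad : ℝ) * (q ^ 2 - 1) := by gcongr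
      _ ≤ _ := by rw [mul_assoc]; gcongr
  have h6 : (q - 1) ^ 2 * (q ^ 2 - 1) ≤ 864 * (q ^ 2 * (3 * q + 1)) := by
    have : 0 < q ^ 2 := by positivity
    refine le_of_mul_le_mul_right ?_ this
    linarith
  have h7 : q ^ 3 * 3000 ≤ q ^ 3 * q := by gcongr
  have h8 : q ^ 2 * 3000 ≤ q ^ 2 * q := by gcongr
  nlinarith

lemma exists_binEval_eq [Fintype k] [DecidableEq k] (c : Fin 4 → k)
    (hq : 3000 ≤ Fintype.card k) (h2 : (2 : k) ≠ 0) (h3 : (3 : k) ≠ 0)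
    (hH : ¬ (hessA c = 0 ∧ hessB c = 0 ∧ hessC c = 0)) {m : k} (hm : m ≠ 0) :
    ∃ x y : k, binEval (n := 3) c x y = m := by
  have aux : ∀ p q r s : k, (p * s - q * r) ≠ 0 → hessVal c p r ≠ 0 →
      ∃ x y : k, binEval (n := 3) c x y = m := by
    intro p β r s hd hv
    obtain ⟨x, y, h⟩ := exists_binEval_eq_of_hessA_ne_zero (substForm c p β r s) h2 h3 hq
      (by rw [hessA_substForm]; exact mul_ne_zero (pow_ne_zero 2 hd) hv) hm
    exact ⟨_, _, (binEval_substForm c p β r s x y).symm.trans h⟩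
  by_cases hA : hessA c = 0
  · by_cases hC : hessC c = 0
    · refine aux 1 0 1 1 (by simp) ?_
      intro h
      refine hH ⟨hA, ?_, hC⟩
      rw [hessVal, hA, hC] at h
      simpa using h
    · exact aux 0 1 1 0 (by simp) (by simpa [hessVal] using hC)
  · exact aux 1 0 0 1 (by simp) (by simpa [hessVal] using hA)

end FiniteFieldSolvability

section LocalSolvability

lemma exists_real_binEval_eq {c : Fin 4 → ℤ} (h0 : c 0 ≠ 0) (m : ℤ) :
    ∃ x y : ℝ, binEval (n := 3) (fun i => ((c i : ℤ) : ℝ)) x y = (m : ℝ) := by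
  have hcube : ∀ t : ℝ, ∃ x : ℝ, x ^ 3 = t := by
    intro t
    rcases le_total 0 t with ht | ht
    · exact ⟨t ^ ((3 : ℕ) : ℝ)⁻¹, Real.rpow_inv_natCast_pow ht (by norm_num)⟩
    · refine ⟨-(-t) ^ ((3 : ℕ) : ℝ)⁻¹, ?_⟩
      rw [Odd.neg_pow (by decide), Real.rpow_inv_natCast_pow (by linarith) (by norm_num), neg_neg]
  have h0' : ((c 0 : ℤ) : ℝ) ≠ 0 := by exact_mod_cast h0
  obtain ⟨x, hx⟩ := hcube ((m : ℝ) / ((c 0 : ℤ) : ℝ))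
  refine ⟨x, 0, ?_⟩
  rw [binEval_cubic, hx]
  field_simp
  ring

variable {p : ℕ} [hp : Fact p.Prime]

lemma exists_padic_binEval_eq_of_deriv {c : Fin 4 → ℤ} {m x y : ℤ}
    (h : (p : ℤ) ∣ binEval (n := 3) c x y - m)
    (hd : ¬ (p : ℤ) ∣ 3 * c 0 * x ^ 2 + 2 * c 1 * x * y + c 2 * y ^ 2) :
    ∃ u v : ℤ_[p], binEval (n := 3) (fun i => ((c i : ℤ) : ℤ_[p])) u v = (m : ℤ_[p]) := by
  set f : Polynomial ℤ_[p] := Polynomial.C ((c 0 : ℤ) : ℤ_[p]) * Polynomial.X ^ 3 +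
    Polynomial.C ((c 1 * y : ℤ) : ℤ_[p]) * Polynomial.X ^ 2 +
    Polynomial.C ((c 2 * y ^ 2 : ℤ) : ℤ_[p]) * Polynomial.X +
    Polynomial.C ((c 3 * y ^ 3 - m : ℤ) : ℤ_[p]) with hf
  have e0 : Polynomial.aeval ((x : ℤ) : ℤ_[p]) f =
      ((binEval (n := 3) c x y - m : ℤ) : ℤ_[p]) := by
    rw [hf, binEval_cubic]
    simp
    ring
  have e1 : Polynomial.aeval ((x : ℤ) : ℤ_[p]) (Polynomial.derivative f) =
      ((3 * c 0 * x ^ 2 + 2 * c 1 * x * y + c 2 * y ^ 2 : ℤ) : ℤ_[p]) := by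
    rw [hf]
    simp [Polynomial.derivative_pow]
    ring
  have n1 : ‖Polynomial.aeval ((x : ℤ) : ℤ_[p]) (Polynomial.derivative f)‖ = 1 := by
    rw [e1]
    refine le_antisymm (PadicInt.norm_le_one _) ?_
    by_contra! hlt
    exact hd ((PadicInt.norm_int_lt_one_iff_dvd _).1 hlt)
  obtain ⟨z, hz, -⟩ := hensels_lemma (F := f) (a := ((x : ℤ) : ℤ_[p])) (by
    rw [n1, e0, one_pow]
    exact (PadicInt.norm_int_lt_one_iff_dvd _).2 h)
  refine ⟨z, (y : ℤ_[p]), ?_⟩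
  rw [binEval_cubic]
  rw [hf] at hz
  simp at hz
  linear_combination hz

lemma exists_padic_binEval_eq_of_deriv' {c : Fin 4 → ℤ} {m x y : ℤ}
    (h : (p : ℤ) ∣ binEval (n := 3) c x y - m)
    (hd : ¬ (p : ℤ) ∣ c 1 * x ^ 2 + 2 * c 2 * x * y + 3 * c 3 * y ^ 2) :
    ∃ u v : ℤ_[p], binEval (n := 3) (fun i => ((c i : ℤ) : ℤ_[p])) u v = (m : ℤ_[p]) := by
  obtain ⟨u, v, huv⟩ := exists_padic_binEval_eq_of_deriv (p := p)
    (c := ![c 3, c 2, c 1, c 0]) (m := m) (x := y) (y := x) (by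
      convert h using 2
      simp only [binEval_cubic, Matrix.cons_val]
      ring) (by
      convert hd using 2
      simp only [Matrix.cons_val]
      ring)
  refine ⟨v, u, ?_⟩
  rw [← huv]
  simp only [binEval_cubic, Matrix.cons_val]
  ring

lemma exists_padic_binEval_eq (hp3 : 3000 ≤ p) {c : Fin 4 → ℤ}
    (hH : ¬ ((p : ℤ) ∣ hessA c ∧ (p : ℤ) ∣ hessB c ∧ (p : ℤ) ∣ hessC c)) {m : ℤ}
    (hm : ¬ (p : ℤ) ∣ m) :
    ∃ u v : ℤ_[p], binEval (n := 3) (fun i => ((c i : ℤ) : ℤ_[p])) u v = (m : ℤ_[p]) := by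
  have small : ∀ n : ℕ, 0 < n → n < 3000 → ((n : ℕ) : ZMod p) ≠ 0 := by
    intro n hn hn' h
    rw [ZMod.natCast_eq_zero_iff] at h
    exact absurd (Nat.le_of_dvd hn h) (by omega)
  set c' : Fin 4 → ZMod p := fun i => ((c i : ℤ) : ZMod p) with hc'
  have h3 : (3 : ZMod p) ≠ 0 := by exact_mod_cast small 3 (by norm_num) (by norm_num)
  have hm' : ((m : ℤ) : ZMod p) ≠ 0 := by rwa [Ne, ZMod.intCast_zmod_eq_zero_iff_dvd]
  obtain ⟨x, y, hxy⟩ := exists_binEval_eq c' (by rwa [ZMod.card])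
    (by exact_mod_cast small 2 (by norm_num) (by norm_num)) h3
    (by
      intro hz
      apply hH
      simp only [← ZMod.intCast_zmod_eq_zero_iff_dvd]
      simp only [hessA, hessB, hessC, hc'] at hz ⊢
      push_cast
      exact hz) hm'
  obtain ⟨x, rfl⟩ := ZMod.intCast_surjective x
  obtain ⟨y, rfl⟩ := ZMod.intCast_surjective y
  have hdvd : (p : ℤ) ∣ binEval (n := 3) c x y - m := by
    rw [← ZMod.intCast_zmod_eq_zero_iff_dvd]
    simp only [binEval_cubic, hc'] at hxy ⊢
    push_cast
    rw [hxy, sub_self]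
  by_cases h1 : (p : ℤ) ∣ 3 * c 0 * x ^ 2 + 2 * c 1 * x * y + c 2 * y ^ 2
  · by_cases h2 : (p : ℤ) ∣ c 1 * x ^ 2 + 2 * c 2 * x * y + 3 * c 3 * y ^ 2
    · exfalso
      have : (p : ℤ) ∣ 3 * m := by
        have e : 3 * m = x * (3 * c 0 * x ^ 2 + 2 * c 1 * x * y + c 2 * y ^ 2) +
          y * (c 1 * x ^ 2 + 2 * c 2 * x * y + 3 * c 3 * y ^ 2) -
          3 * (binEval (n := 3) c x y - m) := by
          rw [binEval_cubic]; ring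
        rw [e]
        exact dvd_sub (dvd_add (h1.mul_left _) (h2.mul_left _)) (hdvd.mul_left _)
      rw [← ZMod.intCast_zmod_eq_zero_iff_dvd] at this
      push_cast at this
      exact mul_ne_zero h3 hm' this
    · exact exists_padic_binEval_eq_of_deriv' hdvd h2
  · exact exists_padic_binEval_eq_of_deriv hdvd h1

end LocalSolvability

section Neighbour

/-- The form `F(Px + ry, y) / P`, when `P` divides `F(r, 1)`. -/
def neighbourForm (c : Fin 4 → ℤ) (P r : ℤ) : Fin 4 → ℤ :=
  ![c 0 * P ^ 2, P * (3 * c 0 * r + c 1), 3 * c 0 * r ^ 2 + 2 * c 1 * r + c 2,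
    binEval (n := 3) c r 1 / P]

variable {c : Fin 4 → ℤ} {P r : ℤ}

lemma mul_neighbourForm (hr : P ∣ binEval (n := 3) c r 1) :
    (fun i => P * neighbourForm c P r i) = substForm c P r 0 1 := by
  funext i
  fin_cases i
  · simp [neighbourForm, substForm]; ring
  · simp [neighbourForm, substForm]; ring
  · simp [neighbourForm, substForm]; ring
  · have := Int.mul_ediv_cancel' hr
    simp only [neighbourForm, substForm]
    simp
    rw [this, binEval_cubic]
    ring

lemma mul_binEval_neighbourForm (hr : P ∣ binEval (n := 3) c r 1) {R : Type*} [CommRing R]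
    (x y : R) : (P : R) * binEval (n := 3) (fun i => ((neighbourForm c P r i : ℤ) : R)) x y =
      binEval (n := 3) (fun i => ((c i : ℤ) : R)) (P * x + r * y) y := by
  have h : ∀ i, P * neighbourForm c P r i = substForm c P r 0 1 i :=
    fun i => congrFun (mul_neighbourForm hr) i
  have h' : ∀ i, (P : R) * ((neighbourForm c P r i : ℤ) : R) = ((substForm c P r 0 1 i : ℤ) : R) :=
    fun i => by rw [← h]; push_cast; ring
  have e : (P : R) * binEval (n := 3) (fun i => ((neighbourForm c P r i : ℤ) : R)) x y =
      binEval (n := 3) (fun i => ((substForm c P r 0 1 i : ℤ) : R)) x y := by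
    simp only [binEval_cubic, ← h']
    ring
  rw [e]
  simp only [binEval_cubic, substForm, Matrix.cons_val]
  push_cast
  ring

lemma hess_neighbourForm (hP : P ≠ 0) (hr : P ∣ binEval (n := 3) c r 1) :
    hessA (neighbourForm c P r) = P ^ 2 * hessA c ∧
    hessB (neighbourForm c P r) = P * (2 * hessA c * r + hessB c) ∧
    hessC (neighbourForm c P r) = hessVal c r 1 := by
  have h := mul_neighbourForm hr
  have hP2 : P ^ 2 ≠ 0 := pow_ne_zero 2 hP
  refine ⟨mul_left_cancel₀ hP2 ?_, mul_left_cancel₀ hP2 ?_, mul_left_cancel₀ hP2 ?_⟩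
  · have := congrArg hessA h
    rw [hessA_substForm] at this
    simp only [hessA, hessVal] at this ⊢
    linear_combination this
  · have := congrArg hessB h
    rw [hessB_substForm] at this
    simp only [hessA, hessB] at this ⊢
    linear_combination this
  · have := congrArg hessC h
    rw [hessC_substForm] at this
    simp only [hessC, hessVal] at this ⊢
    linear_combination this

lemma hessVal_neighbourForm (hP : P ≠ 0) (hr : P ∣ binEval (n := 3) c r 1) (x y : ℤ) :
    hessVal (neighbourForm c P r) x y = hessVal c (P * x + r * y) y := by
  obtain ⟨h1, h2, h3⟩ := hess_neighbourForm hP hr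
  rw [hessVal, h1, h2, h3]
  simp only [hessVal]
  ring

lemma cubicDisc_neighbourForm (hP : P ≠ 0) (hr : P ∣ binEval (n := 3) c r 1) :
    cubicDisc (neighbourForm c P r) = P ^ 2 * cubicDisc c := by
  have h := congrArg cubicDisc (mul_neighbourForm hr)
  rw [cubicDisc_substForm] at h
  have hP4 : P ^ 4 ≠ 0 := pow_ne_zero 4 hP
  refine mul_left_cancel₀ hP4 ?_
  simp only [cubicDisc] at h ⊢
  linear_combination h

lemma isMaximalForm_of_hess {G : Fin 4 → ℤ} (h : ∀ q : ℕ, q.Prime →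
    ¬ ((q : ℤ) ∣ hessA G ∧ (q : ℤ) ∣ hessB G ∧ (q : ℤ) ∣ hessC G)) :
    IsMaximalForm (n := 3) G := by
  rintro ⟨F, a, b, c, d, hdet, hF⟩
  have hG : G = substForm F a b c d := cubic_ext_int fun x y => by rw [hF, binEval_substForm]
  obtain ⟨q, hq, hqd⟩ := Nat.exists_prime_and_dvd (n := (a * d - b * c).natAbs) (by
    intro h1
    rw [Int.abs_eq_natAbs, h1] at hdet
    simp at hdet)
  have hqd' : (q : ℤ) ∣ (a * d - b * c) ^ 2 := dvd_pow (Int.natCast_dvd.2 hqd) two_ne_zero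
  refine h q hq ⟨?_, ?_, ?_⟩
  · rw [hG, hessA_substForm]; exact hqd'.mul_right _
  · rw [hG, hessB_substForm]; exact hqd'.mul_right _
  · rw [hG, hessC_substForm]; exact hqd'.mul_right _

/-- The congruence `F ≡ x³ - xy²` modulo `P`. -/
def IsSplitMod (c : Fin 4 → ℤ) (P : ℤ) : Prop :=
  P ∣ c 0 - 1 ∧ P ∣ c 1 ∧ P ∣ c 2 + 1 ∧ P ∣ c 3

lemma IsSplitMod.dvd_binEval (h : IsSplitMod c P) (hr : P ∣ r ^ 3 - r) :
    P ∣ binEval (n := 3) c r 1 := by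
  obtain ⟨h0, h1, h2, h3⟩ := h
  have e : binEval (n := 3) c r 1 = (c 0 - 1) * r ^ 3 + c 1 * r ^ 2 + (c 2 + 1) * r + c 3 +
      (r ^ 3 - r) := by
    rw [binEval_cubic]; ring
  rw [e]
  exact dvd_add (dvd_add (dvd_add (dvd_add (h0.mul_right _) (h1.mul_right _)) (h2.mul_right _)) h3)
    hr

lemma IsSplitMod.not_dvd_neighbourForm_two (h : IsSplitMod c P) (hr : P ∣ r ^ 3 - r) {q : ℕ}
    (hq : q.Prime) (hqP : (q : ℤ) ∣ P) (hq2 : q ≠ 2) : ¬ (q : ℤ) ∣ neighbourForm c P r 2 := by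
  intro hd
  obtain ⟨h0, h1, h2, h3⟩ := h
  have hqI : Prime (q : ℤ) := Nat.prime_iff_prime_int.1 hq
  have e1 : (q : ℤ) ∣ 3 * r ^ 2 - 1 := by
    have e : 3 * r ^ 2 - 1 = neighbourForm c P r 2 - (3 * r ^ 2 * (c 0 - 1) + 2 * r * c 1 +
        (c 2 + 1)) := by
      simp only [neighbourForm, Matrix.cons_val]; ring
    rw [e]
    exact dvd_sub hd (hqP.trans (dvd_add (dvd_add (h0.mul_left _) (h1.mul_left _)) h2))
  have e2 : (q : ℤ) ∣ 2 * r := by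
    have e : 2 * r = r * (3 * r ^ 2 - 1) - 3 * (r ^ 3 - r) := by ring
    rw [e]
    exact dvd_sub (e1.mul_left _) ((hqP.trans hr).mul_left _)
  rcases hqI.dvd_or_dvd e2 with h | h
  · have := Nat.le_of_dvd (by norm_num) (Int.natCast_dvd_natCast.1 h)
    exact hq2 (le_antisymm this hq.two_le)
  · have : (q : ℤ) ∣ 1 := by
      have e : (1 : ℤ) = 3 * r * r - (3 * r ^ 2 - 1) := by ring
      rw [e]
      exact dvd_sub (h.mul_left _) e1
    exact hqI.not_isUnit (isUnit_of_dvd_one this)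

lemma isMaximalForm_neighbourForm (hP : P ≠ 0) (hP2 : ¬ (2 : ℤ) ∣ P) (hs : IsSplitMod c P)
    (hr : P ∣ r ^ 3 - r) (h : ∀ q : ℕ, q.Prime →
    ¬ ((q : ℤ) ∣ hessA c ∧ (q : ℤ) ∣ hessB c ∧ (q : ℤ) ∣ hessC c)) :
    IsMaximalForm (n := 3) (neighbourForm c P r) := by
  refine isMaximalForm_of_hess fun q hq ⟨hA, hB, hC⟩ => ?_
  have hqI : Prime (q : ℤ) := Nat.prime_iff_prime_int.1 hq
  by_cases hqP : (q : ℤ) ∣ P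
  · refine hs.not_dvd_neighbourForm_two hr hq hqP (by rintro rfl; exact hP2 (by exact_mod_cast hqP))
      (hqI.dvd_of_dvd_pow (n := 2) ?_)
    have e : neighbourForm c P r 2 ^ 2 = hessC (neighbourForm c P r) +
        3 * neighbourForm c P r 1 * neighbourForm c P r 3 := by
      rw [hessC]; ring
    rw [e]
    refine dvd_add hC (((Dvd.dvd.mul_left ?_ _)).mul_right _)
    simp only [neighbourForm, Matrix.cons_val]
    exact hqP.mul_right _
  · obtain ⟨h1, h2, h3⟩ := hess_neighbourForm hP (hs.dvd_binEval hr)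
    rw [h1] at hA
    rw [h2] at hB
    rw [h3] at hC
    have hA' := (hqI.dvd_or_dvd hA).resolve_left fun h => hqP (hqI.dvd_of_dvd_pow h)
    have hB' : (q : ℤ) ∣ hessB c := by
      have := (hqI.dvd_or_dvd hB).resolve_left hqP
      rwa [mul_assoc, mul_left_comm, dvd_add_right (hA'.mul_right _)] at this
    refine h q hq ⟨hA', hB', ?_⟩
    have e : hessC c = hessVal c r 1 - (hessA c * r ^ 2 + hessB c * r) := by
      rw [hessVal]; ring
    rw [e]
    exact dvd_sub hC (dvd_add (hA'.mul_right _) (hB'.mul_right _))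

lemma locallyRep_neighbourForm {h : ℤ} (hP : P ≠ 0) (hP2 : ¬ (2 : ℤ) ∣ P) (hs : IsSplitMod c P)
    (hr : P ∣ r ^ 3 - r) (h0 : c 0 ≠ 0)
    (hH : ∀ q : ℕ, q.Prime → ¬ ((q : ℤ) ∣ hessA c ∧ (q : ℤ) ∣ hessB c ∧ (q : ℤ) ∣ hessC c))
    (hloc : ∀ q : ℕ, q.Prime → ¬ (q : ℤ) ∣ P →
      ((q : ℤ) ∣ c 0 ∧ (q : ℤ) ∣ c 1 - 1 ∧ (q : ℤ) ∣ c 2 ∧ (q : ℤ) ∣ c 3) ∨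
      (3000 ≤ q ∧ ¬ (q : ℤ) ∣ h)) :
    LocallyRep (n := 3) (neighbourForm c P r) h := by
  have hrF := hs.dvd_binEval hr
  refine ⟨exists_real_binEval_eq ?_ h, fun q hq => ?_⟩
  · simp only [neighbourForm, Matrix.cons_val]
    exact mul_ne_zero h0 (pow_ne_zero 2 hP)
  have : Fact q.Prime := ⟨hq⟩
  have hqI : Prime (q : ℤ) := Nat.prime_iff_prime_int.1 hq
  by_cases hqP : (q : ℤ) ∣ P
  · have hu := hs.not_dvd_neighbourForm_two hr hq hqP
      (by rintro rfl; exact hP2 (by exact_mod_cast hqP))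
    set G := neighbourForm c P r with hG
    have g0 : (q : ℤ) ∣ G 0 := by
      simp only [hG, neighbourForm, Matrix.cons_val]
      exact (dvd_pow hqP two_ne_zero).mul_left _
    have g1 : (q : ℤ) ∣ G 1 := by
      simp only [hG, neighbourForm, Matrix.cons_val]
      exact hqP.mul_right _
    have hcop : IsCoprime (q : ℤ) (G 2) := (hqI.coprime_iff_not_dvd).2 hu
    obtain ⟨s, t, hst⟩ := hcop
    refine exists_padic_binEval_eq_of_deriv (p := q) (x := t * (h - G 3)) (y := 1) ?_ ?_
    · have e : binEval (n := 3) G (t * (h - G 3)) 1 - h = G 0 * (t * (h - G 3)) ^ 3 +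
          G 1 * (t * (h - G 3)) ^ 2 - q * (s * (h - G 3)) := by
        rw [binEval_cubic]; linear_combination (h - G 3) * hst
      rw [e]
      exact dvd_sub (dvd_add (g0.mul_right _) (g1.mul_right _)) (dvd_mul_right _ _)
    · intro hd
      refine hu ((dvd_add_right (dvd_add (a := (q : ℤ)) (b := 3 * G 0 * (t * (h - G 3)) ^ 2)
        (c := 2 * G 1 * (t * (h - G 3)) * 1) ?_ ?_)).1 (by simpa using hd))
      · exact (g0.mul_left _).mul_right _
      · exact ((g1.mul_left _).mul_right _).mul_right _
  · have hF : ∃ u v : ℤ_[q], binEval (n := 3) (fun i => ((c i : ℤ) : ℤ_[q])) u v =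
        ((h * P : ℤ) : ℤ_[q]) := by
      rcases hloc q hq hqP with ⟨g0, g1, g2, g3⟩ | ⟨hq3, hqh⟩
      · refine exists_padic_binEval_eq_of_deriv' (p := q) (x := 1) (y := h * P) ?_ ?_
        · have e : binEval (n := 3) c 1 (h * P) - h * P = c 0 + (c 1 - 1) * (h * P) +
              c 2 * (h * P) ^ 2 + c 3 * (h * P) ^ 3 := by
            rw [binEval_cubic]; ring
          rw [e]
          exact dvd_add (dvd_add (dvd_add g0 (g1.mul_right _)) (g2.mul_right _)) (g3.mul_right _)
        · intro hd
          have e : (1 : ℤ) = c 1 * 1 ^ 2 + 2 * c 2 * 1 * (h * P) + 3 * c 3 * (h * P) ^ 2 -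
              ((c 1 - 1) + c 2 * (2 * (h * P)) + c 3 * (3 * (h * P) ^ 2)) := by ring
          refine hqI.not_isUnit (isUnit_of_dvd_one ?_)
          rw [e]
          exact dvd_sub hd (dvd_add (dvd_add g1 (g2.mul_right _)) (g3.mul_right _))
      · refine exists_padic_binEval_eq hq3 (hH q hq) fun hd => ?_
        exact (hqI.dvd_or_dvd hd).elim hqh hqP
    obtain ⟨u, v, huv⟩ := hF
    have hPu : IsUnit ((P : ℤ) : ℤ_[q]) := by
      rw [PadicInt.isUnit_iff]
      refine le_antisymm (PadicInt.norm_le_one _) ?_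
      by_contra! hlt
      exact hqP ((PadicInt.norm_int_lt_one_iff_dvd _).1 hlt)
    obtain ⟨w, hw⟩ := hPu.exists_right_inv
    refine ⟨w * (u - r * v), v, hPu.mul_left_cancel ?_⟩
    rw [mul_binEval_neighbourForm hrF]
    have e : (P : ℤ_[q]) * (w * (u - r * v)) + r * v = u := by
      rw [← mul_assoc, hw]; ring
    rw [e, huv]
    push_cast
    ring

lemma exists_neighbourForm_not_represent {h : ℤ} (hsq : Squarefree P)
    (hcop : IsCoprime P h) (hs : IsSplitMod c P) {R : Finset ℤ} (hR : 22 ≤ #R)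
    (hRP : ∀ r ∈ R, 0 ≤ r ∧ r < P ∧ P ∣ r ^ 3 - r)
    (hS : ∀ S : Finset (ℤ × ℤ), (∀ v ∈ S, binEval (n := 3) c v.1 v.2 = h * P) → #S ≤ 21) :
    ∃ r ∈ R, ¬ ∃ x y : ℤ, binEval (n := 3) (neighbourForm c P r) x y = h := by
  by_contra! hall
  have hall' : ∀ r : ℤ, ∃ v : ℤ × ℤ, r ∈ R →
      binEval (n := 3) (neighbourForm c P r) v.1 v.2 = h := by
    intro r
    by_cases hr : r ∈ R
    · obtain ⟨x, y, hxy⟩ := hall r hr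
      exact ⟨(x, y), fun _ => hxy⟩
    · exact ⟨0, fun h => absurd h hr⟩
  choose v hv using hall'
  have hval : ∀ r ∈ R, binEval (n := 3) c (P * (v r).1 + r * (v r).2) (v r).2 = h * P := by
    intro r hr
    have := mul_binEval_neighbourForm (hs.dvd_binEval (hRP r hr).2.2) (R := ℤ) (v r).1 (v r).2
    simp only [Int.cast_id] at this
    rw [← this, hv r hr, mul_comm]
  have hinj : Set.InjOn (fun r => (P * (v r).1 + r * (v r).2, (v r).2)) (R : Set ℤ) := by
    intro r hr r' hr' heq
    simp only [Prod.mk.injEq] at heq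
    obtain ⟨e1, e2⟩ := heq
    by_contra hne
    have hd : P ∣ (r - r') * (v r).2 := ⟨(v r').1 - (v r).1, by
      rw [← e2] at e1; linear_combination e1⟩
    by_cases hc : IsCoprime P (v r).2
    · have := hc.dvd_of_dvd_mul_right hd
      have h1 := hRP r hr
      have h2 := hRP r' hr'
      have h3 := Int.eq_zero_of_abs_lt_dvd this (by rw [abs_lt]; constructor <;> linarith)
      exact hne (sub_eq_zero.1 h3)
    · rw [Int.isCoprime_iff_gcd_eq_one] at hc
      obtain ⟨q, hq, hqd⟩ := Nat.exists_prime_and_dvd hc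
      have hqI : Prime (q : ℤ) := Nat.prime_iff_prime_int.1 hq
      have hqP : (q : ℤ) ∣ P := (Int.natCast_dvd_natCast.2 hqd).trans (Int.gcd_dvd_left _ _)
      have hqy : (q : ℤ) ∣ (v r).2 := (Int.natCast_dvd_natCast.2 hqd).trans (Int.gcd_dvd_right _ _)
      have hqx : (q : ℤ) ∣ P * (v r).1 + r * (v r).2 := dvd_add (hqP.mul_right _) (hqy.mul_left _)
      have h2 : (q : ℤ) * q ∣ h * P := by
        rw [← hval r hr, binEval_cubic]
        obtain ⟨X, hX⟩ := hqx
        obtain ⟨Y, hY⟩ := hqy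
        rw [hX, hY]
        exact ⟨q * (c 0 * X ^ 3 + c 1 * X ^ 2 * Y + c 2 * X * Y ^ 2 + c 3 * Y ^ 3), by ring⟩
      have hqh : IsCoprime ((q : ℤ) * q) h :=
        IsCoprime.mul_left (hcop.of_isCoprime_of_dvd_left hqP) (hcop.of_isCoprime_of_dvd_left hqP)
      exact hqI.not_isUnit (hsq _ (hqh.dvd_of_dvd_mul_left h2))
  have := hS (R.image fun r => (P * (v r).1 + r * (v r).2, (v r).2)) (by
    intro w hw
    obtain ⟨r, hr, rfl⟩ := mem_image.1 hw
    exact hval r hr)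
  rw [card_image_of_injOn hinj] at this
  omega

end Neighbour

section Residues

lemma exists_mul_residues {P p : ℤ} (hP : 0 < P) (hp : 2 < p) (hc : IsCoprime P p) {R : Finset ℤ}
    (hR : ∀ r ∈ R, 0 ≤ r ∧ r < P ∧ P ∣ r ^ 3 - r) :
    ∃ R' : Finset ℤ, #R' = 3 * #R ∧ ∀ r ∈ R', 0 ≤ r ∧ r < P * p ∧ P * p ∣ r ^ 3 - r := by
  obtain ⟨u, v, huv⟩ := hc
  have hPp : 0 < P * p := by positivity
  set t : ℤ × ℤ → ℤ := fun z => (z.1 * (v * p) + z.2 * (u * P)) % (P * p) with ht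
  have hmod : ∀ a : ℤ, P * p ∣ a % (P * p) - a := fun a =>
    ⟨-(a / (P * p)), by linear_combination Int.emod_add_mul_ediv a (P * p)⟩
  have t1 : ∀ z, P ∣ t z - z.1 := by
    intro z
    have h1 : P ∣ t z - (z.1 * (v * p) + z.2 * (u * P)) :=
      (dvd_mul_right P p).trans (hmod _)
    have e : t z - z.1 = t z - (z.1 * (v * p) + z.2 * (u * P)) + P * (u * (z.2 - z.1)) := by
      linear_combination z.1 * huv
    rw [e]
    exact dvd_add h1 (dvd_mul_right _ _)
  have t2 : ∀ z, p ∣ t z - z.2 := by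
    intro z
    have h1 : p ∣ t z - (z.1 * (v * p) + z.2 * (u * P)) :=
      (dvd_mul_left p P).trans (hmod _)
    have e : t z - z.2 = t z - (z.1 * (v * p) + z.2 * (u * P)) + p * (v * (z.1 - z.2)) := by
      linear_combination z.2 * huv
    rw [e]
    exact dvd_add h1 (dvd_mul_right _ _)
  have cube : ∀ {q a b : ℤ}, q ∣ a - b → q ∣ b ^ 3 - b → q ∣ a ^ 3 - a := by
    intro q a b h1 h2
    have e : a ^ 3 - a = (a - b) * (a ^ 2 + a * b + b ^ 2 - 1) + (b ^ 3 - b) := by ring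
    rw [e]
    exact dvd_add (h1.mul_right _) h2
  refine ⟨(R ×ˢ ({-1, 0, 1} : Finset ℤ)).image t, ?_, ?_⟩
  · rw [card_image_of_injOn, card_product]
    · simp [mul_comm]
    · intro z hz w hw h
      rw [mem_coe, mem_product] at hz hw
      have h1 : P ∣ z.1 - w.1 := by
        have := dvd_sub (t1 w) (t1 z)
        rw [h] at this
        simpa using this
      have h2 : p ∣ z.2 - w.2 := by
        have := dvd_sub (t2 w) (t2 z)
        rw [h] at this
        simpa using this
      have a1 := hR _ hz.1
      have a2 := hR _ hw.1
      have b1 : -1 ≤ z.2 ∧ z.2 ≤ 1 := by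
        have := hz.2; simp at this; omega
      have b2 : -1 ≤ w.2 ∧ w.2 ≤ 1 := by
        have := hw.2; simp at this; omega
      have c1 := Int.eq_zero_of_abs_lt_dvd h1 (by rw [abs_lt]; constructor <;> linarith)
      have c2 := Int.eq_zero_of_abs_lt_dvd h2 (by rw [abs_lt]; constructor <;> linarith)
      exact Prod.ext (sub_eq_zero.1 c1) (sub_eq_zero.1 c2)
  · intro r hr
    obtain ⟨z, hz, rfl⟩ := mem_image.1 hr
    rw [mem_product] at hz
    refine ⟨Int.emod_nonneg _ hPp.ne', Int.emod_lt_of_pos _ hPp, ?_⟩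
    refine IsCoprime.mul_dvd ⟨u, v, huv⟩ (cube (t1 z) (hR _ hz.1).2.2) (cube (t2 z) ?_)
    have := hz.2
    simp at this
    rcases this with h | h | h <;> simp [h]

lemma exists_modulus_and_residues (N : ℕ) : ∃ P : ℤ, 0 < P ∧ Squarefree P ∧
    (∀ q : ℕ, q.Prime → (q : ℤ) ∣ P → N < q) ∧
    ∃ R : Finset ℤ, 22 ≤ #R ∧ ∀ r ∈ R, 0 ≤ r ∧ r < P ∧ P ∣ r ^ 3 - r := by
  obtain ⟨p₁, h1, hp1⟩ := Nat.exists_infinite_primes (N + 3)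
  obtain ⟨p₂, h2, hp2⟩ := Nat.exists_infinite_primes (p₁ + 1)
  obtain ⟨p₃, h3, hp3⟩ := Nat.exists_infinite_primes (p₂ + 1)
  have c12 : Nat.Coprime p₁ p₂ := (Nat.coprime_primes hp1 hp2).2 (by omega)
  have c13 : Nat.Coprime p₁ p₃ := (Nat.coprime_primes hp1 hp3).2 (by omega)
  have c23 : Nat.Coprime p₂ p₃ := (Nat.coprime_primes hp2 hp3).2 (by omega)
  have c123 : Nat.Coprime (p₁ * p₂) p₃ := Nat.Coprime.mul_left c13 c23
  have pos1 : (0 : ℤ) < p₁ := by exact_mod_cast hp1.pos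
  have pos2 : (0 : ℤ) < p₂ := by exact_mod_cast hp2.pos
  have pos3 : (0 : ℤ) < p₃ := by exact_mod_cast hp3.pos
  obtain ⟨R₁, hc1, hR1⟩ := exists_mul_residues (P := 1) (p := p₁) (R := {0}) one_pos
    (by omega) isCoprime_one_left (by simp)
  rw [one_mul] at hR1
  obtain ⟨R₂, hc2, hR2⟩ := exists_mul_residues (p := p₂) pos1 (by omega)
    (Nat.isCoprime_iff_coprime.2 c12) hR1
  obtain ⟨R₃, hc3, hR3⟩ := exists_mul_residues (p := p₃) (mul_pos pos1 pos2) (by omega)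
    (by exact_mod_cast Nat.isCoprime_iff_coprime.2 c123) hR2
  refine ⟨(p₁ : ℤ) * p₂ * p₃, by positivity, ?_, ?_, R₃, ?_, hR3⟩
  · have : Squarefree (p₁ * p₂ * p₃) := by
      rw [Nat.squarefree_mul c123, Nat.squarefree_mul c12]
      exact ⟨⟨hp1.prime.squarefree, hp2.prime.squarefree⟩, hp3.prime.squarefree⟩
    exact_mod_cast Int.squarefree_natCast.2 this
  · intro q hq hd
    have hd' : q ∣ p₁ * p₂ * p₃ := by exact_mod_cast hd
    rcases (Nat.Prime.dvd_mul hq).1 hd' with h | h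
    · rcases (Nat.Prime.dvd_mul hq).1 h with h | h
      · have := (Nat.prime_dvd_prime_iff_eq hq hp1).1 h; omega
      · have := (Nat.prime_dvd_prime_iff_eq hq hp2).1 h; omega
    · have := (Nat.prime_dvd_prime_iff_eq hq hp3).1 h; omega
  · rw [hc3, hc2, hc1]; simp

end Residues

section Sieve

/-- The form with coefficients `v + M t`. -/
def shiftForm (M : ℤ) (v : Fin 4 → ℤ) (t : ℕ × ℕ × ℕ × ℕ) : Fin 4 → ℤ :=
  ![v 0 + M * t.1, v 1 + M * t.2.1, v 2 + M * t.2.2.1, v 3 + M * t.2.2.2]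

/-- The box `[0, N)⁴`. -/
def natBox (N : ℕ) : Finset (ℕ × ℕ × ℕ × ℕ) := range N ×ˢ range N ×ˢ range N ×ˢ range N

lemma card_natBox (N : ℕ) : #(natBox N) = N ^ 4 := by
  simp only [natBox, card_product, card_range]; ring

lemma mem_natBox {N : ℕ} {t : ℕ × ℕ × ℕ × ℕ} :
    t ∈ natBox N ↔ t.1 < N ∧ t.2.1 < N ∧ t.2.2.1 < N ∧ t.2.2.2 < N := by
  simp only [natBox, mem_product, mem_range]

variable {q : ℕ} {M : ℤ}

lemma modEq_of_dvd_affine (hq : q.Prime) {u v : ℤ} (hu : ¬ (q : ℤ) ∣ u) {i j : ℕ}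
    (hi : (q : ℤ) ∣ u * i + v) (hj : (q : ℤ) ∣ u * j + v) : i ≡ j [MOD q] := by
  have hqI : Prime (q : ℤ) := Nat.prime_iff_prime_int.1 hq
  have h := dvd_sub hj hi
  have e : u * j + v - (u * i + v) = u * (j - i) := by ring
  rw [e] at h
  exact (Nat.modEq_iff_dvd).2 ((hqI.dvd_or_dvd h).resolve_left hu)

lemma card_dvd_affine_le (hq : q.Prime) {u v : ℤ} (hu : ¬ (q : ℤ) ∣ u) (N : ℕ) :
    #{i ∈ range N | (q : ℤ) ∣ u * (i : ℕ) + v} ≤ N / q + 1 := by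
  rw [← card_range (N / q + 1)]
  refine card_le_card_of_injOn (fun i => i / q) ?_ ?_
  · intro i hi
    rw [mem_coe, mem_filter, mem_range] at hi
    rw [mem_coe, mem_range]
    exact Nat.lt_succ_of_le (Nat.div_le_div_right hi.1.le)
  · intro i hi j hj h
    have hm := modEq_of_dvd_affine hq hu (mem_filter.1 hi).2 (mem_filter.1 hj).2
    have h' : i / q = j / q := h
    rw [← Nat.div_add_mod i q, ← Nat.div_add_mod j q, h', hm]

lemma card_hess_dvd_of_not_dvd_le (hq : q.Prime) (hM : ¬ (q : ℤ) ∣ M) (h3 : ¬ (q : ℤ) ∣ 3)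
    (v : Fin 4 → ℤ) (N : ℕ) :
    #{t ∈ natBox N | ¬ (q : ℤ) ∣ shiftForm M v t 0 ∧ (q : ℤ) ∣ hessA (shiftForm M v t) ∧
      (q : ℤ) ∣ hessB (shiftForm M v t)} ≤ N ^ 2 * (N / q + 1) ^ 2 := by
  have hqI : Prime (q : ℤ) := Nat.prime_iff_prime_int.1 hq
  have hmul : ∀ {x y : ℤ}, ¬ (q : ℤ) ∣ x → ¬ (q : ℤ) ∣ y → ¬ (q : ℤ) ∣ x * y :=
    fun hx hy h => (hqI.dvd_or_dvd h).elim hx hy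
  set S := {t ∈ natBox N | ¬ (q : ℤ) ∣ shiftForm M v t 0 ∧ (q : ℤ) ∣ hessA (shiftForm M v t) ∧
      (q : ℤ) ∣ hessB (shiftForm M v t)} with hS
  set S₁ : Finset (ℕ × ℕ × ℕ) := S.image fun t => (t.1, t.2.1, t.2.2.1) with hS₁
  have step1 : #S ≤ (N / q + 1) * #S₁ := by
    refine card_le_mul_card_image_of_maps_to (fun t ht => mem_image_of_mem _ ht) _ ?_
    rintro ⟨i, j, k⟩ hz
    obtain ⟨t₀, ht₀, h0⟩ := mem_image.1 hz
    obtain ⟨-, ha, -⟩ := mem_filter.1 ht₀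
    simp only [Prod.mk.injEq] at h0
    simp only [shiftForm, Matrix.cons_val, h0] at ha
    refine le_trans (card_le_card_of_injOn (fun t => t.2.2.2) ?_ ?_)
      (card_dvd_affine_le hq (u := (3 * 3 * (v 0 + M * i)) * M)
        (v := 9 * (v 0 + M * i) * v 3 - (v 1 + M * j) * (v 2 + M * k))
        (hmul (hmul (hmul h3 h3) ha) hM) N)
    · intro t ht
      obtain ⟨htS, ht'⟩ := mem_filter.1 ht
      obtain ⟨hbox, -, -, hB⟩ := mem_filter.1 htS
      simp only [Prod.mk.injEq] at ht'
      refine mem_coe.2 (mem_filter.2 ⟨mem_range.2 (mem_natBox.1 hbox).2.2.2, ?_⟩)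
      rw [← Int.dvd_neg] at hB
      convert hB using 2
      simp only [hessB, shiftForm, Matrix.cons_val, ht']
      ring
    · intro t ht t' ht' h
      have h1 := (mem_filter.1 ht).2
      have h2 := (mem_filter.1 ht').2
      simp only [Prod.mk.injEq] at h1 h2
      refine Prod.ext (h1.1.trans h2.1.symm) (Prod.ext (h1.2.1.trans h2.2.1.symm)
        (Prod.ext (h1.2.2.trans h2.2.2.symm) h))
  have step2 : #S₁ ≤ (N / q + 1) * #(range N ×ˢ range N) := by
    refine card_le_mul_card_image_of_maps_to (f := fun z : ℕ × ℕ × ℕ => (z.1, z.2.1)) ?_ _ ?_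
    · intro z hz
      obtain ⟨t, ht, rfl⟩ := mem_image.1 hz
      have := mem_natBox.1 (mem_filter.1 ht).1
      exact mem_product.2 ⟨mem_range.2 this.1, mem_range.2 this.2.1⟩
    · rintro ⟨i, j⟩ -
      rcases ({z ∈ S₁ | (z.1, z.2.1) = (i, j)}).eq_empty_or_nonempty with h | ⟨z₀, hz₀⟩
      · rw [h]; simp
      obtain ⟨hz₀, h0⟩ := mem_filter.1 hz₀
      obtain ⟨t₀, ht₀, rfl⟩ := mem_image.1 hz₀
      obtain ⟨-, ha, -⟩ := mem_filter.1 ht₀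
      simp only [Prod.mk.injEq] at h0
      simp only [shiftForm, Matrix.cons_val, h0] at ha
      refine le_trans (card_le_card_of_injOn (fun z => z.2.2) ?_ ?_)
        (card_dvd_affine_le hq (u := (3 * (v 0 + M * i)) * M)
          (v := 3 * (v 0 + M * i) * v 2 - (v 1 + M * j) ^ 2)
          (hmul (hmul h3 ha) hM) N)
      · intro z hz
        obtain ⟨hzS, hz'⟩ := mem_filter.1 hz
        obtain ⟨t, ht, rfl⟩ := mem_image.1 hzS
        obtain ⟨hbox, -, hA, -⟩ := mem_filter.1 ht
        simp only [Prod.mk.injEq] at hz'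
        refine mem_coe.2 (mem_filter.2 ⟨mem_range.2 (mem_natBox.1 hbox).2.2.1, ?_⟩)
        rw [← Int.dvd_neg] at hA
        convert hA using 2
        simp only [hessA, shiftForm, Matrix.cons_val, hz']
        ring
      · intro z hz z' hz' h
        have h1 := (mem_filter.1 hz).2
        have h2 := (mem_filter.1 hz').2
        simp only [Prod.mk.injEq] at h1 h2
        exact Prod.ext (h1.1.trans h2.1.symm) (Prod.ext (h1.2.trans h2.2.symm) h)
  rw [card_product, card_range] at step2
  calc #S ≤ (N / q + 1) * ((N / q + 1) * (N * N)) := step1.trans (Nat.mul_le_mul_left _ step2)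
    _ = _ := by ring

lemma card_hess_dvd_of_dvd_le (hq : q.Prime) (hM : ¬ (q : ℤ) ∣ M) (v : Fin 4 → ℤ) (N : ℕ) :
    #{t ∈ natBox N | (q : ℤ) ∣ shiftForm M v t 0 ∧ (q : ℤ) ∣ hessA (shiftForm M v t) ∧
      (q : ℤ) ∣ hessC (shiftForm M v t)} ≤ N * (N / q + 1) ^ 3 := by
  have hqI : Prime (q : ℤ) := Nat.prime_iff_prime_int.1 hq
  set R : ℤ → Finset ℕ := fun w => {i ∈ range N | (q : ℤ) ∣ M * (i : ℕ) + w} with hR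
  have hRc : ∀ w, #(R w) ≤ N / q + 1 := fun w => card_dvd_affine_le hq hM N
  refine le_trans (card_le_card (t := R (v 0) ×ˢ R (v 1) ×ˢ R (v 2) ×ˢ range N) ?_) ?_
  · intro t ht
    obtain ⟨hbox, h0, hA, hC⟩ := mem_filter.1 ht
    have hbox' := mem_natBox.1 hbox
    have h1 : (q : ℤ) ∣ shiftForm M v t 1 := by
      refine hqI.dvd_of_dvd_pow (n := 2) ?_
      have e : shiftForm M v t 1 ^ 2 = hessA (shiftForm M v t) +
          shiftForm M v t 0 * (3 * shiftForm M v t 2) := by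
        rw [hessA]; ring
      rw [e]
      exact dvd_add hA (h0.mul_right _)
    have h2 : (q : ℤ) ∣ shiftForm M v t 2 := by
      refine hqI.dvd_of_dvd_pow (n := 2) ?_
      have e : shiftForm M v t 2 ^ 2 = hessC (shiftForm M v t) +
          shiftForm M v t 1 * (3 * shiftForm M v t 3) := by
        rw [hessC]; ring
      rw [e]
      exact dvd_add hC (h1.mul_right _)
    simp only [shiftForm, Matrix.cons_val] at h0 h1 h2
    rw [mem_product, mem_product, mem_product, hR]
    simp only [mem_filter, mem_range]
    exact ⟨⟨hbox'.1, by rwa [add_comm]⟩, ⟨hbox'.2.1, by rwa [add_comm]⟩,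
      ⟨hbox'.2.2.1, by rwa [add_comm]⟩, hbox'.2.2.2⟩
  · rw [card_product, card_product, card_product, card_range]
    calc _ ≤ (N / q + 1) * ((N / q + 1) * ((N / q + 1) * N)) := by
          gcongr <;> exact hRc _
      _ = _ := by ring

/-- All three coefficients of the Hessian are divisible by `q`. -/
def HessDvd (q : ℕ) (c : Fin 4 → ℤ) : Prop :=
  (q : ℤ) ∣ hessA c ∧ (q : ℤ) ∣ hessB c ∧ (q : ℤ) ∣ hessC c

instance (q : ℕ) (c : Fin 4 → ℤ) : Decidable (HessDvd q c) := by
  unfold HessDvd; infer_instance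

lemma card_hessDvd_le (hq : q.Prime) (hM : ¬ (q : ℤ) ∣ M) (h3 : ¬ (q : ℤ) ∣ 3)
    (v : Fin 4 → ℤ) (N : ℕ) :
    (#{t ∈ natBox N | HessDvd q (shiftForm M v t)} : ℝ) ≤
      6 * (N : ℝ) ^ 4 * (1 / (q : ℝ) ^ 2) + 6 * (N : ℝ) ^ 2 := by
  have h : #{t ∈ natBox N | HessDvd q (shiftForm M v t)} ≤
      N ^ 2 * (N / q + 1) ^ 2 + N * (N / q + 1) ^ 3 := by
    refine le_trans ?_ (Nat.add_le_add (card_hess_dvd_of_not_dvd_le hq hM h3 v N)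
      (card_hess_dvd_of_dvd_le hq hM v N))
    refine le_trans (card_le_card ?_) (card_union_le _ _)
    intro t ht
    obtain ⟨hb, hA, hB, hC⟩ := mem_filter.1 ht
    rw [mem_union, mem_filter, mem_filter]
    by_cases h0 : (q : ℤ) ∣ shiftForm M v t 0
    · exact Or.inr ⟨hb, h0, hA, hC⟩
    · exact Or.inl ⟨hb, h0, hA, hB⟩
  have hq0 : (1 : ℝ) ≤ q := by exact_mod_cast hq.one_le
  have hdiv : ((N / q : ℕ) : ℝ) ≤ N / q := Nat.cast_div_le
  set x : ℝ := (N : ℝ) / q with hx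
  have hx0 : 0 ≤ x := by positivity
  have hxN : x ≤ N := div_le_self (by positivity) hq0
  have hN0 : (0 : ℝ) ≤ N := by positivity
  have h' : (#{t ∈ natBox N | HessDvd q (shiftForm M v t)} : ℝ) ≤
      (N : ℝ) ^ 2 * (x + 1) ^ 2 + N * (x + 1) ^ 3 := by
    calc _ ≤ (((N ^ 2 * (N / q + 1) ^ 2 + N * (N / q + 1) ^ 3 : ℕ)) : ℝ) := by exact_mod_cast h
      _ ≤ _ := by push_cast; gcongr
  have e : (N : ℝ) ^ 4 * (1 / (q : ℝ) ^ 2) = (N : ℝ) ^ 2 * x ^ 2 := by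
    rw [hx]; field_simp
  have hNN : (N : ℝ) ≤ (N : ℝ) ^ 2 := by
    rcases Nat.eq_zero_or_pos N with h | h
    · simp [h]
    · have : (1 : ℝ) ≤ N := by exact_mod_cast h
      nlinarith
  have b1 : (x + 1) ^ 2 ≤ 2 * x ^ 2 + 2 := by nlinarith [sq_nonneg (x - 1)]
  have b2 : (x + 1) ^ 3 ≤ 4 * x ^ 3 + 4 := by
    nlinarith [mul_nonneg (by linarith : 0 ≤ x + 1) (sq_nonneg (x - 1))]
  calc _ ≤ (N : ℝ) ^ 2 * (2 * x ^ 2 + 2) + N * (4 * x ^ 3 + 4) := h'.trans (by gcongr)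
    _ ≤ (N : ℝ) ^ 2 * (2 * x ^ 2 + 2) + (4 * (N * (N * x ^ 2)) + 4 * (N : ℝ) ^ 2) := by
        have : (N : ℝ) * x ^ 3 ≤ N * (N * x ^ 2) := by
          rw [pow_succ' x 2]; gcongr
        linarith
    _ = _ := by rw [mul_assoc 6, e]; ring

lemma card_hessDvd_large_le {v : Fin 4 → ℤ} {N Y : ℕ} (hN : N ≤ Y) (hY : 9 < Y)
    (hb : ∀ t ∈ natBox N, 0 < shiftForm M v t 0 ∧ shiftForm M v t 0 < Y ∧
      0 < hessA (shiftForm M v t) ∧ hessA (shiftForm M v t) < (Y : ℤ) ^ 2)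
    {S : Finset (ℕ × ℕ × ℕ × ℕ)} (hSb : S ⊆ natBox N)
    (hS : ∀ t ∈ S, ∃ q : ℕ, q.Prime ∧ ¬ (q : ℤ) ∣ M ∧ Y < q ∧ HessDvd q (shiftForm M v t)) :
    #S ≤ N ^ 3 := by
  have : N ^ 3 = #(range N ×ˢ range N ×ˢ range N) := by
    simp only [card_product, card_range]; ring
  rw [this]
  refine card_le_card_of_injOn (fun t => (t.1, t.2.1, t.2.2.1)) ?_ ?_
  · intro t ht
    have := mem_natBox.1 (hSb ht)
    rw [mem_coe, mem_product, mem_product, mem_range, mem_range, mem_range]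
    exact ⟨this.1, this.2.1, this.2.2.1⟩
  · intro t ht t' ht' h
    simp only [Prod.mk.injEq] at h
    obtain ⟨h1, h2, h3⟩ := h
    obtain ⟨q, hq, hqM, hqY, hqA, hqB, -⟩ := hS t ht
    obtain ⟨q', hq', -, hqY', hqA', hqB', -⟩ := hS t' ht'
    obtain ⟨ha0, haY, hA0, hAY⟩ := hb t (hSb ht)
    have hAA : hessA (shiftForm M v t') = hessA (shiftForm M v t) := by
      simp only [hessA, shiftForm, Matrix.cons_val, h1, h2, h3]
    rw [hAA] at hqA'
    have hqq : q = q' := by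
      by_contra hne
      have hcop : IsCoprime (q : ℤ) (q' : ℤ) :=
        Nat.isCoprime_iff_coprime.2 ((Nat.coprime_primes hq hq').2 hne)
      have := Int.le_of_dvd hA0 (hcop.mul_dvd hqA hqA')
      have c1 : (Y : ℤ) < q := by exact_mod_cast hqY
      have c2 : (Y : ℤ) < q' := by exact_mod_cast hqY'
      nlinarith
    subst hqq
    have hqI : Prime (q : ℤ) := Nat.prime_iff_prime_int.1 hq
    have hu : ¬ (q : ℤ) ∣ 9 * shiftForm M v t 0 * M := by
      intro hd
      rcases hqI.dvd_or_dvd hd with hd | hd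
      · rcases hqI.dvd_or_dvd hd with hd | hd
        · have := Int.le_of_dvd (by norm_num) hd; omega
        · have := Int.le_of_dvd ha0 hd; omega
      · exact hqM hd
    have hmod := modEq_of_dvd_affine hq hu (i := t.2.2.2) (j := t'.2.2.2)
      (v := 9 * shiftForm M v t 0 * v 3 - shiftForm M v t 1 * shiftForm M v t 2) (by
        rw [← Int.dvd_neg] at hqB
        convert hqB using 2
        simp only [hessB, shiftForm, Matrix.cons_val]; ring) (by
        rw [← Int.dvd_neg] at hqB'
        convert hqB' using 2
        simp only [hessB, shiftForm, Matrix.cons_val, h1, h2, h3]; ring)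
    have l1 := (mem_natBox.1 (hSb ht)).2.2.2
    have l2 := (mem_natBox.1 (hSb ht')).2.2.2
    have h4 := Nat.ModEq.eq_of_lt_of_lt hmod (by omega) (by omega)
    exact Prod.ext h1 (Prod.ext h2 (Prod.ext h3 h4))

end Sieve

section Family

lemma card_hess_primitive_ge {M : ℤ} {v : Fin 4 → ℤ} {N Y Q : ℕ} (hQ0 : 3 ≤ Q)
    (hQ : ∀ q : ℕ, q.Prime → q ≤ Q → (q : ℤ) ∣ M) (hQY : Q ≤ Y) (hN : N ≤ Y) (hY : 9 < Y)
    (hb : ∀ t ∈ natBox N, 0 < shiftForm M v t 0 ∧ shiftForm M v t 0 < Y ∧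
      0 < hessA (shiftForm M v t) ∧ hessA (shiftForm M v t) < (Y : ℤ) ^ 2)
    (S : Finset (ℕ × ℕ × ℕ × ℕ)) (hS : ∀ t ∈ natBox N, (∀ q : ℕ, q.Prime → ¬ (q : ℤ) ∣ M →
      ¬ HessDvd q (shiftForm M v t)) → t ∈ S) :
    (N : ℝ) ^ 4 ≤ #S + (6 * (N : ℝ) ^ 4 * (1 / Q) + 6 * (N : ℝ) ^ 2 * Y + (N : ℝ) ^ 3) := by
  classical
  set L : Finset (ℕ × ℕ × ℕ × ℕ) := {t ∈ natBox N | ∃ q : ℕ, q.Prime ∧ ¬ (q : ℤ) ∣ M ∧ Y < q ∧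
    HessDvd q (shiftForm M v t)} with hL
  have hLc : #L ≤ N ^ 3 := card_hessDvd_large_le hN hY hb (filter_subset _ _)
    fun t ht => (mem_filter.1 ht).2
  set I : Finset ℕ := {q ∈ Ioc Q Y | q.Prime ∧ ¬ (q : ℤ) ∣ M} with hI
  set B : ℕ → Finset (ℕ × ℕ × ℕ × ℕ) := fun q =>
    {t ∈ natBox N | HessDvd q (shiftForm M v t)} with hB
  have hcover : natBox N ⊆ S ∪ (I.biUnion B ∪ L) := by
    intro t ht
    rw [mem_union, mem_union]
    by_cases hall : ∀ q : ℕ, q.Prime → ¬ (q : ℤ) ∣ M → ¬ HessDvd q (shiftForm M v t)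
    · exact Or.inl (hS t ht hall)
    · push Not at hall
      obtain ⟨q, hq, hqM, hd⟩ := hall
      right
      rcases le_or_gt q Y with h | h
      · left
        refine mem_biUnion.2 ⟨q, mem_filter.2 ⟨mem_Ioc.2 ⟨?_, h⟩, hq, hqM⟩, mem_filter.2 ⟨ht, hd⟩⟩
        by_contra! hle
        exact hqM (hQ q hq hle)
      · right
        exact mem_filter.2 ⟨ht, q, hq, hqM, h, hd⟩
  have hsum : (#(I.biUnion B) : ℝ) ≤ 6 * (N : ℝ) ^ 4 * (1 / Q) + 6 * (N : ℝ) ^ 2 * Y := by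
    calc (#(I.biUnion B) : ℝ) ≤ ∑ q ∈ I, (#(B q) : ℝ) := by exact_mod_cast card_biUnion_le
      _ ≤ ∑ q ∈ I, (6 * (N : ℝ) ^ 4 * (1 / (q : ℝ) ^ 2) + 6 * (N : ℝ) ^ 2) := by
          refine sum_le_sum fun q hq => ?_
          obtain ⟨hqI, hqp, hqM⟩ := mem_filter.1 hq
          refine card_hessDvd_le hqp hqM (fun h3 => ?_) v N
          have := Int.le_of_dvd (by norm_num) h3
          have := (mem_Ioc.1 hqI).1
          omega
      _ ≤ ∑ q ∈ Ioc Q Y, (6 * (N : ℝ) ^ 4 * (1 / (q : ℝ) ^ 2) + 6 * (N : ℝ) ^ 2) :=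
          sum_le_sum_of_subset_of_nonneg (filter_subset _ _) fun q _ _ => by positivity
      _ ≤ _ := by
          rw [sum_add_distrib, ← mul_sum, sum_const, nsmul_eq_mul, Nat.card_Ioc]
          have h1 : ∑ q ∈ Ioc Q Y, (1 : ℝ) / (q : ℝ) ^ 2 ≤ 1 / ((Q : ℕ) : ℝ) := by
            have := sum_Ioc_inv_sq_le_sub (α := ℝ) (k := Q) (n := Y) (by omega) hQY
            simp only [one_div]
            have h0 : (0 : ℝ) ≤ (Y : ℝ)⁻¹ := by positivity
            linarith
          have h2 : ((Y - Q : ℕ) : ℝ) ≤ Y := by exact_mod_cast Nat.sub_le _ _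
          have h3 : ((Y - Q : ℕ) : ℝ) * (6 * (N : ℝ) ^ 2) ≤ Y * (6 * (N : ℝ) ^ 2) := by gcongr
          have h4 : 6 * (N : ℝ) ^ 4 * ∑ q ∈ Ioc Q Y, (1 : ℝ) / (q : ℝ) ^ 2 ≤
              6 * (N : ℝ) ^ 4 * (1 / ((Q : ℕ) : ℝ)) :=
            mul_le_mul_of_nonneg_left h1 (by positivity)
          linarith
  have hcard := (card_le_card hcover).trans ((card_union_le _ _).trans
    (Nat.add_le_add_left (card_union_le _ _) _))
  rw [card_natBox] at hcard
  have hcard' : (N : ℝ) ^ 4 ≤ #S + (#(I.biUnion B) + #L) := by exact_mod_cast hcard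
  have hL' : (#L : ℝ) ≤ (N : ℝ) ^ 3 := by exact_mod_cast hLc
  linarith

/-- Base point of the box around `1000 M N (x³ - 3 x y²)`. -/
def boxVec (M e N : ℤ) : Fin 4 → ℤ :=
  ![1000 * (M * N) + e, 1 - e, -(3000 * (M * N) + e), 0]

lemma boxForm_coeff_bounds {M e : ℤ} {N : ℕ} (hM : 0 < M) (he : 0 ≤ e) (heM : e < M)
    {t : ℕ × ℕ × ℕ × ℕ} (ht : t ∈ natBox N) :
    (1000 * (M * N) ≤ shiftForm M (boxVec M e N) t 0 ∧
      shiftForm M (boxVec M e N) t 0 ≤ 1001 * (M * N)) ∧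
    (-(M * N) ≤ shiftForm M (boxVec M e N) t 1 ∧ shiftForm M (boxVec M e N) t 1 ≤ M * N) ∧
    (-(3001 * (M * N)) ≤ shiftForm M (boxVec M e N) t 2 ∧
      shiftForm M (boxVec M e N) t 2 ≤ -(2999 * (M * N))) ∧
    (0 ≤ shiftForm M (boxVec M e N) t 3 ∧ shiftForm M (boxVec M e N) t 3 ≤ M * N) := by
  obtain ⟨h1, h2, h3, h4⟩ := mem_natBox.1 ht
  have key : ∀ i : ℕ, i < N → M * (i : ℤ) + M ≤ M * N ∧ 0 ≤ M * (i : ℤ) := by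
    intro i hi
    have : (i : ℤ) + 1 ≤ N := by exact_mod_cast hi
    constructor
    · nlinarith
    · positivity
  have k1 := key _ h1
  have k2 := key _ h2
  have k3 := key _ h3
  have k4 := key _ h4
  simp only [shiftForm, boxVec, Matrix.cons_val]
  refine ⟨⟨?_, ?_⟩, ⟨?_, ?_⟩, ⟨?_, ?_⟩, ?_, ?_⟩ <;> linarith

lemma hess_bounds_of_coeff_bounds {c : Fin 4 → ℤ} {w : ℤ} (hw : 0 < w)
    (h0 : 1000 * w ≤ c 0 ∧ c 0 ≤ 1001 * w) (h1 : -w ≤ c 1 ∧ c 1 ≤ w)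
    (h2 : -(3001 * w) ≤ c 2 ∧ c 2 ≤ -(2999 * w)) (h3 : 0 ≤ c 3 ∧ c 3 ≤ w) :
    (8990000 * w ^ 2 ≤ hessA c ∧ hessA c ≤ 9020000 * w ^ 2) ∧
    (-(20000 * w ^ 2) ≤ hessB c ∧ hessB c ≤ 20000 * w ^ 2) ∧
    (8990000 * w ^ 2 ≤ hessC c ∧ hessC c ≤ 9020000 * w ^ 2) := by
  have b2 : c 1 ^ 2 ≤ w ^ 2 := sq_le_sq' h1.1 h1.2
  have b2' : 0 ≤ c 1 ^ 2 := sq_nonneg _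
  have ac1 : 1000 * w * (2999 * w) ≤ c 0 * (-c 2) :=
    mul_le_mul h0.1 (by linarith) (by positivity) (by linarith)
  have ac2 : c 0 * (-c 2) ≤ 1001 * w * (3001 * w) :=
    mul_le_mul h0.2 (by linarith) (by linarith) (by linarith)
  have cc1 : (2999 * w) ^ 2 ≤ (-c 2) ^ 2 := pow_le_pow_left₀ (by linarith) (by linarith) 2
  have cc2 : (-c 2) ^ 2 ≤ (3001 * w) ^ 2 := pow_le_pow_left₀ (by linarith) (by linarith) 2
  have bd : |c 1 * c 3| ≤ w * w := by
    rw [abs_mul]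
    exact mul_le_mul (abs_le.2 h1) (abs_le.2 ⟨by linarith, h3.2⟩) (abs_nonneg _) hw.le
  have bc : |c 1 * c 2| ≤ w * (3001 * w) := by
    rw [abs_mul]
    exact mul_le_mul (abs_le.2 h1) (abs_le.2 ⟨by linarith, by linarith⟩) (abs_nonneg _) hw.le
  have ad1 : 0 ≤ c 0 * c 3 := mul_nonneg (by linarith) h3.1
  have ad2 : c 0 * c 3 ≤ 1001 * w * w := mul_le_mul h0.2 h3.2 h3.1 (by linarith)
  rw [abs_le] at bd bc
  simp only [hessA, hessB, hessC]
  refine ⟨⟨?_, ?_⟩, ⟨?_, ?_⟩, ?_, ?_⟩ <;> nlinarith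

lemma hessVal_bounds_of_hess_bounds {c : Fin 4 → ℤ} {w : ℤ}
    (hA : 8990000 * w ^ 2 ≤ hessA c ∧ hessA c ≤ 9020000 * w ^ 2)
    (hB : -(20000 * w ^ 2) ≤ hessB c ∧ hessB c ≤ 20000 * w ^ 2)
    (hC : 8990000 * w ^ 2 ≤ hessC c ∧ hessC c ≤ 9020000 * w ^ 2) (x y : ℤ) :
    8000000 * w ^ 2 * (x ^ 2 + y ^ 2) ≤ hessVal c x y ∧
      hessVal c x y ≤ 10000000 * w ^ 2 * (x ^ 2 + y ^ 2) := by
  have hxy : |hessB c * (x * y)| ≤ 20000 * w ^ 2 * (x ^ 2 + y ^ 2) := by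
    rw [abs_mul]
    refine mul_le_mul (abs_le.2 hB) ?_ (abs_nonneg _) (by positivity)
    rw [abs_le]
    constructor <;> nlinarith [sq_nonneg (x + y), sq_nonneg (x - y)]
  rw [abs_le] at hxy
  have a1 := mul_le_mul_of_nonneg_right hA.1 (sq_nonneg x)
  have a2 := mul_le_mul_of_nonneg_right hA.2 (sq_nonneg x)
  have c1 := mul_le_mul_of_nonneg_right hC.1 (sq_nonneg y)
  have c2 := mul_le_mul_of_nonneg_right hC.2 (sq_nonneg y)
  have p1 : 0 ≤ w ^ 2 * x ^ 2 := by positivity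
  have p2 : 0 ≤ w ^ 2 * y ^ 2 := by positivity
  rw [hessVal]
  constructor <;> nlinarith

lemma cubicDisc_bounds_of_hess_bounds {c : Fin 4 → ℤ} {w : ℤ} (hw : 0 < w)
    (hA : 8990000 * w ^ 2 ≤ hessA c ∧ hessA c ≤ 9020000 * w ^ 2)
    (hB : -(20000 * w ^ 2) ≤ hessB c ∧ hessB c ≤ 20000 * w ^ 2)
    (hC : 8990000 * w ^ 2 ≤ hessC c ∧ hessC c ≤ 9020000 * w ^ 2) :
    0 < cubicDisc c ∧ cubicDisc c ≤ 200 * (1000 * w) ^ 4 := by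
  have h := hess_disc c
  have hw2 : 0 < w ^ 2 := by positivity
  have hB2 : hessB c ^ 2 ≤ (20000 * w ^ 2) ^ 2 := sq_le_sq' hB.1 hB.2
  have hB0 : 0 ≤ hessB c ^ 2 := sq_nonneg _
  have hAC1 : 8990000 * w ^ 2 * (8990000 * w ^ 2) ≤ hessA c * hessC c :=
    mul_le_mul hA.1 hC.1 (by positivity) (by linarith)
  have hAC2 : hessA c * hessC c ≤ 9020000 * w ^ 2 * (9020000 * w ^ 2) :=
    mul_le_mul hA.2 hC.2 (by linarith) (by positivity)
  have hw4 : 0 < w ^ 4 := by positivity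
  constructor
  · nlinarith
  · nlinarith

end Family

section Congruences

variable {M P e N : ℤ} {t : ℕ × ℕ × ℕ × ℕ}

lemma boxForm_congr (d : ℤ) (hd : d ∣ M) :
    d ∣ shiftForm M (boxVec M e N) t 0 - e ∧ d ∣ shiftForm M (boxVec M e N) t 1 - (1 - e) ∧
    d ∣ shiftForm M (boxVec M e N) t 2 + e ∧ d ∣ shiftForm M (boxVec M e N) t 3 := by
  simp only [shiftForm, boxVec, Matrix.cons_val]
  refine ⟨?_, ?_, ?_, ?_⟩ <;> refine hd.trans ?_
  · exact ⟨1000 * N + t.1, by ring⟩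
  · exact ⟨t.2.1, by ring⟩
  · exact ⟨-3000 * N + t.2.2.1, by ring⟩
  · exact ⟨t.2.2.2, by ring⟩

lemma isSplitMod_boxForm (hPM : P ∣ M) (he : P ∣ e - 1) :
    IsSplitMod (shiftForm M (boxVec M e N) t) P := by
  obtain ⟨h0, h1, h2, h3⟩ := boxForm_congr (M := M) (e := e) (N := N) (t := t) P hPM
  refine ⟨?_, ?_, ?_, h3⟩
  · simpa using dvd_add h0 he
  · have := dvd_sub h1 he
    ring_nf at this
    exact this
  · have := dvd_sub h2 he
    ring_nf at this ⊢
    exact this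

lemma boxForm_dvd {q : ℤ} (hqM : q ∣ M) (he : q ∣ e) :
    q ∣ shiftForm M (boxVec M e N) t 0 ∧ q ∣ shiftForm M (boxVec M e N) t 1 - 1 ∧
    q ∣ shiftForm M (boxVec M e N) t 2 ∧ q ∣ shiftForm M (boxVec M e N) t 3 := by
  obtain ⟨h0, h1, h2, h3⟩ := boxForm_congr (M := M) (e := e) (N := N) (t := t) q hqM
  refine ⟨?_, ?_, ?_, h3⟩
  · simpa using dvd_add h0 he
  · have := dvd_sub h1 he
    ring_nf at this ⊢
    exact this
  · simpa using dvd_sub h2 he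

lemma IsSplitMod.not_hessDvd {c : Fin 4 → ℤ} (hs : IsSplitMod c P) {q : ℕ} (hq : q.Prime)
    (hqP : (q : ℤ) ∣ P) (hq3 : q ≠ 3) : ¬ HessDvd q c := by
  rintro ⟨hA, -⟩
  have h0 := hqP.trans hs.1
  have h1 := hqP.trans hs.2.1
  have h2 := hqP.trans hs.2.2.1
  have h3 : (q : ℤ) ∣ 3 := by
    have e : (3 : ℤ) = hessA c - c 1 * c 1 + 3 * c 2 * (c 0 - 1) + 3 * (c 2 + 1) := by
      simp only [hessA]; ring
    rw [e]
    exact dvd_add (dvd_add (dvd_sub hA (h1.mul_left _)) (h0.mul_left _)) (h2.mul_left _)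
  exact hq3 ((Nat.prime_dvd_prime_iff_eq hq Nat.prime_three).1 (by exact_mod_cast h3))

lemma not_hessDvd_of_dvd {c : Fin 4 → ℤ} {q : ℕ} (hq : q.Prime) (h0 : (q : ℤ) ∣ c 0)
    (h1 : (q : ℤ) ∣ c 1 - 1) : ¬ HessDvd q c := by
  rintro ⟨hA, -⟩
  have h : (q : ℤ) ∣ 1 := by
    have e : (1 : ℤ) = hessA c + 3 * c 2 * c 0 - (c 1 + 1) * (c 1 - 1) := by
      simp only [hessA]; ring
    rw [e]
    exact dvd_sub (dvd_add hA (h0.mul_left _)) (h1.mul_left _)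
  exact hq.one_lt.ne' (by exact_mod_cast Int.eq_one_of_dvd_one (by positivity) h)

lemma exists_congr_one_zero {F : ℤ} (hcop : IsCoprime P F) (hP : 0 < P) (hF : 0 < F) :
    ∃ e : ℤ, 0 ≤ e ∧ e < P * F ∧ P ∣ e - 1 ∧ F ∣ e := by
  obtain ⟨u, v, huv⟩ := hcop
  have hPF : 0 < P * F := mul_pos hP hF
  have hmod := Int.emod_add_mul_ediv (v * F) (P * F)
  refine ⟨v * F % (P * F), Int.emod_nonneg _ hPF.ne', Int.emod_lt_of_pos _ hPF,
    ⟨-u - F * (v * F / (P * F)), ?_⟩, ⟨v - P * (v * F / (P * F)), ?_⟩⟩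
  · linear_combination hmod + huv
  · linear_combination hmod

end Congruences

section Family

lemma boxForm_hess_bounds {M e : ℤ} {N : ℕ} (hM : 0 < M) (he : 0 ≤ e) (heM : e < M) (hN : 0 < N)
    {t : ℕ × ℕ × ℕ × ℕ} (ht : t ∈ natBox N) :
    (8990000 * (M * N) ^ 2 ≤ hessA (shiftForm M (boxVec M e N) t) ∧
      hessA (shiftForm M (boxVec M e N) t) ≤ 9020000 * (M * N) ^ 2) ∧
    (-(20000 * (M * N) ^ 2) ≤ hessB (shiftForm M (boxVec M e N) t) ∧
      hessB (shiftForm M (boxVec M e N) t) ≤ 20000 * (M * N) ^ 2) ∧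
    (8990000 * (M * N) ^ 2 ≤ hessC (shiftForm M (boxVec M e N) t) ∧
      hessC (shiftForm M (boxVec M e N) t) ≤ 9020000 * (M * N) ^ 2) := by
  obtain ⟨h0, h1, h2, h3⟩ := boxForm_coeff_bounds hM he heM ht
  exact hess_bounds_of_coeff_bounds (by positivity) h0 h1 h2 h3

lemma card_hess_primitive_boxForm_ge {M e : ℤ} {N Q : ℕ} (hM : 0 < M) (he : 0 ≤ e) (heM : e < M)
    (hQ0 : 3000 ≤ Q) (hQ : ∀ q : ℕ, q.Prime → q ≤ Q → (q : ℤ) ∣ M)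
    (hNQ : Q ≤ N) (hNM : 60000 * M ≤ N) (S : Finset (ℕ × ℕ × ℕ × ℕ))
    (hS : ∀ t ∈ natBox N, (∀ q : ℕ, q.Prime → ¬ (q : ℤ) ∣ M →
      ¬ HessDvd q (shiftForm M (boxVec M e N) t)) → t ∈ S) :
    (N : ℝ) ^ 4 ≤ 2 * #S := by
  have hN : 0 < N := by omega
  lift M to ℕ using hM.le
  have hM' : 1 ≤ M := by exact_mod_cast hM
  have hw : (0 : ℤ) < M * N := by positivity
  have hMN : N ≤ M * N := Nat.le_mul_of_pos_left _ hM'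
  have key := card_hess_primitive_ge (v := boxVec M e N) (N := N) (Y := 4000 * (M * N)) (Q := Q)
    (by omega) hQ (by omega) (by omega) (by omega) (fun t ht => by
      obtain ⟨h0, -⟩ := boxForm_coeff_bounds hM he heM ht
      obtain ⟨hA, -⟩ := boxForm_hess_bounds hM he heM hN ht
      push_cast
      have hw2 : (0 : ℤ) < (M * N) ^ 2 := by positivity
      refine ⟨by linarith, by linarith, by linarith, ?_⟩
      rw [mul_pow]
      linarith) S hS
  have hQr : (1 : ℝ) / Q ≤ 1 / 3000 := by
    have : (3000 : ℝ) ≤ Q := by exact_mod_cast hQ0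
    gcongr
  have hNMr : 60000 * (M : ℝ) ≤ N := by exact_mod_cast hNM
  have hM1 : (1 : ℝ) ≤ M := by exact_mod_cast hM'
  have h1 : 6 * (N : ℝ) ^ 4 * (1 / Q) ≤ 6 * (N : ℝ) ^ 4 * (1 / 3000) := by gcongr
  have h2 : 60000 * (M : ℝ) * (N : ℝ) ^ 3 ≤ N * (N : ℝ) ^ 3 := by gcongr
  have h3 : 1 * (N : ℝ) ^ 3 ≤ M * (N : ℝ) ^ 3 := by gcongr
  push_cast at key
  nlinarith

lemma neighbourForm_injective {c c' : Fin 4 → ℤ} {P r : ℤ} (hP : P ≠ 0)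
    (hr : P ∣ binEval (n := 3) c r 1) (hr' : P ∣ binEval (n := 3) c' r 1)
    (h : neighbourForm c P r = neighbourForm c' P r) : c = c' := by
  have h0 : c 0 = c' 0 := by
    have := congrFun h 0
    simp only [neighbourForm, Matrix.cons_val] at this
    exact mul_right_cancel₀ (pow_ne_zero 2 hP) this
  have h1 : c 1 = c' 1 := by
    have := congrFun h 1
    simp only [neighbourForm, Matrix.cons_val] at this
    have := mul_left_cancel₀ hP this
    rw [h0] at this
    linarith
  have h2 : c 2 = c' 2 := by
    have := congrFun h 2
    simp only [neighbourForm, Matrix.cons_val] at this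
    rw [h0, h1] at this
    linarith
  have h3 : c 3 = c' 3 := by
    have := congrFun h 3
    simp only [neighbourForm, Matrix.cons_val] at this
    have := (Int.ediv_left_inj hr hr').1 this
    rw [binEval_cubic, binEval_cubic, h0, h1, h2] at this
    linarith
  funext i
  fin_cases i <;> assumption

lemma shiftForm_injective {M : ℤ} (hM : M ≠ 0) (v : Fin 4 → ℤ) :
    Function.Injective (shiftForm M v) := by
  intro t t' h
  have h0 := congrFun h 0
  have h1 := congrFun h 1
  have h2 := congrFun h 2
  have h3 := congrFun h 3
  simp only [shiftForm, Matrix.cons_val, add_right_inj, mul_right_inj' hM, Nat.cast_inj]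
    at h0 h1 h2 h3
  exact Prod.ext h0 (Prod.ext h1 (Prod.ext h2 h3))

lemma abs_le_of_hessVal_neighbourForm_le {c : Fin 4 → ℤ} {P r w : ℤ} (hP : 0 < P) (hw : 0 < w)
    (hr0 : 0 ≤ r) (hrP : r < P) (hr : P ∣ binEval (n := 3) c r 1)
    (hc : ∀ x y : ℤ, 8000000 * w ^ 2 * (x ^ 2 + y ^ 2) ≤ hessVal c x y) {x y : ℤ}
    (h : hessVal (neighbourForm c P r) x y ≤ 32000000 * w ^ 2 * P ^ 2) :
    |x| ≤ 2 * P + 2 ∧ |y| ≤ 2 * P + 2 := by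
  rw [hessVal_neighbourForm hP.ne' hr] at h
  have h1 := (hc _ _).trans h
  have h2 : (P * x + r * y) ^ 2 + y ^ 2 ≤ (2 * P) ^ 2 := by
    refine le_of_mul_le_mul_left (a := 8000000 * w ^ 2) ?_ (by positivity)
    linarith
  have hy : |y| ≤ 2 * P :=
    abs_le_of_sq_le_sq (by nlinarith [sq_nonneg (P * x + r * y)]) (by positivity)
  have hu : |P * x + r * y| ≤ 2 * P :=
    abs_le_of_sq_le_sq (by nlinarith [sq_nonneg y]) (by positivity)
  refine ⟨?_, by linarith⟩
  have hry : |r * y| ≤ P * (2 * P) := by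
    rw [abs_mul, abs_of_nonneg hr0]
    exact mul_le_mul hrP.le hy (abs_nonneg _) hP.le
  have hPx : P * |x| ≤ P * (2 * P + 2) := by
    have e : P * |x| = |(P * x + r * y) - r * y| := by
      rw [add_sub_cancel_right, abs_mul, abs_of_pos hP]
    rw [e]
    exact (abs_sub _ _).trans (by linarith)
  exact le_of_mul_le_mul_left hPx hP

lemma entries_le_of_neighbourForm_eq {c c' : Fin 4 → ℤ} {P r r' w : ℤ} (hP : 0 < P) (hw : 0 < w)
    (hr0 : 0 ≤ r) (hrP : r < P) (hr0' : 0 ≤ r') (hrP' : r' < P)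
    (hr : P ∣ binEval (n := 3) c r 1) (hr' : P ∣ binEval (n := 3) c' r' 1)
    (hc : ∀ x y : ℤ, 8000000 * w ^ 2 * (x ^ 2 + y ^ 2) ≤ hessVal c x y)
    (hc' : ∀ x y : ℤ, hessVal c' x y ≤ 10000000 * w ^ 2 * (x ^ 2 + y ^ 2)) {p q s u : ℤ}
    (hdet : |p * u - q * s| = 1)
    (h : neighbourForm c' P r' = substForm (neighbourForm c P r) p q s u) :
    (|p| ≤ 2 * P + 2 ∧ |s| ≤ 2 * P + 2) ∧ (|q| ≤ 2 * P + 2 ∧ |u| ≤ 2 * P + 2) := by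
  have hdet2 : (p * u - q * s) ^ 2 = 1 := by rw [← sq_abs, hdet, one_pow]
  have key : ∀ x y : ℤ, hessVal (neighbourForm c P r) (p * x + q * y) (s * x + u * y) ≤
      10000000 * w ^ 2 * ((P * x + r' * y) ^ 2 + y ^ 2) := by
    intro x y
    have e : hessVal (neighbourForm c' P r') x y =
        hessVal (neighbourForm c P r) (p * x + q * y) (s * x + u * y) := by
      rw [h, hessVal_substForm, hdet2, one_mul]
    rw [← e, hessVal_neighbourForm hP.ne' hr']
    exact hc' _ _
  have k1 := key 1 0
  have k2 := key 0 1
  simp only [mul_one, mul_zero, add_zero, zero_add] at k1 k2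
  have hw2 : 0 ≤ w ^ 2 := by positivity
  have hr2 : r' ^ 2 ≤ P ^ 2 := pow_le_pow_left₀ hr0' hrP'.le 2
  have hP2 : 1 ≤ P ^ 2 := one_le_pow₀ hP
  have hwP := mul_nonneg hw2 (sq_nonneg P)
  have m1 := mul_le_mul_of_nonneg_left hr2 hw2
  have m2 := mul_le_mul_of_nonneg_left hP2 hw2
  exact ⟨abs_le_of_hessVal_neighbourForm_le hP hw hr0 hrP hr hc (by nlinarith),
    abs_le_of_hessVal_neighbourForm_le hP hw hr0 hrP hr hc (by nlinarith)⟩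

lemma card_fiber_neighbourForm_le {ι : Type*} {P w : ℤ} (hP : 0 < P) (hw : 0 < w) {R : Finset ℤ}
    (hRP : ∀ r ∈ R, 0 ≤ r ∧ r < P) {S : Finset ι} {F : ι → Fin 4 → ℤ}
    (hF : Function.Injective F) {ρ : ι → ℤ} (hρ : ∀ t ∈ S, ρ t ∈ R)
    (hdvd : ∀ t ∈ S, P ∣ binEval (n := 3) (F t) (ρ t) 1)
    (hH : ∀ t ∈ S, ∀ x y : ℤ, 8000000 * w ^ 2 * (x ^ 2 + y ^ 2) ≤ hessVal (F t) x y ∧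
      hessVal (F t) x y ≤ 10000000 * w ^ 2 * (x ^ 2 + y ^ 2))
    (hcl : ∀ t ∈ S, ∀ t' ∈ S, FormEquiv (n := 3) (neighbourForm (F t) P (ρ t))
      (neighbourForm (F t') P (ρ t'))) :
    #S ≤ #R * #(Icc (-(2 * P + 2)) (2 * P + 2)) ^ 4 := by
  classical
  rcases S.eq_empty_or_nonempty with rfl | ⟨t₀, ht₀⟩
  · simp
  set I := Icc (-(2 * P + 2)) (2 * P + 2) with hI
  have hex : ∀ t : ι, ∃ z : ℤ × ℤ × ℤ × ℤ, t ∈ S → z ∈ I ×ˢ I ×ˢ I ×ˢ I ∧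
      neighbourForm (F t) P (ρ t) =
        substForm (neighbourForm (F t₀) P (ρ t₀)) z.1 z.2.1 z.2.2.1 z.2.2.2 := by
    intro t
    by_cases ht : t ∈ S
    · obtain ⟨p, q, s, u, hdet, h⟩ := formEquiv_iff.1 (hcl t₀ ht₀ t ht)
      have hb := entries_le_of_neighbourForm_eq hP hw (hRP _ (hρ _ ht₀)).1 (hRP _ (hρ _ ht₀)).2
        (hRP _ (hρ _ ht)).1 (hRP _ (hρ _ ht)).2 (hdvd _ ht₀) (hdvd _ ht)
        (fun x y => (hH _ ht₀ x y).1) (fun x y => (hH _ ht x y).2) hdet h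
      simp only [abs_le] at hb
      refine ⟨(p, q, s, u), fun _ => ⟨?_, h⟩⟩
      simp only [mem_product, hI, mem_Icc]
      exact ⟨hb.1.1, hb.2.1, hb.1.2, hb.2.2⟩
    · exact ⟨0, fun h => absurd h ht⟩
  choose Z hZ using hex
  have hcard : #(R ×ˢ I ×ˢ I ×ˢ I ×ˢ I) = #R * #I ^ 4 := by
    simp only [card_product]; ring
  rw [← hcard]
  refine card_le_card_of_injOn (fun t => (ρ t, Z t)) (fun t ht => ?_) fun t ht t' ht' h => ?_
  · exact mem_coe.2 (mem_product.2 ⟨hρ t ht, (hZ t ht).1⟩)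
  · obtain ⟨h1, h2⟩ := Prod.mk.inj h
    have e : neighbourForm (F t) P (ρ t) = neighbourForm (F t') P (ρ t') := by
      rw [(hZ t ht).2, (hZ t' ht').2, h2]
    have d := hdvd t' ht'
    rw [← h1] at e d
    exact hF (neighbourForm_injective hP.ne' (hdvd t ht) d e)

/-- A maximal form of positive discriminant which represents `h` locally but not globally. -/
def FailsHasse (h : ℤ) (G : Fin 4 → ℤ) : Prop :=
  IsMaximalForm (n := 3) G ∧ LocallyRep (n := 3) G h ∧ ¬ ∃ x y : ℤ, binEval (n := 3) G x y = h

/-- Many boxed split forms have a neighbour failing the Hasse principle. -/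
lemma exists_failsHasse_neighbours {h : ℤ} (hh : h ≠ 0) : ∃ (P M e : ℤ) (R : Finset ℤ) (N₀ : ℕ),
    0 < P ∧ 0 < M ∧ 0 ≤ e ∧ e < M ∧ (∀ r ∈ R, 0 ≤ r ∧ r < P) ∧ ∀ N : ℕ, N₀ ≤ N → 0 < N ∧
    ∃ S ⊆ natBox N, (N : ℝ) ^ 4 ≤ 2 * #S ∧ ∃ ρ : ℕ × ℕ × ℕ × ℕ → ℤ, ∀ t ∈ S, ρ t ∈ R ∧
      P ∣ binEval (n := 3) (shiftForm M (boxVec M e N) t) (ρ t) 1 ∧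
      FailsHasse h (neighbourForm (shiftForm M (boxVec M e N) t) P (ρ t)) := by
  classical
  set Q := max 3000 h.natAbs with hQdef
  have hQ0 : 3000 ≤ Q := le_max_left _ _
  have hQh : h.natAbs ≤ Q := le_max_right _ _
  obtain ⟨P, hP, hsq, hPQ, R, hR, hRP⟩ := exists_modulus_and_residues Q
  have hcopP : ∀ m : ℤ, (∀ q : ℕ, q.Prime → (q : ℤ) ∣ m → q ≤ Q) → IsCoprime P m := by
    intro m hm
    rw [Int.isCoprime_iff_gcd_eq_one]
    by_contra hg
    obtain ⟨q, hq, hqd⟩ := Nat.exists_prime_and_dvd hg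
    have hq1 : (q : ℤ) ∣ P := (Int.natCast_dvd_natCast.2 hqd).trans (Int.gcd_dvd_left _ _)
    have hq2 : (q : ℤ) ∣ m := (Int.natCast_dvd_natCast.2 hqd).trans (Int.gcd_dvd_right _ _)
    exact absurd (hPQ q hq hq1) (not_lt.2 (hm q hq hq2))
  have hP2 : ¬ (2 : ℤ) ∣ P := by
    intro h2
    have := hPQ 2 Nat.prime_two (by exact_mod_cast h2)
    omega
  have hPh : IsCoprime P h := hcopP h fun q _ hqh =>
    (Nat.le_of_dvd (Int.natAbs_pos.2 hh) (Int.natCast_dvd.1 hqh)).trans hQh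
  have hF : (0 : ℤ) < (Q.factorial : ℤ) := by exact_mod_cast Q.factorial_pos
  have hPF : IsCoprime P (Q.factorial : ℤ) := hcopP _ fun q hq hqF =>
    (hq.dvd_factorial).1 (by exact_mod_cast hqF)
  obtain ⟨e, he0, heM, heP, heF⟩ := exists_congr_one_zero hPF hP hF
  set M := P * (Q.factorial : ℤ) with hMdef
  have hM : 0 < M := mul_pos hP hF
  have hPM : P ∣ M := Dvd.intro _ rfl
  have hFM : (Q.factorial : ℤ) ∣ M := Dvd.intro_left _ rfl
  have hQF : ∀ q : ℕ, q.Prime → q ≤ Q → (q : ℤ) ∣ (Q.factorial : ℤ) := fun q hq hqQ => by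
    exact_mod_cast (hq.dvd_factorial).2 hqQ
  obtain ⟨L₀, hL₀⟩ := card_solutions_le (h * P) (mul_ne_zero hh hP.ne')
  refine ⟨P, M, e, R, max (max Q (60000 * M).toNat) ⌈L₀⌉₊, hP, hM, he0, heM,
    fun r hr => ⟨(hRP r hr).1, (hRP r hr).2.1⟩, fun N hN => ?_⟩
  have hNQ : Q ≤ N := (le_max_left _ _).trans ((le_max_left _ _).trans hN)
  have hNM : 60000 * M ≤ N :=
    Int.toNat_le.1 ((le_max_right _ _).trans ((le_max_left _ _).trans hN))
  have hNL : L₀ ≤ N := (Nat.le_ceil L₀).trans (by exact_mod_cast (le_max_right _ _).trans hN)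
  have hN0 : 0 < N := by omega
  refine ⟨hN0, {t ∈ natBox N | ∀ q : ℕ, q.Prime → ¬ (q : ℤ) ∣ M →
      ¬ HessDvd q (shiftForm M (boxVec M e N) t)}, filter_subset _ _,
    card_hess_primitive_boxForm_ge hM he0 heM hQ0 (fun q hq hqQ => (hQF q hq hqQ).trans hFM)
      hNQ hNM _ fun t ht h => mem_filter.2 ⟨ht, h⟩, ?_⟩
  have hex : ∀ t : ℕ × ℕ × ℕ × ℕ, ∃ r : ℤ, t ∈ ({t ∈ natBox N | ∀ q : ℕ, q.Prime →
      ¬ (q : ℤ) ∣ M → ¬ HessDvd q (shiftForm M (boxVec M e N) t)} : Finset _) → r ∈ R ∧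
      P ∣ binEval (n := 3) (shiftForm M (boxVec M e N) t) r 1 ∧
      FailsHasse h (neighbourForm (shiftForm M (boxVec M e N) t) P r) := by
    intro t
    by_cases ht : t ∈ ({t ∈ natBox N | ∀ q : ℕ, q.Prime →
      ¬ (q : ℤ) ∣ M → ¬ HessDvd q (shiftForm M (boxVec M e N) t)} : Finset _)
    swap
    · exact ⟨0, fun h => absurd h ht⟩
    obtain ⟨htN, hprim⟩ := mem_filter.1 ht
    set c := shiftForm M (boxVec M e N) t with hc
    have hs : IsSplitMod c P := isSplitMod_boxForm hPM heP
    obtain ⟨hA, hB, hC⟩ := boxForm_hess_bounds hM he0 heM hN0 htN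
    have hw : (0 : ℤ) < M * N := by positivity
    have hc0 : c 0 ≠ 0 := by
      have := (boxForm_coeff_bounds hM he0 heM htN).1.1
      linarith
    have hHall : ∀ q : ℕ, q.Prime →
        ¬ ((q : ℤ) ∣ hessA c ∧ (q : ℤ) ∣ hessB c ∧ (q : ℤ) ∣ hessC c) := by
      intro q hq
      by_cases hqQ : q ≤ Q
      · have hd := boxForm_dvd (N := N) (t := t) ((hQF q hq hqQ).trans hFM)
          ((hQF q hq hqQ).trans heF)
        exact not_hessDvd_of_dvd hq hd.1 hd.2.1
      by_cases hqP : (q : ℤ) ∣ P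
      · exact hs.not_hessDvd hq hqP (by omega)
      refine hprim q hq fun hqM => ?_
      rcases (Nat.prime_iff_prime_int.1 hq).dvd_or_dvd hqM with h1 | h1
      · exact hqP h1
      · exact hqQ ((hq.dvd_factorial).1 (by exact_mod_cast h1))
    obtain ⟨hD0, hD1⟩ := cubicDisc_bounds_of_hess_bounds hw hA hB hC
    obtain ⟨r, hrR, hr⟩ := exists_neighbourForm_not_represent hsq hPh hs hR hRP
      (hL₀ (1000 * ((M : ℝ) * N)) (by
        have : (1 : ℝ) ≤ M := by exact_mod_cast hM
        have : (1 : ℝ) * N ≤ M * N := by gcongr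
        have : (0 : ℝ) ≤ N := by positivity
        linarith) c hD0 (by exact_mod_cast hD1) (by nlinarith) (fun x y hxy => by
          have h1 := (hessVal_bounds_of_hess_bounds hA hB hC x y).1
          have h2 : 1 ≤ x ^ 2 + y ^ 2 := by
            by_contra! hlt
            have hx : x = 0 := by nlinarith [sq_nonneg x, sq_nonneg y]
            have hy : y = 0 := by nlinarith [sq_nonneg x, sq_nonneg y]
            exact hxy (by rw [hx, hy]; rfl)
          have h3 : (1000 * (M * N)) ^ 2 ≤ hessVal c x y := by nlinarith [sq_nonneg (M * (N : ℤ))]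
          exact_mod_cast h3))
    refine ⟨r, fun _ => ⟨hrR, hs.dvd_binEval (hRP r hrR).2.2,
      isMaximalForm_neighbourForm hP.ne' hP2 hs (hRP r hrR).2.2 hHall,
      locallyRep_neighbourForm hP.ne' hP2 hs (hRP r hrR).2.2 hc0 hHall fun q hq hqP => ?_, hr⟩⟩
    by_cases hqQ : q ≤ Q
    · exact Or.inl (boxForm_dvd ((hQF q hq hqQ).trans hFM) ((hQF q hq hqQ).trans heF))
    · refine Or.inr ⟨by omega, fun hqh => hqQ ?_⟩
      exact (Nat.le_of_dvd (Int.natAbs_pos.2 hh) (Int.natCast_dvd.1 hqh)).trans hQh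
  choose ρ hρ using hex
  exact ⟨ρ, hρ⟩

end Family

section Counting

lemma exists_failsHasse_classes {h : ℤ} (hh : h ≠ 0) : ∃ (C K : ℝ) (N₀ : ℕ), 0 < C ∧ 0 < K ∧
    ∀ N : ℕ, N₀ ≤ N → 0 < N ∧ ∃ T : Finset (Quot (@FormEquiv 3)), (N : ℝ) ^ 4 ≤ K * #T ∧
      ∀ κ ∈ T, ∃ G : Fin 4 → ℤ, Quot.mk (@FormEquiv 3) G = κ ∧ FailsHasse h G ∧
        ∃ D : ℤ, IsDisc (n := 3) G D ∧ 0 < |D| ∧ ((|D| : ℤ) : ℝ) ≤ C * (N : ℝ) ^ 4 := by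
  classical
  obtain ⟨P, M, e, R, N₀, hP, hM, he, heM, hR, hfam⟩ := exists_failsHasse_neighbours hh
  set k := #R * #(Icc (-(2 * P + 2)) (2 * P + 2)) ^ 4 with hk
  have hPr : (0 : ℝ) < P := by exact_mod_cast hP
  have hMr : (0 : ℝ) < M := by exact_mod_cast hM
  refine ⟨(P : ℝ) ^ 2 * (200 * (1000 * M) ^ 4), 2 * (k + 1), N₀, by positivity, by positivity,
    fun N hN => ?_⟩
  obtain ⟨hN0, S, hSbox, hScard, ρ, hρ⟩ := hfam N hN
  have hw : (0 : ℤ) < M * N := by positivity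
  set F := shiftForm M (boxVec M e N) with hF
  set f := fun t => Quot.mk (@FormEquiv 3) (neighbourForm (F t) P (ρ t)) with hf
  refine ⟨hN0, S.image f, ?_, fun κ hκ => ?_⟩
  · have hfib : (#S : ℝ) ≤ #(S.image f) * (k : ℝ) := by
      refine card_le_mul_of_fiber_le (f := f) le_rfl (by positivity) fun κ _ => ?_
      have := card_fiber_neighbourForm_le hP hw hR (S := {t ∈ S | f t = κ}) (F := F)
        (shiftForm_injective hM.ne' _) (ρ := ρ) (fun t ht => (hρ t (mem_filter.1 ht).1).1)
        (fun t ht => (hρ t (mem_filter.1 ht).1).2.1)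
        (fun t ht => by
          obtain ⟨hA, hB, hC⟩ := boxForm_hess_bounds hM he heM hN0 (hSbox (mem_filter.1 ht).1)
          exact hessVal_bounds_of_hess_bounds hA hB hC)
        (fun t ht t' ht' =>
          quot_mk_eq_iff.1 ((mem_filter.1 ht).2.trans (mem_filter.1 ht').2.symm))
      exact_mod_cast this
    nlinarith [Nat.cast_nonneg (α := ℝ) #(S.image f)]
  · obtain ⟨t, ht, rfl⟩ := mem_image.1 hκ
    obtain ⟨-, hdvd, hfail⟩ := hρ t ht
    refine ⟨_, rfl, hfail, _, isDisc_cubicDisc ?_, ?_⟩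
    · have h0 := (boxForm_coeff_bounds hM he heM (hSbox ht)).1.1
      have hF0 : F t 0 ≠ 0 := by
        have : 0 < F t 0 := by linarith
        exact this.ne'
      simpa [neighbourForm] using ⟨hF0, hP.ne'⟩
    · rw [cubicDisc_neighbourForm hP.ne' hdvd]
      obtain ⟨hA, hB, hC⟩ := boxForm_hess_bounds hM he heM hN0 (hSbox ht)
      obtain ⟨hD0, hD1⟩ := cubicDisc_bounds_of_hess_bounds hw hA hB hC
      have hpos : 0 < P ^ 2 * cubicDisc (F t) := by positivity
      rw [abs_of_pos hpos]
      refine ⟨hpos, ?_⟩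
      have h1 : P ^ 2 * cubicDisc (F t) ≤ P ^ 2 * (200 * (1000 * M) ^ 4) * (N : ℤ) ^ 4 := by
        have := mul_le_mul_of_nonneg_left hD1 (sq_nonneg P)
        linarith
      exact_mod_cast h1

lemma exists_nat_pow_four_between {z : ℝ} (n : ℕ) (hn : 1 ≤ n) (hz : (n : ℝ) ^ 4 ≤ z) :
    ∃ N : ℕ, n ≤ N ∧ (N : ℝ) ^ 4 ≤ z ∧ z ≤ 16 * (N : ℝ) ^ 4 := by
  have hz0 : 0 ≤ z := le_trans (by positivity) hz
  set y := √√z with hy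
  have hy4 : y ^ 4 = z := by
    rw [show y ^ 4 = (y ^ 2) ^ 2 by ring, Real.sq_sqrt (Real.sqrt_nonneg _), Real.sq_sqrt hz0]
  have hy0 : 0 ≤ y := Real.sqrt_nonneg _
  have hny : (n : ℝ) ≤ y := by
    rw [← hy4] at hz
    exact le_of_pow_le_pow_left₀ (by norm_num) hy0 hz
  have hnN : n ≤ ⌊y⌋₊ := Nat.le_floor hny
  have hN1 : (1 : ℝ) ≤ (⌊y⌋₊ : ℕ) := by exact_mod_cast hn.trans hnN
  refine ⟨⌊y⌋₊, hnN, ?_, ?_⟩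
  · rw [← hy4]
    exact pow_le_pow_left₀ (by positivity) (Nat.floor_le hy0) 4
  · have h1 : y ≤ 2 * (⌊y⌋₊ : ℕ) := by linarith [Nat.lt_floor_add_one y]
    calc z = y ^ 4 := hy4.symm
      _ ≤ (2 * ((⌊y⌋₊ : ℕ) : ℝ)) ^ 4 := pow_le_pow_left₀ hy0 h1 4
      _ = _ := by ring

end Counting

/-- a positive proportion of `GL₂(ℤ)`-classes of integral binary cubic forms,
ordered by absolute discriminant, are maximal, locally represent `h` everywhere, but do not
represent `h` over `ℤ`. -/
theorem cubic_thue_fail_hasse_positive_proportion (h : ℤ) (hh : h ≠ 0) :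
    0 < Filter.liminf (fun X : ℝ =>
      (Nat.card (Quot.mk (@FormEquiv 3) ''
        {c : Fin 4 → ℤ | (∃ D : ℤ, IsDisc c D ∧ 0 < |D| ∧ (|D| : ℝ) < X) ∧
          IsMaximalForm c ∧ LocallyRep c h ∧ ¬ ∃ x y : ℤ, binEval c x y = h}) : ℝ) /
      (Nat.card (Quot.mk (@FormEquiv 3) ''
        {c : Fin 4 → ℤ | ∃ D : ℤ, IsDisc c D ∧ 0 < |D| ∧ (|D| : ℝ) < X}) : ℝ))
      Filter.atTop := by
  obtain ⟨C, K, N₀, hC, hK, hcls⟩ := exists_failsHasse_classes hh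
  have hsub : ∀ X : ℝ, Quot.mk (@FormEquiv 3) '' {c : Fin 4 → ℤ |
      (∃ D : ℤ, IsDisc c D ∧ 0 < |D| ∧ (|D| : ℝ) < X) ∧ IsMaximalForm c ∧ LocallyRep c h ∧
        ¬ ∃ x y : ℤ, binEval c x y = h} ⊆ Quot.mk (@FormEquiv 3) ''
      {c : Fin 4 → ℤ | ∃ D : ℤ, IsDisc c D ∧ 0 < |D| ∧ (|D| : ℝ) < X} :=
    fun X => Set.image_mono fun c hc => hc.1
  have hev : ∀ᶠ X : ℝ in Filter.atTop, 1 ≤ X ∧ ((max N₀ 1 : ℕ) : ℝ) ^ 4 ≤ X / (2 * C) := by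
    refine (Filter.eventually_ge_atTop 1).and ?_
    filter_upwards [Filter.eventually_ge_atTop (((max N₀ 1 : ℕ) : ℝ) ^ 4 * (2 * C))] with X hX
    rwa [le_div_iff₀ (by positivity)]
  have hδ : 0 < 1 / (32 * C * K * 1100) := by positivity
  refine hδ.trans_le (Filter.le_liminf_of_le ?_ ?_)
  · refine Filter.IsCoboundedUnder.of_frequently_le (a := 1) (Filter.Eventually.frequently ?_)
    filter_upwards [Filter.eventually_ge_atTop 1] with X hX
    refine div_le_one_of_le₀ ?_ (Nat.cast_nonneg _)
    exact_mod_cast Nat.card_mono (card_classes_le hX).1 (hsub X)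
  · filter_upwards [hev] with X hX
    obtain ⟨hX1, hXN⟩ := hX
    obtain ⟨hfin, hden⟩ := card_classes_le hX1
    obtain ⟨N, hN, hNz, hzN⟩ := exists_nat_pow_four_between _ (le_max_right _ _) hXN
    obtain ⟨hN0, T, hT, hTG⟩ := hcls N ((le_max_left _ _).trans hN)
    have hCN : C * (N : ℝ) ^ 4 < X := by
      rw [le_div_iff₀ (by positivity)] at hNz
      linarith
    have hnum : (#T : ℝ) ≤ Nat.card (Quot.mk (@FormEquiv 3) '' {c : Fin 4 → ℤ |
        (∃ D : ℤ, IsDisc c D ∧ 0 < |D| ∧ (|D| : ℝ) < X) ∧ IsMaximalForm c ∧ LocallyRep c h ∧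
          ¬ ∃ x y : ℤ, binEval c x y = h}) := by
      have := Nat.card_mono (hfin.subset (hsub X)) (s := (T : Set (Quot (@FormEquiv 3)))) (by
        intro κ hκ
        obtain ⟨G, rfl, hG, D, hD, hD0, hD1⟩ := hTG κ hκ
        exact ⟨G, ⟨⟨D, hD, hD0, by push_cast at hD1; exact hD1.trans_lt hCN⟩, hG⟩, rfl⟩)
      rw [Nat.card_coe_set_eq, Set.ncard_coe_finset] at this
      exact_mod_cast this
    have hXT : X ≤ 32 * C * K * #T := by
      rw [div_le_iff₀ (by positivity)] at hzN
      have := mul_le_mul_of_nonneg_left hT (by positivity : 0 ≤ 32 * C)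
      linarith
    have hTpos : 0 < (#T : ℝ) := by
      by_contra! hle
      have : 32 * C * K * (#T : ℝ) ≤ 0 := mul_nonpos_of_nonneg_of_nonpos (by positivity) hle
      linarith
    have hdpos := (hTpos.trans_le hnum).trans_le
      (by exact_mod_cast Nat.card_mono hfin (hsub X) :
        _ ≤ (Nat.card (Quot.mk (@FormEquiv 3) ''
          {c : Fin 4 → ℤ | ∃ D : ℤ, IsDisc c D ∧ 0 < |D| ∧ (|D| : ℝ) < X}) : ℝ))
    rw [div_le_div_iff₀ (by positivity) hdpos]
    have := mul_le_mul_of_nonneg_left hnum (by positivity : 0 ≤ 32 * C * K * 1100)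
    linarith
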